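/- Let n ≥ 1 and m ≥ 1 be integers and let P ⊆ ℝⁿ be a bounded set that is an intersection of at most m DH-half-spaces. Then the limit L = lim_{ε→0⁺} μ_ε(P) exists and satisfies |L| ≤ (m!/2^{m−1}) · (2π^{(n+1)/2}/Γ((n+1)/2)), where Γ is the Gamma function and 2π^{(n+1)/2}/Γ((n+1)/2) is the surface volume V_n(Sⁿ) of the unit n-sphere. (Theorem 1.3: uniform boundedness |V_n(P)| ≤ (m!/2^{m−1}) V_n(Sⁿ).) -/

import Mathlib

open MeasureTheory Filter Metric

variable {n : ℕ} [NeZero n]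

/-- A *DH-half-space* in `ℝⁿ` (upper half-space model of the double hyperbolic space `DHⁿ`):
either a closed ball whose center has first coordinate `0`, or the complement of an open ball
whose center has first coordinate `0`, or a closed affine half-space whose normal vector is
nonzero with first coordinate `0`. -/
def IsDHHalfSpace (H : Set (EuclideanSpace ℝ (Fin n))) : Prop :=
  (∃ (c : EuclideanSpace ℝ (Fin n)) (r : ℝ), 0 < r ∧ c 0 = 0 ∧ H = closedBall c r) ∨
  (∃ (c : EuclideanSpace ℝ (Fin n)) (r : ℝ), 0 < r ∧ c 0 = 0 ∧ H = (ball c r)ᶜ) ∨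
  (∃ (v : EuclideanSpace ℝ (Fin n)) (t : ℝ), v ≠ 0 ∧ v 0 = 0 ∧
    H = {x | t ≤ inner v x (𝕜 := ℝ)})

/-- A *DH-polytope* in `ℝⁿ`: a finite intersection of DH-half-spaces. -/
def IsDHPolytope (P : Set (EuclideanSpace ℝ (Fin n))) : Prop :=
  ∃ S : Finset (Set (EuclideanSpace ℝ (Fin n))), (∀ H ∈ S, IsDHHalfSpace H) ∧ P = ⋂₀ ↑S

/-- `μ_ε(P) = ∫_P (x₀ - εi)^{-n} dx`. -/
noncomputable def dhInt (n : ℕ) [NeZero n] (P : Set (EuclideanSpace ℝ (Fin n))) (ε : ℝ) : ℂ :=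
  ∫ x in P, ((x 0 : ℂ) - (ε : ℂ) * Complex.I) ^ (-(n : ℤ))

open scoped Pointwise Topology

open Classical in
/-- The real-valued indicator of a proposition. -/
noncomputable def ind (p : Prop) : ℝ := if p then 1 else 0

lemma ind_pos {p : Prop} (h : p) : ind p = 1 := if_pos h

lemma ind_neg {p : Prop} (h : ¬p) : ind p = 0 := if_neg h

lemma ind_congr {p q : Prop} (h : p ↔ q) : ind p = ind q := by rw [propext h]

section Sweep

/-- A tie-broken sum over the maximizers of `f` counts whether a given monotone condition holds at
the maximum. -/
lemma sum_argmax_indicator {ι : Type*} [LinearOrder ι] (A : Finset ι) (f : ι → ℝ)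
    (C : ℝ → Prop) :
    (∑ k ∈ A, ind (C (f k) ∧ ∀ j ∈ A, j ≠ k → f j ≤ f k ∧ (j < k → f j < f k))) =
      ind (∃ k ∈ A, C (f k) ∧ ∀ j ∈ A, f j ≤ f k) := by
  by_cases h : ∃ k ∈ A, C (f k) ∧ ∀ j ∈ A, f j ≤ f k
  · rw [ind_pos h]
    obtain ⟨k₀, hk₀, hC, hmax⟩ := h
    have hne : (A.filter fun k => f k = f k₀).Nonempty := ⟨k₀, by simp [hk₀]⟩
    set k := (A.filter fun k => f k = f k₀).min' hne with hk
    have hkm : k ∈ A ∧ f k = f k₀ := by simpa using Finset.min'_mem _ hne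
    rw [Finset.sum_eq_single k]
    · rw [ind_pos]
      refine ⟨hkm.2 ▸ hC, fun j hj hjk => ⟨hkm.2 ▸ hmax j hj, fun hlt => ?_⟩⟩
      refine lt_of_le_of_ne (hkm.2 ▸ hmax j hj) fun he => ?_
      exact absurd (Finset.min'_le (A.filter fun k => f k = f k₀) j
        (by simp [hj, he, hkm.2])) (not_le.2 hlt)
    · intro j hj hjk
      rw [ind_neg]
      rintro ⟨-, hj2⟩
      have h1 := hj2 k hkm.1 hjk.symm
      have h2 := hmax j hj
      rw [← hkm.2] at h2
      have hjf : f j = f k := le_antisymm h2 h1.1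
      have hle : k ≤ j := Finset.min'_le _ j (by simp [hj, hjf, hkm.2])
      exact absurd (h1.2 (lt_of_le_of_ne hle hjk.symm)) (by rw [hjf]; exact lt_irrefl _)
    · intro h'; exact absurd hkm.1 h'
  · rw [ind_neg h]
    refine Finset.sum_eq_zero fun k hk => ind_neg ?_
    rintro ⟨hC, hk2⟩
    refine h ⟨k, hk, hC, fun j hj => ?_⟩
    by_cases hjk : j = k
    · rw [hjk]
    · exact (hk2 j hj hjk).1

/-- Change of an indicator between two times: `e i > 0` makes `τ i` an entrance time, `e i < 0` an
exit time. -/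
lemma sweep_indicator {ι : Type*} [Fintype ι] [LinearOrder ι] (e τ : ι → ℝ) (S : Prop)
    {s₁ s₂ : ℝ} (hs : s₁ < s₂) (h₁ : ∀ i, e i ≠ 0 → τ i ≠ s₁) (h₂ : ∀ i, e i ≠ 0 → τ i ≠ s₂) :
    ind (S ∧ ∀ i, e i * τ i ≤ e i * s₂) -
      ind (S ∧ ∀ i, e i * τ i ≤ e i * s₁) =
    ∑ k, (SignType.sign (e k) : ℝ) * ind ((s₁ < τ k ∧ τ k ≤ s₂) ∧ S ∧ ∀ j, j ≠ k →
      e j * τ j ≤ e j * τ k ∧ (0 < e j * e k ∧ j < k → e j * τ j < e j * τ k)) := by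
  by_cases hS : S
  swap; · simp [hS, ind]
  have ha : ∀ s, (∀ i, e i * τ i ≤ e i * s) ↔
      (∀ i, 0 < e i → τ i ≤ s) ∧ (∀ i, e i < 0 → s ≤ τ i) := by
    intro s
    constructor
    · intro h
      exact ⟨fun i hi => by have := h i; rwa [mul_le_mul_iff_right₀ hi] at this,
        fun i hi => by have := h i; rwa [mul_le_mul_left_of_neg hi] at this⟩
    · rintro ⟨h, h'⟩ i
      rcases lt_trichotomy (e i) 0 with hi | hi | hi
      · rw [mul_le_mul_left_of_neg hi]; exact h' i hi
      · simp [hi]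
      · rw [mul_le_mul_iff_right₀ hi]; exact h i hi
  set A := Finset.univ.filter fun i => 0 < e i with hA
  set B := Finset.univ.filter fun i => e i < 0 with hB
  have key : (∑ k, (SignType.sign (e k) : ℝ) * ind ((s₁ < τ k ∧ τ k ≤ s₂) ∧ S ∧ ∀ j, j ≠ k →
      e j * τ j ≤ e j * τ k ∧ (0 < e j * e k ∧ j < k → e j * τ j < e j * τ k))) =
      (∑ k ∈ A, ind ((s₁ < τ k ∧ τ k ≤ s₂ ∧ ∀ j ∈ B, τ k ≤ τ j) ∧ ∀ j ∈ A, j ≠ k →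
        τ j ≤ τ k ∧ (j < k → τ j < τ k))) -
      ∑ k ∈ B, ind ((s₁ < - -τ k ∧ - -τ k ≤ s₂ ∧ ∀ j ∈ A, τ j ≤ - -τ k) ∧ ∀ j ∈ B, j ≠ k →
        -τ j ≤ -τ k ∧ (j < k → -τ j < -τ k)) := by
    rw [hA, hB, Finset.sum_filter, Finset.sum_filter, ← Finset.sum_sub_distrib]
    refine Finset.sum_congr rfl fun k _ => ?_
    rcases lt_trichotomy (e k) 0 with hk | hk | hk
    · rw [if_neg (not_lt.2 hk.le), if_pos hk, sign_neg hk]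
      simp only [SignType.coe_neg, SignType.coe_one, neg_mul, one_mul,
        zero_sub, neg_inj]
      refine ind_congr ?_
      simp only [Finset.mem_filter, Finset.mem_univ, true_and, hS]
      constructor
      · rintro ⟨h, h'⟩
        refine ⟨⟨by simpa using h.1, by simpa using h.2, fun j hj => ?_⟩, fun j hj hjk => ?_⟩
        · have := (h' j (by rintro rfl; linarith)).1
          rw [mul_le_mul_iff_right₀ hj] at this; simpa using this
        · have := h' j hjk
          rw [mul_le_mul_left_of_neg hj, mul_lt_mul_left_of_neg hj] at this
          exact ⟨neg_le_neg this.1, fun hjk' => neg_lt_neg (this.2 ⟨mul_pos_of_neg_of_neg hj hk, hjk'⟩)⟩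
      · rintro ⟨⟨h1, h2, h3⟩, h4⟩
        refine ⟨⟨by simpa using h1, by simpa using h2⟩, fun j hjk => ?_⟩
        rcases lt_trichotomy (e j) 0 with hj | hj | hj
        · rw [mul_le_mul_left_of_neg hj, mul_lt_mul_left_of_neg hj]
          have := h4 j hj hjk
          exact ⟨neg_le_neg_iff.1 this.1, fun h => neg_lt_neg_iff.1 (this.2 h.2)⟩
        · simp [hj]
        · rw [mul_le_mul_iff_right₀ hj]
          refine ⟨by simpa using h3 j hj, fun h => ?_⟩
          have := mul_neg_of_pos_of_neg hj hk
          linarith [h.1]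
    · simp [hk]
    · rw [if_pos hk, if_neg (not_lt.2 hk.le), sign_pos hk]
      simp only [SignType.coe_one, one_mul, sub_zero]
      refine ind_congr ?_
      simp only [Finset.mem_filter, Finset.mem_univ, true_and, hS]
      constructor
      · rintro ⟨h, h'⟩
        refine ⟨⟨h.1, h.2, fun j hj => ?_⟩, fun j hj hjk => ?_⟩
        · have := (h' j (by rintro rfl; linarith)).1
          rwa [mul_le_mul_left_of_neg hj] at this
        · have := h' j hjk
          rw [mul_le_mul_iff_right₀ hj, mul_lt_mul_iff_right₀ hj] at this
          exact ⟨this.1, fun hjk' => this.2 ⟨mul_pos hj hk, hjk'⟩⟩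
      · rintro ⟨⟨h1, h2, h3⟩, h4⟩
        refine ⟨⟨h1, h2⟩, fun j hjk => ?_⟩
        rcases lt_trichotomy (e j) 0 with hj | hj | hj
        · rw [mul_le_mul_left_of_neg hj]
          refine ⟨h3 j hj, fun h => ?_⟩
          have := mul_neg_of_neg_of_pos hj hk
          linarith [h.1]
        · simp [hj]
        · rw [mul_le_mul_iff_right₀ hj, mul_lt_mul_iff_right₀ hj]
          have := h4 j hj hjk
          exact ⟨this.1, fun h => this.2 h.2⟩
  rw [key, sum_argmax_indicator A τ (fun x => s₁ < x ∧ x ≤ s₂ ∧ ∀ j ∈ B, x ≤ τ j),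
    sum_argmax_indicator B (fun k => -τ k) (fun x => s₁ < -x ∧ -x ≤ s₂ ∧ ∀ j ∈ A, τ j ≤ -x)]
  simp only [hS, true_and, ha]
  have hAm : A = ∅ ∨ ∃ k ∈ A, ∀ j ∈ A, τ j ≤ τ k := by
    rcases A.eq_empty_or_nonempty with h | h
    · exact Or.inl h
    · exact Or.inr (A.exists_max_image τ h)
  have hBm : B = ∅ ∨ ∃ k ∈ B, ∀ j ∈ B, τ k ≤ τ j := by
    rcases B.eq_empty_or_nonempty with h | h
    · exact Or.inl h
    · exact Or.inr (B.exists_min_image τ h)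
  have hA0 : ∀ s, (∀ i, 0 < e i → τ i ≤ s) ↔ ∀ i ∈ A, τ i ≤ s := by simp [hA]
  have hB0 : ∀ s, (∀ i, e i < 0 → s ≤ τ i) ↔ ∀ i ∈ B, s ≤ τ i := by simp [hB]
  have hA1 : ∀ k ∈ A, τ k ≠ s₁ ∧ τ k ≠ s₂ := fun k hk =>
    have hk : 0 < e k := by simpa [hA] using hk
    ⟨h₁ k hk.ne', h₂ k hk.ne'⟩
  have hB1 : ∀ k ∈ B, τ k ≠ s₁ ∧ τ k ≠ s₂ := fun k hk =>
    have hk : e k < 0 := by simpa [hB] using hk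
    ⟨h₁ k hk.ne, h₂ k hk.ne⟩
  simp only [hA0, hB0, neg_neg, neg_le_neg_iff]
  clear_value A B
  have hAe : ∀ C : ℝ → Prop, ∀ k ∈ A, (∀ j ∈ A, τ j ≤ τ k) →
      ((∃ k ∈ A, C (τ k) ∧ ∀ j ∈ A, τ j ≤ τ k) ↔ C (τ k)) := fun C k hk hm =>
    ⟨fun ⟨l, hl, hC, hl'⟩ => by rwa [le_antisymm (hl' k hk) (hm l hl)], fun h => ⟨k, hk, h, hm⟩⟩
  have hBe : ∀ C : ℝ → Prop, ∀ k ∈ B, (∀ j ∈ B, τ k ≤ τ j) →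
      ((∃ k ∈ B, C (τ k) ∧ ∀ j ∈ B, τ k ≤ τ j) ↔ C (τ k)) := fun C k hk hm =>
    ⟨fun ⟨l, hl, hC, hl'⟩ => by rwa [le_antisymm (hm l hl) (hl' k hk)], fun h => ⟨k, hk, h, hm⟩⟩
  have hAl : ∀ k ∈ A, (∀ j ∈ A, τ j ≤ τ k) → ∀ s, (∀ i ∈ A, τ i ≤ s) ↔ τ k ≤ s :=
    fun k hk hm s => ⟨fun h => h k hk, fun h i hi => (hm i hi).trans h⟩
  have hBl : ∀ k ∈ B, (∀ j ∈ B, τ k ≤ τ j) → ∀ s, (∀ i ∈ B, s ≤ τ i) ↔ s ≤ τ k :=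
    fun k hk hm s => ⟨fun h => h k hk, fun h i hi => h.trans (hm i hi)⟩
  rcases hAm with rfl | ⟨k, hk, hkm⟩ <;> rcases hBm with rfl | ⟨l, hl, hlm⟩
  · simp [ind]
  · rw [hBe (fun x => s₁ < x ∧ x ≤ s₂ ∧ ∀ j ∈ (∅ : Finset ι), τ j ≤ x) l hl hlm]
    simp only [hBl l hl hlm]
    have := hB1 l hl
    simp [ind]
    grind
  · rw [hAe (fun x => s₁ < x ∧ x ≤ s₂ ∧ ∀ j ∈ (∅ : Finset ι), x ≤ τ j) k hk hkm]
    simp only [hAl k hk hkm]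
    have := hA1 k hk
    simp [ind]
    grind
  · rw [hBe (fun x => s₁ < x ∧ x ≤ s₂ ∧ ∀ j ∈ A, τ j ≤ x) l hl hlm,
      hAe (fun x => s₁ < x ∧ x ≤ s₂ ∧ ∀ j ∈ B, x ≤ τ j) k hk hkm]
    simp only [hAl k hk hkm, hBl l hl hlm]
    have h3 := hA1 k hk
    have h4 := hB1 l hl
    generalize τ k = M at *
    generalize τ l = m at *
    clear hAe hBe hAl hBl hkm hlm key ha hA0 hB0
    unfold ind
    grind

end Sweep

/-- Slicing of Euclidean space along a unit vector `ν`. -/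
structure IsSlicing {N : ℕ} (ν : EuclideanSpace ℝ (Fin N))
    (i : EuclideanSpace ℝ (Fin (N - 1)) →ₗ[ℝ] EuclideanSpace ℝ (Fin N)) : Prop where
  inner_eq : ∀ z, inner ℝ ν (i z) = 0
  norm_eq : ∀ z, ‖i z‖ = ‖z‖
  surj : ∀ c, inner ℝ ν c = 0 → ∃ z, i z = c
  mp : MeasurePreserving fun p : ℝ × EuclideanSpace ℝ (Fin (N - 1)) => p.1 • ν + i p.2

lemma exists_isSlicing {N : ℕ} {ν : EuclideanSpace ℝ (Fin N)} (hν : ‖ν‖ = 1) :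
    ∃ i, IsSlicing ν i := by
  obtain _ | N := N
  · rw [Subsingleton.elim ν 0] at hν; simp at hν
  have hν0 : ν ≠ 0 := by rintro rfl; simp at hν
  have : Fact (Module.finrank ℝ (EuclideanSpace ℝ (Fin (N + 1))) = N + 1) := ⟨by simp⟩
  let b := OrthonormalBasis.fromOrthogonalSpanSingleton (𝕜 := ℝ) N hν0
  let j : EuclideanSpace ℝ (Fin N) →ₗᵢ[ℝ] EuclideanSpace ℝ (Fin (N + 1)) :=
    (Submodule.subtypeₗᵢ _).comp b.repr.symm.toLinearIsometry
  have hj : ∀ z, inner ℝ ν (j z) = 0 := fun z =>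
    (Submodule.mem_orthogonal_singleton_iff_inner_right).1 (b.repr.symm z).2
  have hn : ∀ (r : ℝ) z, ‖r • ν + j z‖ ^ 2 = r ^ 2 + ‖z‖ ^ 2 := fun r z => by
    rw [norm_add_sq_real, norm_smul, hν, inner_smul_left, hj, j.norm_map]; simp
  let f : WithLp 2 (ℝ × EuclideanSpace ℝ (Fin N)) →ₗᵢ[ℝ] EuclideanSpace ℝ (Fin (N + 1)) :=
    { toFun := fun p => p.fst • ν + j p.snd
      map_add' := fun p q => by simp [add_smul]; abel
      map_smul' := fun r p => by simp [mul_smul]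
      norm_map' := fun p => by
        rw [← sq_eq_sq₀ (norm_nonneg _) (norm_nonneg _)]
        simp only [LinearMap.coe_mk, AddHom.coe_mk]
        rw [hn, WithLp.prod_norm_sq_eq_of_L2]; simp }
  have hfr : Module.finrank ℝ (WithLp 2 (ℝ × EuclideanSpace ℝ (Fin N))) =
      Module.finrank ℝ (EuclideanSpace ℝ (Fin (N + 1))) := by
    rw [(WithLp.linearEquiv 2 ℝ (ℝ × EuclideanSpace ℝ (Fin N))).finrank_eq]
    simp [add_comm]
  let g := f.toLinearIsometryEquiv hfr
  refine ⟨j.toLinearMap, hj, j.norm_map, fun c hc => ?_, ?_⟩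
  · refine ⟨b.repr ⟨c, (Submodule.mem_orthogonal_singleton_iff_inner_right).2 hc⟩, ?_⟩
    simp [j]
  · exact g.measurePreserving.comp (WithLp.volume_preserving_toLp ℝ (EuclideanSpace ℝ (Fin N)))

open Classical in
/-- A chosen parametrization of the hyperplane orthogonal to `ν`. -/
noncomputable def hypEmb {N : ℕ} (ν : EuclideanSpace ℝ (Fin N)) :
    EuclideanSpace ℝ (Fin (N - 1)) →ₗ[ℝ] EuclideanSpace ℝ (Fin N) :=
  if h : ∃ i, IsSlicing ν i then h.choose else 0

lemma isSlicing_hypEmb {N : ℕ} {ν : EuclideanSpace ℝ (Fin N)} (hν : ‖ν‖ = 1) :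
    IsSlicing ν (hypEmb ν) := by
  rw [hypEmb, dif_pos (exists_isSlicing hν)]
  exact (exists_isSlicing hν).choose_spec

lemma IsSlicing.norm_sq {N : ℕ} {ν : EuclideanSpace ℝ (Fin N)} {i} (h : IsSlicing ν i)
    (hν : ‖ν‖ = 1) (r : ℝ) (z) : ‖r • ν + i z‖ ^ 2 = r ^ 2 + ‖z‖ ^ 2 := by
  rw [norm_add_sq_real, norm_smul, hν, inner_smul_left, h.inner_eq, h.norm_eq]; simp

/-- A (possibly strict, possibly degenerate) affine half-space `0 ≤ ⟪nv, x⟫ + c`. -/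
structure Wall (N : ℕ) where
  nv : EuclideanSpace ℝ (Fin N)
  c : ℝ
  strict : Prop

namespace Wall

variable {N : ℕ}

def holds (w : Wall N) (x : EuclideanSpace ℝ (Fin N)) : Prop :=
  0 ≤ inner ℝ w.nv x + w.c ∧ (w.strict → 0 < inner ℝ w.nv x + w.c)

/-- Signed distance from the origin to the boundary. -/
noncomputable def h (w : Wall N) : ℝ := w.c / ‖w.nv‖

noncomputable def unit (w : Wall N) : EuclideanSpace ℝ (Fin N) := ‖w.nv‖⁻¹ • w.nv

lemma norm_unit {w : Wall N} (hw : w.nv ≠ 0) : ‖w.unit‖ = 1 := by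
  rw [unit, norm_smul, norm_inv, norm_norm, inv_mul_cancel₀ (norm_ne_zero_iff.2 hw)]

lemma measurableSet_holds (w : Wall N) : MeasurableSet {x | w.holds x} := by
  have hm : Measurable fun x => inner ℝ w.nv x + w.c := by fun_prop
  by_cases hs : w.strict
  · simp only [holds, hs, true_imp_iff]
    exact (measurableSet_le measurable_const hm).inter (measurableSet_lt measurable_const hm)
  · simp only [holds, hs, false_imp_iff, and_true]
    exact measurableSet_le measurable_const hm

/-- The same wall with its offset rescaled. -/
def scale (w : Wall N) (s : ℝ) : Wall N := ⟨w.nv, w.c * s, w.strict⟩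

end Wall

section Phi

variable {N : ℕ} {ι : Type}

/-- Part of the open ball of squared radius `u` cut out by the walls. -/
def region (K : ι → Wall N) (u : ℝ) : Set (EuclideanSpace ℝ (Fin N)) :=
  {x | (∀ k, (K k).holds x) ∧ ‖x‖ ^ 2 < u}

noncomputable def Phi (K : ι → Wall N) (u : ℝ) : ℝ := volume.real (region K u)

lemma measurableSet_region [Finite ι] (K : ι → Wall N) (u : ℝ) : MeasurableSet (region K u) := by
  have : region K u = (⋂ k, {x | (K k).holds x}) ∩ {x | ‖x‖ ^ 2 < u} := by
    ext x; simp [region]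
  rw [this]
  exact (MeasurableSet.iInter fun k => (K k).measurableSet_holds).inter
    (measurableSet_lt (by fun_prop) measurable_const)

lemma setOf_norm_sq_lt (u : ℝ) :
    {x : EuclideanSpace ℝ (Fin N) | ‖x‖ ^ 2 < u} = ball 0 (Real.sqrt u) := by
  ext x
  simp [Real.lt_sqrt (norm_nonneg x)]

lemma region_subset (K : ι → Wall N) (u : ℝ) : region K u ⊆ ball 0 (Real.sqrt u) :=
  fun _ hx => setOf_norm_sq_lt u ▸ hx.2

lemma region_eq_empty (K : ι → Wall N) {u : ℝ} (hu : u ≤ 0) : region K u = ∅ := by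
  ext x; simp only [region, Set.mem_ofPred_eq, Set.mem_empty_iff_false, iff_false, not_and, not_lt]
  exact fun _ => hu.trans (sq_nonneg _)

lemma Phi_of_nonpos (K : ι → Wall N) {u : ℝ} (hu : u ≤ 0) : Phi K u = 0 := by
  simp [Phi, region_eq_empty K hu]

lemma volume_region_ne_top (K : ι → Wall N) (u : ℝ) : volume (region K u) ≠ ⊤ :=
  measure_ne_top_of_subset (region_subset K u) measure_ball_lt_top.ne

lemma Phi_nonneg (K : ι → Wall N) (u : ℝ) : 0 ≤ Phi K u := measureReal_nonneg

lemma volumeReal_ball_sqrt (N : ℕ) {u : ℝ} (hu : 0 < u) :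
    volume.real (ball (0 : EuclideanSpace ℝ (Fin N)) (Real.sqrt u)) =
      Real.sqrt u ^ N * volume.real (ball (0 : EuclideanSpace ℝ (Fin N)) 1) := by
  rw [measureReal_def, Measure.addHaar_ball_of_pos _ _ (Real.sqrt_pos.2 hu), ENNReal.toReal_mul,
    ENNReal.toReal_ofReal (by positivity), measureReal_def]
  simp

lemma Phi_le (K : ι → Wall N) (u : ℝ) :
    Phi K u ≤ Real.sqrt u ^ N * volume.real (ball (0 : EuclideanSpace ℝ (Fin N)) 1) := by
  rcases le_or_gt u 0 with hu | hu
  · rw [Phi_of_nonpos K hu]; positivity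
  rw [← volumeReal_ball_sqrt N hu]
  exact measureReal_mono (region_subset K u) measure_ball_lt_top.ne

/-- Scaling: the unit ball cut by the walls dilated by `s`. -/
lemma volumeReal_scale (K : ι → Wall N) {s : ℝ} (hs : 0 < s) (v : ℝ) :
    volume.real (region (fun k => (K k).scale s) (s ^ 2 * v)) = s ^ N * Phi K v := by
  have : region (fun k => (K k).scale s) (s ^ 2 * v) = s • region K v := by
    ext x
    rw [Set.mem_smul_set_iff_inv_smul_mem₀ hs.ne']
    have h1 : ∀ k, inner ℝ (K k).nv (s⁻¹ • x) + (K k).c =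
        s⁻¹ * (inner ℝ (K k).nv x + (K k).c * s) := fun k => by
      rw [inner_smul_right]; field_simp
    simp only [region, Set.mem_ofPred_eq, Wall.holds, Wall.scale, h1, norm_smul, mul_pow]
    have hs' : 0 < s⁻¹ := inv_pos.2 hs
    simp only [mul_nonneg_iff_of_pos_left hs', mul_pos_iff_of_pos_left hs', norm_inv,
      Real.norm_eq_abs, abs_of_pos hs, inv_pow]
    rw [inv_mul_lt_iff₀ (by positivity)]
  rw [this, Phi, measureReal_def, Measure.addHaar_smul, ENNReal.toReal_mul, measureReal_def]
  rw [ENNReal.toReal_ofReal (abs_nonneg _), finrank_euclideanSpace_fin, abs_of_pos (by positivity)]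

end Phi

section Euler

lemma measurable_ind {α : Type*} [MeasurableSpace α] {p : α → Prop} (hp : MeasurableSet {x | p x}) :
    Measurable fun x => ind (p x) := by
  classical
  exact Measurable.ite hp measurable_const measurable_const

lemma ind_eq_indicator {α : Type*} (p : α → Prop) :
    (fun x => ind (p x)) = Set.indicator {x | p x} 1 := by
  ext x; by_cases h : p x <;> simp [ind, h]

lemma integral_ind {α : Type*} [MeasurableSpace α] {μ : Measure α} {p : α → Prop}
    (hp : MeasurableSet {x | p x}) : ∫ x, ind (p x) ∂μ = μ.real {x | p x} := by
  rw [ind_eq_indicator, integral_indicator_one hp]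

lemma integrable_ind {α : Type*} [MeasurableSpace α] {μ : Measure α} {p : α → Prop}
    (hp : MeasurableSet {x | p x}) (hf : μ {x | p x} ≠ ⊤) : Integrable (fun x => ind (p x)) μ := by
  rw [ind_eq_indicator, integrable_indicator_iff hp]
  exact integrableOn_const hf

lemma integral_ind_mem {α : Type*} [MeasurableSpace α] {μ : Measure α} {s : Set α}
    (hs : MeasurableSet s) : ∫ x, ind (x ∈ s) ∂μ = μ.real s :=
  integral_ind (p := fun x => x ∈ s) hs

lemma integrable_ind_mem {α : Type*} [MeasurableSpace α] {μ : Measure α} {s : Set α}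
    (hs : MeasurableSet s) (hf : μ s ≠ ⊤) : Integrable (fun x => ind (x ∈ s)) μ :=
  integrable_ind (p := fun x => x ∈ s) hs hf

lemma volume_hyperplane {N : ℕ} {v : EuclideanSpace ℝ (Fin N)} (hv : v ≠ 0) (t : ℝ) :
    volume {x : EuclideanSpace ℝ (Fin N) | inner ℝ v x = t} = 0 := by
  have hv2 : ‖v‖ ^ 2 ≠ 0 := by simpa using hv
  let A : AffineSubspace ℝ (EuclideanSpace ℝ (Fin N)) :=
    { carrier := {x | inner ℝ v x = t}
      smul_vsub_vadd_mem' := fun c p₁ p₂ p₃ h1 h2 h3 => by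
        simp only [Set.mem_ofPred_eq] at *
        simp [inner_add_right, inner_smul_right, inner_sub_right, h1, h2, h3] }
  refine Measure.addHaar_affineSubspace volume A fun h => ?_
  have h1 : ∀ x, inner ℝ v x = t := fun x => by
    have : x ∈ A := h ▸ AffineSubspace.mem_top ℝ _ x
    exact this
  have h2 := h1 0
  have h3 := h1 v
  rw [inner_zero_right] at h2
  rw [real_inner_self_eq_norm_sq, ← h2] at h3
  exact hv2 h3

variable {N : ℕ} {ι : Type}

/-- Time at which the `k`-th scaled wall passes through `x`. -/
noncomputable def crossTime (K : ι → Wall N) (x : EuclideanSpace ℝ (Fin N)) (k : ι) : ℝ :=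
  -inner ℝ (K k).nv x / (K k).c

lemma measurable_crossTime (K : ι → Wall N) (k : ι) : Measurable fun x => crossTime K x k := by
  unfold crossTime; fun_prop

lemma ae_crossTime_ne [Finite ι] (K : ι → Wall N) {s : ℝ} (hs : s ≠ 0) :
    ∀ᵐ x, ∀ i, (K i).c ≠ 0 → crossTime K x i ≠ s := by
  refine ae_all_iff.2 fun i => ?_
  by_cases hc : (K i).c = 0
  · simp [hc]
  by_cases hn : (K i).nv = 0
  · simp [crossTime, hn, hs.symm]
  have : volume {x : EuclideanSpace ℝ (Fin N) | inner ℝ (K i).nv x = -((K i).c * s)} = 0 :=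
    volume_hyperplane hn _
  filter_upwards [compl_mem_ae_iff.2 this] with x hx _ h
  refine hx ?_
  rw [crossTime, div_eq_iff hc] at h
  simp only [Set.mem_ofPred_eq]
  linarith

lemma ind_region_scale (K : ι → Wall N) {s : ℝ} (x : EuclideanSpace ℝ (Fin N))
    (hx : ∀ i, (K i).c ≠ 0 → crossTime K x i ≠ s) :
    ind (x ∈ region (fun k => (K k).scale s) 1) =
      ind (((∀ j, (K j).c = 0 → (K j).holds x) ∧ ‖x‖ ^ 2 < 1) ∧
        ∀ i, (K i).c * crossTime K x i ≤ (K i).c * s) := by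
  refine ind_congr ?_
  simp only [region, Set.mem_ofPred_eq, Wall.holds, Wall.scale]
  have hc : ∀ i, (K i).c ≠ 0 → (K i).c * crossTime K x i = - inner ℝ (K i).nv x := fun i hi => by
    rw [crossTime]; field_simp
  constructor
  · rintro ⟨h, hb⟩
    refine ⟨⟨fun j hj => by simpa [hj] using h j, hb⟩, fun i => ?_⟩
    by_cases hi : (K i).c = 0
    · simp [hi]
    · rw [hc i hi]; linarith [(h i).1]
  · rintro ⟨⟨h, hb⟩, h2⟩
    refine ⟨fun k => ?_, hb⟩
    by_cases hk : (K k).c = 0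
    · simpa [hk] using h k hk
    · have h3 := h2 k
      have h4 : (K k).c * crossTime K x k ≠ (K k).c * s := fun h => hx k hk (mul_left_cancel₀ hk h)
      have h5 := lt_of_le_of_ne h3 h4
      rw [hc k hk] at h5
      exact ⟨by linarith, fun _ => by linarith⟩

variable [LinearOrder ι]

/-- The walls induced on the (unit-offset) hyperplane bounding the `k`-th wall. -/
noncomputable def face (K : ι → Wall N) (k : ι) : {j // j ≠ k} → Wall (N - 1) := fun j =>
  { nv := LinearMap.adjoint (hypEmb (K k).unit) (K j).nv
    c := (K j).c - (K k).h * inner ℝ (K j).nv (K k).unit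
    strict := ((K j).c = 0 ∧ (K j).strict) ∨ (0 < (K j).c * (K k).c ∧ (j : ι) < k) }

/-- Points swept by the `k`-th wall between two times. -/
def swept (K : ι → Wall N) (k : ι) (s₁ s₂ : ℝ) : Set (EuclideanSpace ℝ (Fin N)) :=
  {x | (s₁ < crossTime K x k ∧ crossTime K x k ≤ s₂) ∧
    ((∀ j, (K j).c = 0 → (K j).holds x) ∧ ‖x‖ ^ 2 < 1) ∧
    ∀ j, j ≠ k → (K j).c * crossTime K x j ≤ (K j).c * crossTime K x k ∧
      (0 < (K j).c * (K k).c ∧ j < k → (K j).c * crossTime K x j < (K j).c * crossTime K x k)}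

lemma measurableSet_swept [Finite ι] (K : ι → Wall N) (k : ι) (s₁ s₂ : ℝ) :
    MeasurableSet (swept K k s₁ s₂) := by
  have hm := measurable_crossTime K
  have h1 := fun j => (K j).measurableSet_holds
  have hn : Measurable fun x : EuclideanSpace ℝ (Fin N) => ‖x‖ ^ 2 := by fun_prop
  refine measurableSet_setOfPred.2 (.and (.and ?_ ?_) (.and (.and ?_ ?_) ?_))
  · exact measurableSet_setOfPred.1 (measurableSet_lt measurable_const (hm k))
  · exact measurableSet_setOfPred.1 (measurableSet_le (hm k) measurable_const)
  · exact .forall fun j => .imp measurable_const (measurableSet_setOfPred.1 (h1 j))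
  · exact measurableSet_setOfPred.1 (measurableSet_lt hn measurable_const)
  · exact .forall fun j => .imp measurable_const (.and
      (measurableSet_setOfPred.1 (measurableSet_le ((hm j).const_mul _) ((hm k).const_mul _)))
      (.imp measurable_const
        (measurableSet_setOfPred.1 (measurableSet_lt ((hm j).const_mul _) ((hm k).const_mul _)))))

lemma volume_swept_ne_top (K : ι → Wall N) (k : ι) (s₁ s₂ : ℝ) :
    volume (swept K k s₁ s₂) ≠ ⊤ := by
  have : swept K k s₁ s₂ ⊆ ball 0 (Real.sqrt 1) := fun x hx => by
    rw [← setOf_norm_sq_lt]; exact hx.2.1.2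
  exact measure_ne_top_of_subset this measure_ball_lt_top.ne

lemma swept_slice (K : ι → Wall N) {k : ι} (hc : (K k).c ≠ 0) (hn : (K k).nv ≠ 0) {s₁ s₂ : ℝ}
    (hs : 0 < s₁) {τ : ℝ} (h1 : s₁ < τ) (h2 : τ ≤ s₂) :
    {z | (-τ * (K k).h) • (K k).unit + hypEmb (K k).unit z ∈ swept K k s₁ s₂} =
      region (fun j => (face K k j).scale τ) (τ ^ 2 * ((τ ^ 2)⁻¹ - (K k).h ^ 2)) := by
  have hτ : 0 < τ := hs.trans h1
  have hν := Wall.norm_unit hn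
  have hsl := isSlicing_hypEmb hν
  have hn' : ‖(K k).nv‖ ≠ 0 := norm_ne_zero_iff.2 hn
  have hkν : (K k).nv = ‖(K k).nv‖ • (K k).unit := by
    rw [Wall.unit, smul_smul, mul_inv_cancel₀ hn', one_smul]
  ext z
  rw [Set.mem_ofPred_eq]
  set x := (-τ * (K k).h) • (K k).unit + hypEmb (K k).unit z with hx
  have hct : crossTime K x k = τ := by
    have : inner ℝ (K k).nv x = -τ * (K k).c := by
      rw [hx]
      nth_rewrite 1 [hkν]
      rw [inner_smul_left, inner_add_right, hsl.inner_eq, inner_smul_right,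
        real_inner_self_eq_norm_sq, hν, Wall.h]
      simp; field_simp
    rw [crossTime, this]; field_simp
  have hj : ∀ j, inner ℝ (K j).nv x = inner ℝ (LinearMap.adjoint (hypEmb (K k).unit) (K j).nv) z
      - (K k).h * inner ℝ (K j).nv (K k).unit * τ := fun j => by
    rw [LinearMap.adjoint_inner_left, hx, inner_add_right, inner_smul_right]; ring
  have hnx : ‖x‖ ^ 2 < 1 ↔ ‖z‖ ^ 2 < τ ^ 2 * ((τ ^ 2)⁻¹ - (K k).h ^ 2) := by
    rw [hx, hsl.norm_sq hν, mul_sub, mul_inv_cancel₀ (by positivity)]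
    constructor <;> intro h <;> linarith
  have hcj : ∀ j, (K j).c ≠ 0 → (K j).c * crossTime K x j = - inner ℝ (K j).nv x := fun j hj => by
    rw [crossTime]; field_simp
  simp only [swept, region, Set.mem_ofPred_eq, hct, h1, h2, true_and, hnx]
  rw [and_assoc, and_comm (b := ∀ j, j ≠ k → _), ← and_assoc, and_congr_left_iff]
  intro _
  simp only [Wall.holds, Wall.scale, face, Subtype.forall]
  constructor
  · rintro ⟨ha, hb⟩ j hjk
    by_cases h0 : (K j).c = 0
    · have := ha j h0
      rw [h0, hj] at this
      rw [h0]
      refine ⟨by linarith [this.1], fun h => ?_⟩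
      simp at h
      linarith [this.2 h]
    · have := hb j hjk
      rw [hcj j h0, hj] at this
      refine ⟨by linarith [this.1], fun h => ?_⟩
      simp [h0] at h
      linarith [this.2 h]
  · intro h
    refine ⟨fun j h0 => ?_, fun j hjk => ?_⟩
    · have hjk : j ≠ k := by rintro rfl; exact hc h0
      have := h j hjk
      rw [h0] at this ⊢
      rw [hj]
      refine ⟨by linarith [this.1], fun h' => ?_⟩
      linarith [this.2 (by simp [h'])]
    · by_cases h0 : (K j).c = 0
      · simp [h0]
      · rw [hcj j h0, hj]
        have := h j hjk
        refine ⟨by linarith [this.1], fun h' => ?_⟩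
        linarith [this.2 (by simp [h'])]

lemma sign_mul_swept [Finite ι] (K : ι → Wall N) (k : ι) {s₁ s₂ : ℝ} (hs : 0 < s₁) (h12 : s₁ ≤ s₂) :
    (SignType.sign (K k).c : ℝ) * volume.real (swept K k s₁ s₂) =
      (K k).h * ∫ τ in s₁..s₂, τ ^ (N - 1) * Phi (face K k) ((τ ^ 2)⁻¹ - (K k).h ^ 2) := by
  by_cases hc : (K k).c = 0
  · simp [hc, Wall.h]
  by_cases hn : (K k).nv = 0
  · have : swept K k s₁ s₂ = ∅ := by
      ext x
      simp only [swept, crossTime, hn, Set.mem_ofPred_eq, Set.mem_empty_iff_false, iff_false]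
      rintro ⟨⟨h, -⟩, -⟩
      simp at h; linarith
    rw [this]; simp [Wall.h, hn]
  have hν := Wall.norm_unit hn
  have hsl := isSlicing_hypEmb hν
  have hh : (K k).h ≠ 0 := div_ne_zero hc (norm_ne_zero_iff.2 hn)
  set h := (K k).h with hh_def
  set G : ℝ → ℝ := fun τ => τ ^ (N - 1) * Phi (face K k) ((τ ^ 2)⁻¹ - h ^ 2) with hG
  have hmeas := measurableSet_swept K k s₁ s₂
  set T := (fun p : ℝ × EuclideanSpace ℝ (Fin (N - 1)) => p.1 • (K k).unit +
    hypEmb (K k).unit p.2) ⁻¹' swept K k s₁ s₂ with hT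
  have hTm : MeasurableSet T := hsl.mp.measurable hmeas
  have hv : volume (swept K k s₁ s₂) = volume T :=
    (hsl.mp.measure_preimage hmeas.nullMeasurableSet).symm
  have hslice : ∀ r : ℝ, (volume (Prod.mk r ⁻¹' T)).toReal =
      (Set.Ioc s₁ s₂).indicator G ((-h⁻¹) * r) := by
    intro r
    have hr : r = -(-h⁻¹ * r) * h := by field_simp
    have hu : (K k).unit = (‖(K k).nv‖)⁻¹ • (K k).nv := rfl
    by_cases hτ : -h⁻¹ * r ∈ Set.Ioc s₁ s₂
    · rw [Set.indicator_of_mem hτ, hG]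
      dsimp only
      rw [← volumeReal_scale _ (hs.trans hτ.1), ← swept_slice K hc hn hs hτ.1 hτ.2, ← hh_def, ← hr]
      rfl
    · rw [Set.indicator_of_notMem hτ]
      have : Prod.mk r ⁻¹' T = ∅ := by
        ext z
        simp only [hT, Set.mem_preimage, Set.mem_empty_iff_false, iff_false]
        rintro ⟨hz, -⟩
        refine hτ ?_
        have : crossTime K (r • (K k).unit + hypEmb (K k).unit z) k = -h⁻¹ * r := by
          have h1 : (K k).nv = ‖(K k).nv‖ • (K k).unit := by
            rw [Wall.unit, smul_smul, mul_inv_cancel₀ (norm_ne_zero_iff.2 hn), one_smul]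
          have : inner ℝ (K k).nv (r • (K k).unit + hypEmb (K k).unit z) = ‖(K k).nv‖ * r := by
            nth_rewrite 1 [h1]
            rw [inner_smul_left, inner_add_right, hsl.inner_eq, inner_smul_right,
              real_inner_self_eq_norm_sq, hν]
            simp
          rw [crossTime, this, hh_def, Wall.h]
          field_simp
        rw [← this]; exact hz
      simp [this]
  have hfin : volume T ≠ ⊤ := hv ▸ volume_swept_ne_top K k s₁ s₂
  have hvol : volume.real (swept K k s₁ s₂) = ∫ r, (Set.Ioc s₁ s₂).indicator G ((-h⁻¹) * r) := by
    simp_rw [← hslice]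
    rw [measureReal_def, hv, Measure.volume_eq_prod, Measure.prod_apply hTm, integral_toReal]
    · exact (measurable_measure_prodMk_left hTm).aemeasurable
    · rw [Measure.volume_eq_prod] at hfin
      exact Measure.ae_measure_lt_top hTm hfin
  rw [hvol, Measure.integral_comp_mul_left, integral_indicator measurableSet_Ioc,
    ← intervalIntegral.integral_of_le h12]
  simp only [smul_eq_mul, inv_neg, inv_inv, abs_neg, ← mul_assoc]
  congr 1
  have hsg : SignType.sign (K k).c = SignType.sign h := by
    rw [hh_def, Wall.h, div_eq_mul_inv, sign_mul, sign_pos (inv_pos.2 (norm_pos_iff.2 hn)), mul_one]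
  rw [hsg, sign_mul_abs]

lemma euler_sweep [Fintype ι] (K : ι → Wall N) {s₁ s₂ : ℝ} (hs : 0 < s₁) (h12 : s₁ ≤ s₂) :
    s₂ ^ N * Phi K (s₂ ^ 2)⁻¹ - s₁ ^ N * Phi K (s₁ ^ 2)⁻¹ =
      ∑ k, (K k).h * ∫ τ in s₁..s₂, τ ^ (N - 1) * Phi (face K k) ((τ ^ 2)⁻¹ - (K k).h ^ 2) := by
  rcases h12.eq_or_lt with rfl | h12
  · simp
  have hs2 : 0 < s₂ := hs.trans h12
  have hG : ∀ s, 0 < s → s ^ N * Phi K (s ^ 2)⁻¹ =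
      ∫ x, ind (x ∈ region (fun k => (K k).scale s) 1) := fun s hs => by
    rw [← volumeReal_scale K hs, mul_inv_cancel₀ (by positivity)]
    exact (integral_ind_mem (measurableSet_region _ 1)).symm
  rw [hG s₁ hs, hG s₂ hs2, ← integral_sub (integrable_ind_mem (measurableSet_region _ 1)
    (volume_region_ne_top _ _)) (integrable_ind_mem (measurableSet_region _ 1)
    (volume_region_ne_top _ _))]
  calc _ = ∫ x, ∑ k, (SignType.sign (K k).c : ℝ) * ind (x ∈ swept K k s₁ s₂) := by
        refine integral_congr_ae ?_
        filter_upwards [ae_crossTime_ne K hs.ne', ae_crossTime_ne K hs2.ne'] with x h1 h2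
        rw [ind_region_scale K x h1, ind_region_scale K x h2]
        exact sweep_indicator (fun i => (K i).c) (crossTime K x) _ h12 h1 h2
    _ = ∑ k, (SignType.sign (K k).c : ℝ) * volume.real (swept K k s₁ s₂) := by
        rw [integral_finsetSum _ fun k _ => (integrable_ind_mem (measurableSet_swept K k s₁ s₂)
          (volume_swept_ne_top K k s₁ s₂)).const_mul _]
        refine Finset.sum_congr rfl fun k _ => ?_
        rw [integral_const_mul, integral_ind_mem (measurableSet_swept K k s₁ s₂)]
    _ = _ := Finset.sum_congr rfl fun k _ => sign_mul_swept K k hs h12.le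

end Euler

section Tower

variable {N : ℕ} {ι : Type}

lemma Phi_mono (K : ι → Wall N) : Monotone (Phi K) := fun _ _ h =>
  measureReal_mono (fun _ hx => ⟨hx.1, hx.2.trans_le h⟩) (volume_region_ne_top _ _)

lemma continuousWithinAt_Phi [Finite ι] (K : ι → Wall N) (u : ℝ) :
    ContinuousWithinAt (Phi K) (Set.Iic u) u := by
  have h : ∀ v, Phi K v = ∫ x, ind (x ∈ region K v) := fun v =>
    (integral_ind_mem (measurableSet_region K v)).symm
  rw [ContinuousWithinAt, h u, tendsto_congr h]
  refine tendsto_integral_filter_of_dominated_convergence (fun x => ind (x ∈ region K u)) ?_ ?_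
    (integrable_ind_mem (measurableSet_region K u) (volume_region_ne_top K u)) ?_
  · exact .of_forall fun v => (measurable_ind (measurableSet_region K v)).aestronglyMeasurable
  · filter_upwards [self_mem_nhdsWithin] with v hv
    refine .of_forall fun x => ?_
    by_cases hx : x ∈ region K v
    · rw [ind_pos hx, ind_pos ⟨hx.1, hx.2.trans_le hv⟩]; simp
    · rw [ind_neg hx, ind]; split_ifs <;> simp
  · refine .of_forall fun x => tendsto_nhds_of_eventually_eq ?_
    by_cases hx : x ∈ region K u
    · filter_upwards [mem_nhdsWithin_of_mem_nhds (lt_mem_nhds hx.2)] with v hv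
      rw [ind_pos hx, ind_pos ⟨hx.1, hv⟩]
    · filter_upwards [self_mem_nhdsWithin] with v hv
      rw [ind_neg hx, ind_neg fun h => hx ⟨h.1, h.2.trans_le hv⟩]

variable [LinearOrder ι]

/-- Integrand in the sweeping formula. -/
noncomputable def sweepDensity (K : ι → Wall N) (k : ι) (τ : ℝ) : ℝ :=
  τ ^ (N - 1) * Phi (face K k) ((τ ^ 2)⁻¹ - (K k).h ^ 2)

lemma intervalIntegrable_sweepDensity (K : ι → Wall N) (k : ι) {a b : ℝ} (ha : 0 < a)
    (hb : 0 < b) : IntervalIntegrable (sweepDensity K k) volume a b := by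
  refine IntervalIntegrable.continuousOn_mul ?_ (by fun_prop)
  refine AntitoneOn.intervalIntegrable fun x hx y _ hxy => Phi_mono _ ?_
  have hx0 : 0 < x := (lt_min ha hb).trans_le hx.1
  gcongr

lemma continuousWithinAt_sweepDensity [Finite ι] (K : ι → Wall N) (k : ι) {s : ℝ} (hs : 0 < s) :
    ContinuousWithinAt (sweepDensity K k) (Set.Ici s) s := by
  refine ContinuousWithinAt.mul (by fun_prop) ?_
  refine ContinuousWithinAt.comp (g := Phi (face K k))
    (f := fun τ : ℝ => (τ ^ 2)⁻¹ - (K k).h ^ 2) (continuousWithinAt_Phi (face K k) _) ?_ ?_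
  · exact ((continuousAt_id.pow 2).inv₀ (pow_pos hs 2).ne').sub continuousAt_const
      |>.continuousWithinAt
  · intro x hx
    simp only [Set.mem_Iic, Set.mem_Ici] at *
    gcongr

variable [Fintype ι]

lemma Phi_eq_sweep (K : ι → Wall N) {a : ℝ} (ha : 0 < a) {u : ℝ} (hu : 0 < u)
    (hau : a ≤ (√u)⁻¹) :
    Phi K u = √u ^ N * (a ^ N * Phi K (a ^ 2)⁻¹ +
      ∑ k, (K k).h * ∫ τ in a..(√u)⁻¹, sweepDensity K k τ) := by
  have h := euler_sweep K ha hau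
  have hu' : 0 < √u := Real.sqrt_pos.2 hu
  rw [inv_pow (√u) 2, inv_inv, Real.sq_sqrt hu.le, sub_eq_iff_eq_add, add_comm] at h
  unfold sweepDensity
  rw [← h, inv_pow, ← mul_assoc, mul_inv_cancel₀ (by positivity), one_mul]

lemma continuousOn_Phi (K : ι → Wall N) : ContinuousOn (Phi K) (Set.Ioi 0) := by
  intro u hu
  have hu : 0 < u := hu
  refine ContinuousAt.continuousWithinAt ?_
  set a := (√(2 * u))⁻¹ with ha_def
  have ha : 0 < a := by positivity
  set b := (√(u / 2))⁻¹ with hb_def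
  have hb : 0 < b := by positivity
  have hmem : Set.Ioo (u / 2) (2 * u) ∈ 𝓝 u := Ioo_mem_nhds (by linarith) (by linarith)
  have hc : ContinuousOn (fun u => √u ^ N * (a ^ N * Phi K (a ^ 2)⁻¹ +
      ∑ k, (K k).h * ∫ τ in a..(√u)⁻¹, sweepDensity K k τ)) (Set.Ioo (u / 2) (2 * u)) := by
    have hinv : ContinuousOn (fun u : ℝ => (√u)⁻¹) (Set.Ioo (u / 2) (2 * u)) := by
      refine ContinuousOn.inv₀ (by fun_prop) fun x hx => ?_
      have : 0 < x := by linarith [hx.1]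
      positivity
    refine ContinuousOn.mul (by fun_prop) (continuousOn_const.add ?_)
    refine continuousOn_finsetSum _ fun k _ => continuousOn_const.mul ?_
    refine (intervalIntegral.continuousOn_primitive_interval'
      (intervalIntegrable_sweepDensity K k ha hb) Set.left_mem_uIcc).comp hinv fun x hx => ?_
    have hx0 : 0 < x := by linarith [hx.1]
    refine Set.mem_uIcc_of_le ?_ ?_
    · exact inv_anti₀ (by positivity) (Real.sqrt_le_sqrt hx.2.le)
    · exact inv_anti₀ (by positivity) (Real.sqrt_le_sqrt hx.1.le)
  refine (hc.continuousAt hmem).congr ?_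
  filter_upwards [hmem] with x hx
  have hx0 : 0 < x := by linarith [hx.1]
  exact (Phi_eq_sweep K ha hx0 (inv_anti₀ (by positivity) (Real.sqrt_le_sqrt hx.2.le))).symm

lemma hasDerivWithinAt_Phi (K : ι → Wall N) {u : ℝ} (hu : 0 < u) :
    HasDerivWithinAt (Phi K) ((N * Phi K u - ∑ k, (K k).h * Phi (face K k) (u - (K k).h ^ 2)) /
      (2 * u)) (Set.Iic u) u := by
  have hu' : 0 < √u := Real.sqrt_pos.2 hu
  set s := (√u)⁻¹ with hs_def
  have hs : 0 < s := by positivity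
  have h_int : ∀ k, HasDerivWithinAt (fun x => ∫ τ in s..x, sweepDensity K k τ)
      (sweepDensity K k s) (Set.Ici s) s := fun k =>
    intervalIntegral.integral_hasDerivWithinAt_right (intervalIntegrable_sweepDensity K k hs hs)
      (t := Set.Ioi s) ⟨Set.Ioo s (s + 1), Ioo_mem_nhdsGT (by linarith),
        ((intervalIntegrable_sweepDensity K k hs (by linarith : 0 < s + 1)).1.mono_set
          Set.Ioo_subset_Ioc_self).aestronglyMeasurable⟩
      ((continuousWithinAt_sweepDensity K k hs).mono Set.Ioi_subset_Ici_self)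
  have hsq : HasDerivAt (fun x => √x) (1 / (2 * √u)) u := Real.hasDerivAt_sqrt hu.ne'
  have hinv : HasDerivAt (fun x => (√x)⁻¹) (-(1 / (2 * √u)) / √u ^ 2) u := hsq.fun_inv hu'.ne'
  have hcomp : ∀ k, HasDerivWithinAt (fun x => ∫ τ in s..(√x)⁻¹, sweepDensity K k τ)
      (sweepDensity K k s * (-(1 / (2 * √u)) / √u ^ 2)) (Set.Ioc 0 u) u := fun k => by
    refine (h_int k).comp (h := fun x => (√x)⁻¹) u hinv.hasDerivWithinAt fun x hx => ?_
    exact inv_anti₀ (Real.sqrt_pos.2 hx.1) (Real.sqrt_le_sqrt hx.2)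
  have hmain : HasDerivWithinAt (fun x => √x ^ N * (s ^ N * Phi K (s ^ 2)⁻¹ +
      ∑ k, (K k).h * ∫ τ in s..(√x)⁻¹, sweepDensity K k τ)) _ (Set.Ioc 0 u) u :=
    (hsq.fun_pow N).hasDerivWithinAt.mul (HasDerivWithinAt.const_add _
      (HasDerivWithinAt.fun_sum fun k (_ : k ∈ Finset.univ) => (hcomp k).const_mul _))
  have hphi := HasDerivWithinAt.congr_of_mem (f₁ := Phi K) hmain (fun x hx => Phi_eq_sweep K hs hx.1
    (inv_anti₀ (Real.sqrt_pos.2 hx.1) (Real.sqrt_le_sqrt hx.2))) ⟨hu, le_rfl⟩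
  refine (hphi.mono_of_mem_nhdsWithin (Ioc_mem_nhdsLE hu)).congr_deriv ?_
  have hss : (s ^ 2)⁻¹ = u := by rw [hs_def, inv_pow, inv_inv, Real.sq_sqrt hu.le]
  simp only [← hs_def, intervalIntegral.integral_same, mul_zero, Finset.sum_const_zero, add_zero,
    sweepDensity, hss]
  rw [sub_div, Finset.sum_div, sub_eq_add_neg, ← Finset.sum_neg_distrib, Finset.mul_sum]
  congr 1
  · obtain _ | N := N
    · simp
    · have h2 := Real.sq_sqrt hu.le
      have h3 : √u ^ (N + 1) * s ^ (N + 1) = 1 := by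
        rw [← mul_pow, hs_def, mul_inv_cancel₀ hu'.ne', one_pow]
      calc _ = (√u ^ (N + 1) * s ^ (N + 1)) * ((N + 1 : ℕ) : ℝ) * Phi K u / (2 * √u ^ 2) := by
            rw [Nat.add_sub_cancel]; field_simp; ring
        _ = _ := by rw [h3, h2]; ring
  · refine Finset.sum_congr rfl fun k _ => ?_
    obtain _ | N := N
    · have : (K k).nv = 0 := Subsingleton.elim _ _
      simp [Wall.h, this]
    · have h2 := Real.sq_sqrt hu.le
      have h3 : √u ^ N * s ^ N = 1 := by
        rw [← mul_pow, hs_def, mul_inv_cancel₀ hu'.ne', one_pow]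
      generalize Phi (face K k) (u - (K k).h ^ 2) = p
      calc _ = -((√u ^ N * s ^ N) * (K k).h * p / (2 * √u ^ 2)) := by
            rw [Nat.add_sub_cancel]; field_simp; ring
        _ = _ := by rw [h3, h2]; ring

end Tower

section Derivatives

/-- The tower of iterated left derivatives of `Phi`. -/
noncomputable def D : ℕ → ∀ {N : ℕ} {ι : Type} [Fintype ι] [LinearOrder ι],
    (ι → Wall N) → ℝ → ℝ
  | 0, _, _, _, _, K => Phi K
  | i + 1, N, _, _, _, K => fun u =>
      (((N : ℝ) - 2 * i) * D i K u - ∑ k, (K k).h * D i (face K k) (u - (K k).h ^ 2)) / (2 * u)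

variable {N : ℕ} {ι : Type} [Fintype ι] [LinearOrder ι]

lemma D_zero (K : ι → Wall N) : D 0 K = Phi K := by rw [D]

lemma D_succ (i : ℕ) (K : ι → Wall N) (u : ℝ) : D (i + 1) K u =
    (((N : ℝ) - 2 * i) * D i K u - ∑ k, (K k).h * D i (face K k) (u - (K k).h ^ 2)) / (2 * u) := by
  rw [D]

lemma D_of_nonpos (i : ℕ) (K : ι → Wall N) {u : ℝ} (hu : u ≤ 0) : D i K u = 0 := by
  induction i generalizing N ι u with
  | zero => rw [D_zero, Phi_of_nonpos K hu]
  | succ i ih =>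
    rw [D_succ, ih K hu, Finset.sum_eq_zero fun k _ => ?_]
    · simp
    · rw [ih (face K k) (by nlinarith [sq_nonneg (K k).h]), mul_zero]

lemma hasDerivWithinAt_D (i : ℕ) (K : ι → Wall N) (u : ℝ) :
    HasDerivWithinAt (D i K) (D (i + 1) K u) (Set.Iic u) u := by
  induction i generalizing N ι u with
  | zero =>
    rcases le_or_gt u 0 with hu | hu
    · rw [D_of_nonpos _ _ hu]
      exact (hasDerivWithinAt_const u (Set.Iic u) (0 : ℝ)).congr
        (fun v hv => D_of_nonpos _ _ (le_trans hv hu)) (D_of_nonpos _ _ hu)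
    · rw [D_succ, D_zero]
      simpa [D_zero] using hasDerivWithinAt_Phi K hu
  | succ i ih =>
    rcases le_or_gt u 0 with hu | hu
    · rw [D_of_nonpos _ _ hu]
      exact (hasDerivWithinAt_const u (Set.Iic u) (0 : ℝ)).congr
        (fun v hv => D_of_nonpos _ _ (le_trans hv hu)) (D_of_nonpos _ _ hu)
    · have hf : ∀ k, HasDerivWithinAt (fun v => D i (face K k) (v - (K k).h ^ 2))
          (D (i + 1) (face K k) (u - (K k).h ^ 2)) (Set.Iic u) u := fun k => by
        have h1 := (ih (face K k) (u - (K k).h ^ 2))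
        refine (HasDerivWithinAt.comp u h1
          (h := fun v => v - (K k).h ^ 2) (((hasDerivAt_id u).sub_const _).hasDerivWithinAt
            (s := Set.Iic u)) (fun v hv => by
              simp only [Set.mem_Iic] at hv ⊢; linarith)).congr_deriv (mul_one _)
      have hmain := ((((ih K u).const_mul ((N : ℝ) - 2 * i)).sub
        (HasDerivWithinAt.fun_sum fun k (_ : k ∈ Finset.univ) =>
          (hf k).const_mul (K k).h)).div
        (((hasDerivAt_id u).const_mul 2).hasDerivWithinAt) (by simpa using hu.ne'))
      refine (hmain.congr (fun v _ => ?_) ?_).congr_deriv ?_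
      · rw [D_succ]; rfl
      · rw [D_succ]; rfl
      · rw [D_succ (i + 1)]
        have h3 := D_succ i K u
        rw [eq_div_iff (by positivity)] at h3
        simp only [Pi.sub_apply, id]
        rw [← h3]
        have := hu.ne'
        push_cast
        field_simp
        ring

lemma eventually_continuousOn_D (i : ℕ) (K : ι → Wall N) (u : ℝ) :
    ∀ᶠ v in 𝓝[<] u, ContinuousOn (D i K) (Set.Icc v u) := by
  induction i generalizing N ι u with
  | zero =>
    rcases le_or_gt u 0 with hu | hu
    · exact .of_forall fun v => (continuousOn_const (c := (0 : ℝ))).congr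
        fun w hw => D_of_nonpos _ _ (hw.2.trans hu)
    · rw [D_zero]
      filter_upwards [Ioo_mem_nhdsLT hu] with v hv
      exact (continuousOn_Phi K).mono fun w hw => hv.1.trans_le hw.1
  | succ i ih =>
    rcases le_or_gt u 0 with hu | hu
    · exact .of_forall fun v => (continuousOn_const (c := (0 : ℝ))).congr
        fun w hw => D_of_nonpos _ _ (hw.2.trans hu)
    · have hf : ∀ᶠ v in 𝓝[<] u, ∀ k, ContinuousOn (D i (face K k))
          (Set.Icc (v - (K k).h ^ 2) (u - (K k).h ^ 2)) := by
        refine eventually_all.2 fun k => ?_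
        have : Tendsto (fun v => v - (K k).h ^ 2) (𝓝[<] u) (𝓝[<] (u - (K k).h ^ 2)) :=
          tendsto_nhdsWithin_iff.2 ⟨(tendsto_id.sub_const _).mono_left nhdsWithin_le_nhds,
            by filter_upwards [self_mem_nhdsWithin] with v hv; exact sub_lt_sub_right (Set.mem_Iio.1 hv) _⟩
        exact this.eventually (ih (face K k) _)
      filter_upwards [hf, ih K u, Ioo_mem_nhdsLT hu] with v h1 h2 hv
      refine ContinuousOn.congr ?_ fun w _ => D_succ i K w
      refine ContinuousOn.div ((h2.const_mul _ ).sub (continuousOn_finsetSum _ fun k _ =>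
        ContinuousOn.mul continuousOn_const ((h1 k).comp (by fun_prop) fun w hw => ?_)))
        (by fun_prop) fun w hw => ?_
      · exact ⟨sub_le_sub_right hw.1 _, sub_le_sub_right hw.2 _⟩
      · have := hv.1.trans_le hw.1
        positivity

/-- One-sided Peano expansion of order `r` at `0`. -/
def HasExpansion (f : ℝ → ℝ) (r : ℕ) (c : ℕ → ℝ) : Prop :=
  (fun σ => f σ - ∑ l ∈ Finset.range r, c l * σ ^ l) =O[𝓝[>] 0] fun σ => σ ^ r

lemma isBigO_D_sub (r i : ℕ) (K : ι → Wall N) (u : ℝ) :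
    (fun σ => D i K (u - σ) - ∑ l ∈ Finset.range r,
      ((-1) ^ l * D (i + l) K u / l.factorial) * σ ^ l) =O[𝓝[≥] 0] fun σ => σ ^ r := by
  have hsub : Tendsto (fun σ : ℝ => u - σ) (𝓝[≥] 0) (𝓝[≤] u) :=
    tendsto_nhdsWithin_iff.2 ⟨by
      simpa using ((tendsto_const_nhds (x := u)).sub (tendsto_id (x := 𝓝 (0:ℝ)))).mono_left
        nhdsWithin_le_nhds,
      by filter_upwards [self_mem_nhdsWithin] with v hv; simpa using hv⟩
  induction r generalizing i with
  | zero =>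
    simp only [Finset.range_zero, Finset.sum_empty, sub_zero, pow_zero]
    exact ((hasDerivWithinAt_D i K u).continuousWithinAt.tendsto.comp hsub).isBigO_one ℝ
  | succ r ih =>
    obtain ⟨C, hC, hb⟩ := (ih (i + 1)).exists_pos
    obtain ⟨δ₁, hδ₁, h1⟩ := (mem_nhdsGE_iff_exists_Ico_subset.1 hb.bound)
    obtain ⟨v, hv, h2⟩ := mem_nhdsLT_iff_exists_Ioo_subset.1 (eventually_continuousOn_D i K u)
    have hcont : ∀ w ∈ Set.Ioo v u, ContinuousOn (D i K) (Set.Icc w u) := fun w hw => h2 hw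
    simp only [Set.mem_Ioi, Set.mem_Iio] at hδ₁ hv
    refine Asymptotics.IsBigO.of_bound C ?_
    filter_upwards [Ico_mem_nhdsGE (lt_min hδ₁ (sub_pos.2 hv))] with σ hσ
    obtain ⟨hσ0, hσ1⟩ := hσ
    rw [lt_min_iff] at hσ1
    set F : ℝ → ℝ := fun σ => D i K (u - σ) - ∑ l ∈ Finset.range (r + 1),
      ((-1) ^ l * D (i + l) K u / l.factorial) * σ ^ l with hF
    have hF0 : F 0 = 0 := by
      simp [hF, Finset.sum_range_succ']
    have hFc : ContinuousOn F (Set.Icc 0 σ) := by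
      refine ContinuousOn.sub ?_ (by fun_prop)
      rcases hσ0.eq_or_lt with rfl | hpos
      · simp
      refine (hcont (u - σ) ⟨by linarith, by linarith⟩).comp (by fun_prop) fun s hs => ?_
      exact ⟨by linarith [hs.2], by linarith [hs.1]⟩
    have hFd : ∀ s ∈ Set.Ico 0 σ, HasDerivWithinAt F (-(D (i + 1) K (u - s) -
        ∑ l ∈ Finset.range r, ((-1) ^ l * D (i + 1 + l) K u / l.factorial) * s ^ l))
        (Set.Ici s) s := by
      intro s hs
      have h3 := HasDerivWithinAt.scomp s (hasDerivWithinAt_D i K (u - s))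
        (h := fun v => u - v) (((hasDerivAt_id s).const_sub _).hasDerivWithinAt
          (s := Set.Ici s)) (fun v hv => by
            simp only [Set.mem_Iic, Set.mem_Ici] at hv ⊢; linarith)
      have h4 : HasDerivAt (fun s => ∑ l ∈ Finset.range (r + 1),
          ((-1) ^ l * D (i + l) K u / l.factorial) * s ^ l) (∑ l ∈ Finset.range (r + 1),
          ((-1) ^ l * D (i + l) K u / l.factorial) * (l * s ^ (l - 1))) s :=
        HasDerivAt.fun_sum fun l _ => (hasDerivAt_pow l s).const_mul _
      refine (h3.sub h4.hasDerivWithinAt).congr_deriv ?_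
      rw [Finset.sum_range_succ']
      simp only [Nat.cast_zero, zero_mul, mul_zero, add_zero, Nat.add_sub_cancel, neg_smul, one_smul]
      rw [neg_sub, sub_eq_add_neg, add_comm, ← Finset.sum_neg_distrib]
      rw [← sub_eq_add_neg]
      congr 1
      refine Finset.sum_congr rfl fun l _ => ?_
      rw [Nat.factorial_succ, show i + (l + 1) = i + 1 + l by ring]
      have := Nat.factorial_pos l
      push_cast
      field_simp
      ring
    have hbd : ∀ s ∈ Set.Ico 0 σ, ‖-(D (i + 1) K (u - s) -
        ∑ l ∈ Finset.range r, ((-1) ^ l * D (i + 1 + l) K u / l.factorial) * s ^ l)‖ ≤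
          C * σ ^ r := by
      intro s hs
      rw [norm_neg]
      refine (h1 ⟨hs.1, hs.2.trans hσ1.1⟩).trans ?_
      rw [Real.norm_of_nonneg (pow_nonneg hs.1 r)]
      gcongr
      exacts [hs.1, hs.2.le]
    have := norm_image_sub_le_of_norm_deriv_right_le_segment hFc hFd hbd σ ⟨hσ0, le_rfl⟩
    rw [hF0, sub_zero, sub_zero] at this
    rw [Real.norm_of_nonneg (pow_nonneg hσ0 _), pow_succ]
    linarith

lemma hasExpansion_D (r i : ℕ) (K : ι → Wall N) (u : ℝ) :
    HasExpansion (fun σ => D i K (u - σ)) r fun l => (-1) ^ l * D (i + l) K u / l.factorial :=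
  (isBigO_D_sub r i K u).mono (nhdsWithin_mono 0 Set.Ioi_subset_Ici_self)

end Derivatives

section Small

variable {N : ℕ} {ι : Type}

lemma Phi_eq_zero_of_small (K : ι → Wall N) {u : ℝ} {k : ι} (hk : (K k).h < 0)
    (hu : u ≤ (K k).h ^ 2) : Phi K u = 0 := by
  have : region K u = ∅ := by
    ext x
    simp only [region, Set.mem_ofPred_eq, Set.mem_empty_iff_false, iff_false, not_and, not_lt]
    refine fun hx => hu.trans ?_
    have h1 := (hx k).1
    have hn : 0 < ‖(K k).nv‖ := by
      rcases (norm_nonneg (K k).nv).eq_or_lt with h | h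
      · rw [Wall.h, ← h, div_zero] at hk; exact absurd hk (lt_irrefl _)
      · exact h
    have h2 : (K k).c = (K k).h * ‖(K k).nv‖ := by rw [Wall.h, div_mul_cancel₀ _ hn.ne']
    have h3 := (le_abs_self _).trans (abs_real_inner_le_norm (K k).nv x)
    have h4 : -(K k).h ≤ ‖x‖ := by
      rw [← mul_le_mul_iff_right₀ hn]; linarith
    nlinarith
  rw [Phi, this, measureReal_empty]

lemma Phi_eq_ball_of_small (K : ι → Wall N) {u : ℝ} (hk : ∀ k, 0 < (K k).h)
    (hu : ∀ k, u ≤ (K k).h ^ 2) : Phi K u =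
      volume.real (ball (0 : EuclideanSpace ℝ (Fin N)) √u) := by
  have : region K u = ball 0 √u := by
    rw [← setOf_norm_sq_lt]
    ext x
    simp only [region, Set.mem_ofPred_eq, and_iff_right_iff_imp]
    intro hx k
    have hn : 0 < ‖(K k).nv‖ := by
      rcases (norm_nonneg (K k).nv).eq_or_lt with h | h
      · have := hk k; rw [Wall.h, ← h, div_zero] at this; exact absurd this (lt_irrefl _)
      · exact h
    have h2 : (K k).c = (K k).h * ‖(K k).nv‖ := by rw [Wall.h, div_mul_cancel₀ _ hn.ne']
    have h3 := (neg_le_abs _).trans (abs_real_inner_le_norm (K k).nv x)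
    have h4 : ‖x‖ < (K k).h := lt_of_pow_lt_pow_left₀ 2 (hk k).le (hx.trans_le (hu k))
    have h5 : 0 < inner ℝ (K k).nv x + (K k).c := by nlinarith
    exact ⟨h5.le, fun _ => h5⟩
  rw [Phi, this]

end Small

section Estimates

variable {N : ℕ} {ι : Type} [Fintype ι] [LinearOrder ι]

lemma abs_mul_D_sub_le {i : ℕ} {K : ι → Wall N} {C h u : ℝ} {p : ℕ} (hC : 0 ≤ C)
    (hb : ∀ u, |D i K u| ≤ C * √u ^ p) : |h * D i K (u - h ^ 2)| ≤ C * √u ^ (p + 1) := by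
  rcases le_or_gt u (h ^ 2) with hu | hu
  · rw [D_of_nonpos _ _ (by linarith), mul_zero, abs_zero]; positivity
  · rw [abs_mul, pow_succ √u, ← mul_assoc, mul_comm]
    have h1 : |h| ≤ √u := Real.abs_le_sqrt hu.le
    have h2 : √(u - h ^ 2) ≤ √u := Real.sqrt_le_sqrt (by nlinarith [sq_nonneg h])
    have h3 : |D i K (u - h ^ 2)| ≤ C * √u ^ p := (hb _).trans (by gcongr)
    exact mul_le_mul h3 h1 (abs_nonneg _) (by positivity)

lemma exists_abs_D_le (i : ℕ) (K : ι → Wall N) (hi : 2 * i ≤ N) :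
    ∃ C, 0 ≤ C ∧ ∀ u, |D i K u| ≤ C * √u ^ (N - 2 * i) := by
  induction i generalizing N ι with
  | zero =>
    refine ⟨volume.real (ball (0 : EuclideanSpace ℝ (Fin N)) 1), measureReal_nonneg, fun u => ?_⟩
    rw [D_zero, abs_of_nonneg (Phi_nonneg K u), mul_comm]
    exact Phi_le K u
  | succ i ih =>
    obtain ⟨C, hC, hb⟩ := ih K (by omega)
    choose c hc hcb using fun k => ih (face K k) (by omega)
    refine ⟨(|(N : ℝ) - 2 * i| * C + ∑ k, c k) / 2, by
      have := Finset.sum_nonneg fun k (_ : k ∈ Finset.univ) => hc k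
      positivity, fun u => ?_⟩
    rcases le_or_gt u 0 with hu | hu
    · rw [D_of_nonpos _ _ hu, abs_zero]
      have := Finset.sum_nonneg fun k (_ : k ∈ Finset.univ) => hc k
      positivity
    have hN : N - 2 * i = N - 2 * (i + 1) + 2 := by omega
    have hN' : N - 1 - 2 * i + 1 = N - 2 * (i + 1) + 2 := by omega
    rw [D_succ, abs_div, abs_of_pos (by positivity : 0 < 2 * u), div_le_iff₀ (by positivity)]
    refine (abs_sub _ _).trans ?_
    calc _ ≤ |(N : ℝ) - 2 * i| * (C * √u ^ (N - 2 * (i + 1) + 2)) +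
          ∑ k, c k * √u ^ (N - 2 * (i + 1) + 2) := by
          gcongr
          · rw [abs_mul, ← hN]
            gcongr
            exact hb u
          · refine (Finset.abs_sum_le_sum_abs _ _).trans (Finset.sum_le_sum fun k _ => ?_)
            rw [← hN']
            exact abs_mul_D_sub_le (hc k) (hcb k)
      _ = _ := by
          rw [← Finset.sum_mul, pow_add, Real.sq_sqrt hu.le]; ring

lemma exists_abs_asymp_le (i : ℕ) (K : ι → Wall N) (hi : 2 * i ≤ N) :
    ∃ C, ∀ u, |D i K u * u ^ i - (∏ l ∈ Finset.range i, ((N : ℝ) / 2 - l)) * Phi K u| ≤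
      C * √u ^ (N - 1) := by
  induction i with
  | zero => exact ⟨0, fun u => by simp [D_zero]⟩
  | succ i ih =>
    obtain ⟨C, hb⟩ := ih (by omega)
    choose c hc hcb using fun k => exists_abs_D_le i (face K k) (by omega)
    refine ⟨|(N : ℝ) / 2 - i| * C + ∑ k, |(K k).h| / 2 * c k, fun u => ?_⟩
    rcases le_or_gt u 0 with hu | hu
    · rw [D_of_nonpos _ _ hu, Phi_of_nonpos _ hu, Real.sqrt_eq_zero_of_nonpos hu,
        zero_pow (by omega)]
      simp
    have h2 : ∀ k, |u ^ i * D i (face K k) (u - (K k).h ^ 2)| ≤ c k * √u ^ (N - 1) := fun k => by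
      have : √u ^ (N - 1) = u ^ i * √u ^ (N - 1 - 2 * i) := by
        nth_rewrite 2 [← Real.sq_sqrt hu.le]
        rw [← pow_mul, ← pow_add]; congr 1; omega
      rw [abs_mul, abs_of_pos (pow_pos hu i), this, mul_left_comm]
      gcongr
      refine (hcb k _).trans ?_
      have := hc k
      gcongr
      nlinarith [sq_nonneg (K k).h]
    have h1 : D (i + 1) K u * u ^ (i + 1) -
        (∏ l ∈ Finset.range (i + 1), ((N : ℝ) / 2 - l)) * Phi K u =
        ((N : ℝ) / 2 - i) * (D i K u * u ^ i -
          (∏ l ∈ Finset.range i, ((N : ℝ) / 2 - l)) * Phi K u) -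
        ∑ k, (K k).h / 2 * (u ^ i * D i (face K k) (u - (K k).h ^ 2)) := by
      rw [D_succ, Finset.prod_range_succ]
      have : ∑ k, (K k).h / 2 * (u ^ i * D i (face K k) (u - (K k).h ^ 2)) =
          u ^ i / 2 * ∑ k, (K k).h * D i (face K k) (u - (K k).h ^ 2) := by
        rw [Finset.mul_sum]; exact Finset.sum_congr rfl fun k _ => by ring
      rw [this]
      field_simp
      ring
    rw [h1, add_mul, Finset.sum_mul]
    refine (abs_sub _ _).trans (add_le_add ?_ ?_)
    · rw [abs_mul, mul_assoc]
      exact mul_le_mul_of_nonneg_left (hb u) (abs_nonneg _)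
    · refine (Finset.abs_sum_le_sum_abs _ _).trans (Finset.sum_le_sum fun k _ => ?_)
      rw [abs_mul, mul_assoc, abs_div, abs_two]
      exact mul_le_mul_of_nonneg_left (h2 k) (by positivity)

/-- Below all wall distances only the wedge at the origin is seen. -/
lemma D_mul_pow_of_small (i : ℕ) (K : ι → Wall N) {u : ℝ} (hu : ∀ k, (K k).h ≠ 0 → u ≤ (K k).h ^ 2) :
    D i K u * u ^ i = (∏ l ∈ Finset.range i, ((N : ℝ) / 2 - l)) * Phi K u := by
  induction i with
  | zero => simp [D_zero]
  | succ i ih =>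
    rcases eq_or_ne u 0 with rfl | h0
    · rw [Phi_of_nonpos _ le_rfl, D_of_nonpos _ _ le_rfl]; simp
    rw [D_succ, Finset.sum_eq_zero, Finset.prod_range_succ, mul_right_comm, ← ih]
    · field_simp; ring
    · intro k _
      by_cases hk : (K k).h = 0
      · rw [hk, zero_mul]
      · rw [D_of_nonpos _ _ (sub_nonpos.2 (hu k hk)), mul_zero]

lemma continuousOn_continuous_D (i : ℕ) (K : ι → Wall N) (hi : 2 * i ≤ N) :
    ContinuousOn (D i K) (Set.Ioi 0) ∧ (2 * i < N → Continuous (D i K)) := by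
  induction i generalizing N ι with
  | zero => 
    have h1 : ContinuousOn (D 0 K) (Set.Ioi 0) := by rw [D_zero]; exact continuousOn_Phi K
    exact ⟨h1, fun h => continuous_D_of_continuousOn 0 K h h1⟩
  | succ i ih =>
    have h1 : ContinuousOn (D (i + 1) K) (Set.Ioi 0) := by
      refine ContinuousOn.congr ?_ fun w _ => D_succ i K w
      refine ContinuousOn.div (((ih K (by omega)).1.const_mul _).sub
        (continuousOn_finsetSum _ fun k _ => ContinuousOn.mul continuousOn_const ?_))
        (by fun_prop) fun w hw => ?_
      · exact (((ih (face K k) (by omega)).2 (by omega)).comp (by fun_prop)).continuousOn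
      · have : 0 < w := hw
        positivity
    exact ⟨h1, fun h => continuous_D_of_continuousOn _ K h h1⟩
where
  continuous_D_of_continuousOn {N : ℕ} {ι : Type} [Fintype ι] [LinearOrder ι] (i : ℕ)
      (K : ι → Wall N) (hi : 2 * i < N) (h : ContinuousOn (D i K) (Set.Ioi 0)) :
      Continuous (D i K) := by
    obtain ⟨C, hC, hb⟩ := exists_abs_D_le i K hi.le
    rw [continuous_iff_continuousAt]
    intro u
    rcases lt_trichotomy u 0 with hu | rfl | hu
    · refine (continuousAt_const (y := (0 : ℝ))).congr ?_
      filter_upwards [gt_mem_nhds hu] with v hv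
      rw [D_of_nonpos _ _ hv.le]
    · rw [ContinuousAt, D_of_nonpos _ _ le_rfl]
      refine squeeze_zero_norm hb ?_
      have : Continuous fun u : ℝ => C * √u ^ (N - 2 * i) := by fun_prop
      have h2 := this.tendsto 0
      rwa [Real.sqrt_zero, zero_pow (by omega), mul_zero] at h2
    · exact h.continuousAt (Ioi_mem_nhds hu)

end Estimates

section Monotone

lemma monotoneOn_of_leftDeriv_nonneg {f f' : ℝ → ℝ} (hf : ContinuousOn f (Set.Ioi 0))
    (hd : ∀ u, 0 < u → HasDerivWithinAt f (f' u) (Set.Iic u) u) (h0 : ∀ u, 0 < u → 0 ≤ f' u) :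
    MonotoneOn f (Set.Ioi 0) := by
  intro a ha b hb hab
  have ha' : 0 < a := ha
  have key := image_le_of_deriv_right_le_deriv_boundary (f := fun s => f (-s))
    (f' := fun s => -f' (-s)) (a := -b) (b := -a) (B := fun _ => f b) (B' := fun _ => 0)
    (hf.comp (by fun_prop) fun s hs => ?_) (fun s hs => ?_) (by simp) continuousOn_const
    (fun s _ => hasDerivWithinAt_const _ _ _) (fun s hs => ?_) (x := -a)
    ⟨neg_le_neg hab, le_rfl⟩
  · simpa using key
  · exact ha'.trans_le (by linarith [hs.2])
  · have hs' : 0 < -s := by linarith [hs.2]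
    have := HasDerivWithinAt.comp s (hd (-s) hs') (h := fun v => -v)
      ((hasDerivAt_neg s).hasDerivWithinAt (s := Set.Ici s)) (fun v hv => by
        simp only [Set.mem_Iic, Set.mem_Ici] at hv ⊢; linarith)
    simpa [Function.comp_def] using this
  · have := h0 (-s) (by linarith [hs.2])
    linarith

/-- Weight `U` for positive `h`, `L` for negative `h`. -/
noncomputable def wt (U L h : ℝ) : ℝ := if 0 < h then U else if h < 0 then L else 0

lemma wt_nonneg {U L : ℝ} (hU : 0 ≤ U) (hL : 0 ≤ L) (h : ℝ) : 0 ≤ wt U L h := by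
  unfold wt; split_ifs <;> simp_all

lemma neg_sign_mul_le_wt {U L a h : ℝ} (ha : a ∈ Set.Icc (-L) U) :
    -((SignType.sign h : ℝ) * a) ≤ wt L U h := by
  obtain ⟨h1, h2⟩ := ha
  unfold wt
  rcases lt_trichotomy h 0 with hh | rfl | hh
  · simp [hh, hh.not_gt]; linarith
  · simp
  · simp [hh]; linarith

lemma sign_mul_le_wt {U L a h : ℝ} (ha : a ∈ Set.Icc (-L) U) :
    (SignType.sign h : ℝ) * a ≤ wt U L h := by
  obtain ⟨h1, h2⟩ := ha
  unfold wt
  rcases lt_trichotomy h 0 with hh | rfl | hh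
  · simp [hh, hh.not_gt]; linarith
  · simp
  · simp [hh]; linarith

variable {κ : Type} [Fintype κ]

lemma monotoneOn_add_wt {g : ℝ → ℝ} {G G' a : κ → ℝ → ℝ} {h : κ → ℝ} {U L : ℝ}
    (hg : ContinuousOn g (Set.Ioi 0)) (hG : ∀ k, ContinuousOn (G k) (Set.Ioi 0))
    (hGd : ∀ k u, 0 < u → HasDerivWithinAt (G k) (G' k u) (Set.Iic u) u)
    (hG0 : ∀ k u, 0 < u → 0 ≤ G' k u) (ha : ∀ k u, a k u ∈ Set.Icc (-L) U)
    (hgd : ∀ u, 0 < u → HasDerivWithinAt g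
      (-∑ k, (SignType.sign (h k) : ℝ) * a k u * G' k u) (Set.Iic u) u) :
    MonotoneOn (fun u => g u + ∑ k, wt U L (h k) * G k u) (Set.Ioi 0) := by
  refine monotoneOn_of_leftDeriv_nonneg (hg.add (continuousOn_finsetSum _ fun k _ =>
    continuousOn_const.mul (hG k))) (fun u hu => (hgd u hu).add (HasDerivWithinAt.fun_sum
      fun k (_ : k ∈ Finset.univ) => (hGd k u hu).const_mul _)) fun u hu => ?_
  rw [← Finset.sum_neg_distrib, ← Finset.sum_add_distrib]
  refine Finset.sum_nonneg fun k _ => ?_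
  have h1 := sign_mul_le_wt (h := h k) (ha k u)
  have h2 := hG0 k u hu
  nlinarith

lemma antitoneOn_sub_wt {g : ℝ → ℝ} {G G' a : κ → ℝ → ℝ} {h : κ → ℝ} {U L : ℝ}
    (hg : ContinuousOn g (Set.Ioi 0)) (hG : ∀ k, ContinuousOn (G k) (Set.Ioi 0))
    (hGd : ∀ k u, 0 < u → HasDerivWithinAt (G k) (G' k u) (Set.Iic u) u)
    (hG0 : ∀ k u, 0 < u → 0 ≤ G' k u) (ha : ∀ k u, a k u ∈ Set.Icc (-L) U)
    (hgd : ∀ u, 0 < u → HasDerivWithinAt g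
      (-∑ k, (SignType.sign (h k) : ℝ) * a k u * G' k u) (Set.Iic u) u) :
    AntitoneOn (fun u => g u - ∑ k, wt L U (h k) * G k u) (Set.Ioi 0) := by
  have := monotoneOn_add_wt (g := fun u => -g u) (G := G) (a := fun k u => -a k u) (h := h)
    (U := L) (L := U) hg.neg hG hGd hG0
    (fun k u => ⟨neg_le_neg (ha k u).2, by linarith [(ha k u).1]⟩)
    (fun u hu => (hgd u hu).neg.congr_deriv (by
      rw [neg_neg, ← Finset.sum_neg_distrib]; exact Finset.sum_congr rfl fun k _ => by ring))
  intro x hx y hy hxy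
  have := this hx hy hxy
  simp only at this ⊢
  linarith

lemma exists_wt_sum {h T : κ → ℝ} (hT : ∀ k, T k ∈ Set.Icc (0 : ℝ) (1 / 2)) :
    ∃ (P M : ℕ) (TP TM : ℝ), P + M ≤ Fintype.card κ ∧ 0 ≤ TP ∧ TP ≤ P / 2 ∧ 0 ≤ TM ∧ TM ≤ M / 2 ∧
      (M ≠ 0 → ∃ k, h k < 0) ∧ (P = Fintype.card κ → ∀ k, 0 < h k) ∧
      (∀ U L, ∑ k, wt U L (h k) * T k = U * TP + L * TM) ∧
      (∀ U L, ∑ k, wt U L (h k) = U * P + L * M) := by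
  classical
  refine ⟨(Finset.univ.filter fun k => 0 < h k).card, (Finset.univ.filter fun k => h k < 0).card,
    ∑ k with 0 < h k, T k, ∑ k with h k < 0, T k, ?_, ?_, ?_, ?_, ?_, ?_, ?_, ?_, ?_⟩
  · rw [← Finset.card_union_of_disjoint]
    · exact Finset.card_le_univ _
    · rw [Finset.disjoint_filter]; intro k _ h1 h2; exact lt_asymm h1 h2
  · exact Finset.sum_nonneg fun k _ => (hT k).1
  · refine (Finset.sum_le_card_nsmul _ _ _ fun k _ => (hT k).2).trans (by rw [nsmul_eq_mul]; linarith)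
  · exact Finset.sum_nonneg fun k _ => (hT k).1
  · refine (Finset.sum_le_card_nsmul _ _ _ fun k _ => (hT k).2).trans (by rw [nsmul_eq_mul]; linarith)
  · intro hM
    obtain ⟨k, hk⟩ := Finset.card_ne_zero.1 hM
    exact ⟨k, (Finset.mem_filter.1 hk).2⟩
  · intro hP k
    have := Finset.mem_univ k
    rw [← (Finset.card_eq_iff_eq_univ _).1 hP] at this
    exact (Finset.mem_filter.1 this).2
  · intro U L
    rw [Finset.mul_sum, Finset.mul_sum, Finset.sum_filter, Finset.sum_filter,
      ← Finset.sum_add_distrib]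
    refine Finset.sum_congr rfl fun k _ => ?_
    unfold wt
    rcases lt_trichotomy (h k) 0 with hh | hh | hh
    · simp [hh, hh.not_gt]
    · simp [hh]
    · simp [hh, hh.not_gt]
  · intro U L
    rw [Finset.cast_card, Finset.cast_card, Finset.mul_sum, Finset.mul_sum, Finset.sum_filter,
      Finset.sum_filter, ← Finset.sum_add_distrib]
    refine Finset.sum_congr rfl fun k _ => ?_
    unfold wt
    rcases lt_trichotomy (h k) 0 with hh | hh | hh
    · simp [hh, hh.not_gt]
    · simp [hh]
    · simp [hh, hh.not_gt]

end Monotone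

section Normalization

open Real

lemma prod_mul_volume_ball_even (j : ℕ) {u : ℝ} (hu : 0 < u) :
    (∏ l ∈ Finset.range j, (((2 * j : ℕ) : ℝ) / 2 - l)) *
      volume.real (ball (0 : EuclideanSpace ℝ (Fin (2 * j))) √u) = π ^ j * u ^ j := by
  have h1 : ∏ l ∈ Finset.range j, (((2 * j : ℕ) : ℝ) / 2 - l) = j.factorial := by
    induction j with
    | zero => simp
    | succ j ih =>
      rw [Finset.prod_range_succ', Nat.factorial_succ, mul_comm]
      push_cast at ih ⊢
      rw [← ih]
      congr 1
      · ring
      · exact Finset.prod_congr rfl fun l _ => by ring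
  obtain _ | j := j
  · simp [measureReal_def, volume_euclideanSpace_eq_dirac, hu]
  have : Nontrivial (EuclideanSpace ℝ (Fin (2 * (j + 1)))) :=
    Module.nontrivial_of_finrank_pos (R := ℝ) (by simp)
  rw [h1, measureReal_def, InnerProductSpace.volume_ball_of_dim_even (k := j + 1) (by simp),
    ENNReal.toReal_mul, ENNReal.toReal_pow, ENNReal.toReal_ofReal (by positivity),
    ENNReal.toReal_ofReal (by positivity), finrank_euclideanSpace_fin, pow_mul, sq_sqrt hu.le]
  have := Nat.factorial_pos (j + 1)
  field_simp

lemma prod_mul_volume_ball_odd (j : ℕ) {u : ℝ} (hu : 0 < u) :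
    (∏ l ∈ Finset.range j, (((2 * j + 1 : ℕ) : ℝ) / 2 - l)) *
      volume.real (ball (0 : EuclideanSpace ℝ (Fin (2 * j + 1))) √u) =
      2 * π ^ j * u ^ j * √u := by
  have h1 : ∏ l ∈ Finset.range j, (((2 * j + 1 : ℕ) : ℝ) / 2 - l) =
      (2 * j + 1).doubleFactorial / 2 ^ j := by
    induction j with
    | zero => simp
    | succ j ih =>
      rw [Finset.prod_range_succ', show 2 * (j + 1) + 1 = 2 * j + 1 + 2 by ring,
        Nat.doubleFactorial_add_two]
      push_cast at ih ⊢
      have : ∏ k ∈ Finset.range j, ((2 * (j : ℝ) + 1 + 2) / 2 - (↑k + 1)) =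
          ∏ k ∈ Finset.range j, ((2 * (j : ℝ) + 1) / 2 - k) :=
        Finset.prod_congr rfl fun l _ => by ring
      rw [this, ih]
      field_simp
      ring
  rw [h1, measureReal_def, InnerProductSpace.volume_ball_of_dim_odd (k := j) (by simp),
    ENNReal.toReal_mul, ENNReal.toReal_pow, ENNReal.toReal_ofReal (by positivity),
    ENNReal.toReal_ofReal (by positivity), finrank_euclideanSpace_fin, pow_succ √u, pow_mul,
    sq_sqrt hu.le]
  have := Nat.doubleFactorial_pos (2 * j + 1)
  field_simp
  ring

end Normalization

section Steps

open Real

/-- The angle swept by a wall at signed distance `h`, in units of `π`. -/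
noncomputable def sweepAngle (h u : ℝ) : ℝ := arctan (√(u - h ^ 2) / |h|) / π

lemma sweepAngle_of_le {h u : ℝ} (hu : u ≤ h ^ 2) : sweepAngle h u = 0 := by
  rw [sweepAngle, sqrt_eq_zero_of_nonpos (sub_nonpos.2 hu), zero_div, arctan_zero, zero_div]

lemma sweepAngle_zero (u : ℝ) : sweepAngle 0 u = 0 := by simp [sweepAngle]

lemma sweepAngle_mem (h u : ℝ) : sweepAngle h u ∈ Set.Icc (0 : ℝ) (1 / 2) := by
  have h1 : 0 ≤ arctan (√(u - h ^ 2) / |h|) := arctan_nonneg.2 (by positivity)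
  have h2 := arctan_lt_pi_div_two (√(u - h ^ 2) / |h|)
  refine ⟨div_nonneg h1 pi_pos.le, ?_⟩
  rw [sweepAngle, div_le_iff₀ pi_pos]
  linarith

lemma hasDerivWithinAt_sweepAngle (h : ℝ) {u : ℝ} (hu : 0 < u) :
    HasDerivWithinAt (sweepAngle h) (|h| / (2 * π * u * √(u - h ^ 2))) (Set.Iic u) u := by
  rcases le_or_gt u (h ^ 2) with hh | hh
  · rw [sqrt_eq_zero_of_nonpos (sub_nonpos.2 hh), mul_zero, div_zero]
    exact (hasDerivWithinAt_const u (Set.Iic u) (0 : ℝ)).congr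
      (fun v hv => sweepAngle_of_le (le_trans hv hh)) (sweepAngle_of_le hh)
  · rcases eq_or_ne h 0 with rfl | h0
    · simp only [abs_zero, zero_div]
      exact (hasDerivWithinAt_const u (Set.Iic u) (0 : ℝ)).congr
        (fun v _ => sweepAngle_zero v) (sweepAngle_zero u)
    · have hv : 0 < u - h ^ 2 := sub_pos.2 hh
      have h1 := (((((hasDerivAt_id u).sub_const (h ^ 2)).sqrt hv.ne').div_const |h|).arctan).div_const π
      refine h1.hasDerivWithinAt.congr_deriv ?_
      have h2 := abs_pos.2 h0
      have h3 := sqrt_pos.2 hv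
      have h4 : 1 + (√(u - h ^ 2) / |h|) ^ 2 = u / |h| ^ 2 := by
        rw [div_pow, sq_sqrt hv.le, sq_abs]; field_simp; ring
      simp only [id]
      rw [h4]
      have := pi_pos
      field_simp

variable {N : ℕ} {ι : Type}

lemma exists_small [Finite ι] (K : ι → Wall N) {u : ℝ} (hu : 0 < u) :
    ∃ v, 0 < v ∧ v ≤ u ∧ ∀ k, (K k).h ≠ 0 → v ≤ (K k).h ^ 2 := by
  have h1 : ∀ᶠ v in 𝓝[>] (0 : ℝ), ∀ k, (K k).h ≠ 0 → v ≤ (K k).h ^ 2 :=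
    eventually_all.2 fun k => by
      by_cases hk : (K k).h = 0
      · exact .of_forall fun v h => absurd hk h
      · filter_upwards [mem_nhdsWithin_of_mem_nhds (gt_mem_nhds (by positivity : 0 < (K k).h ^ 2))]
          with v hv _ using le_of_lt hv
  obtain ⟨v, hv, hvu⟩ := (h1.and (Ioc_mem_nhdsGT hu)).exists
  exact ⟨v, hvu.1, hvu.2, hv⟩

lemma Phi_le_ball (K : ι → Wall N) (u : ℝ) :
    Phi K u ≤ volume.real (ball (0 : EuclideanSpace ℝ (Fin N)) √u) :=
  measureReal_mono (region_subset K u) measure_ball_lt_top.ne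

lemma prod_nonneg_of_le {j : ℕ} (hN : 2 * j ≤ N) :
    0 ≤ ∏ l ∈ Finset.range j, ((N : ℝ) / 2 - l) := Finset.prod_nonneg fun l hl => by
  have h1 : l < j := Finset.mem_range.1 hl
  have h2 : (2 * l : ℝ) ≤ N := by exact_mod_cast (by omega : 2 * l ≤ N)
  linarith

lemma prod_mul_Phi_even {j : ℕ} (hN : N = 2 * j) (K : ι → Wall N) {u : ℝ} (hu : 0 < u) :
    (∏ l ∈ Finset.range j, ((N : ℝ) / 2 - l)) * Phi K u ∈ Set.Icc 0 (π ^ j * u ^ j) := by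
  refine ⟨mul_nonneg (prod_nonneg_of_le hN.ge) (Phi_nonneg K u), ?_⟩
  refine (mul_le_mul_of_nonneg_left (Phi_le_ball K u) (prod_nonneg_of_le hN.ge)).trans ?_
  subst hN
  exact (prod_mul_volume_ball_even j hu).le

lemma prod_mul_Phi_odd {j : ℕ} (hN : N = 2 * j + 1) (K : ι → Wall N) {u : ℝ} (hu : 0 < u) :
    (∏ l ∈ Finset.range j, ((N : ℝ) / 2 - l)) * Phi K u ∈
      Set.Icc 0 (2 * π ^ j * u ^ j * √u) := by
  have h0 : 2 * j ≤ N := by omega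
  refine ⟨mul_nonneg (prod_nonneg_of_le h0) (Phi_nonneg K u), ?_⟩
  refine (mul_le_mul_of_nonneg_left (Phi_le_ball K u) (prod_nonneg_of_le h0)).trans ?_
  subst hN
  exact (prod_mul_volume_ball_odd j hu).le

variable [Fintype ι] [LinearOrder ι]

lemma even_step {j : ℕ} (hN : N = 2 * (j + 1)) (K : ι → Wall N) {U L : ℝ} (hU : 0 ≤ U)
    (hL : 0 ≤ L) (ha : ∀ k v, √v * D (j + 1) (face K k) v / π ^ j ∈ Set.Icc (-L) U)
    {u : ℝ} (hu : 0 < u) :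
    ∃ (P M : ℕ) (b₀ TP TM : ℝ), P + M ≤ Fintype.card ι ∧ 0 ≤ TP ∧ TP ≤ P / 2 ∧ 0 ≤ TM ∧
      TM ≤ M / 2 ∧ 0 ≤ b₀ ∧ b₀ ≤ 1 ∧ (M ≠ 0 → b₀ = 0) ∧
      b₀ - (U * TP + L * TM) ≤ D (j + 1) K u / π ^ (j + 1) ∧
      D (j + 1) K u / π ^ (j + 1) ≤ b₀ + (L * TP + U * TM) ∧
      -(L * (P / 2 - TP) + U * (M / 2 - TM)) ≤ D (j + 1) K u / π ^ (j + 1) ∧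
      D (j + 1) K u / π ^ (j + 1) ≤ 1 + (U * (P / 2 - TP) + L * (M / 2 - TM)) := by
  set g : ℝ → ℝ := fun u => D (j + 1) K u / π ^ (j + 1) with hg_def
  have hpi := pi_pos
  have hgc : ContinuousOn g (Set.Ioi 0) :=
    (continuousOn_continuous_D (j + 1) K hN.ge).1.div_const _
  have hGc : ∀ k : ι, ContinuousOn (sweepAngle (K k).h) (Set.Ioi 0) := fun k => by
    unfold sweepAngle; fun_prop
  have hG0 : ∀ (k : ι) u, 0 < u → 0 ≤ |(K k).h| / (2 * π * u * √(u - (K k).h ^ 2)) :=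
    fun k u hu => by positivity
  have hgd : ∀ u, 0 < u → HasDerivWithinAt g (-∑ k, (SignType.sign (K k).h : ℝ) *
      (√(u - (K k).h ^ 2) * D (j + 1) (face K k) (u - (K k).h ^ 2) / π ^ j) *
        (|(K k).h| / (2 * π * u * √(u - (K k).h ^ 2)))) (Set.Iic u) u := fun u hu => by
    refine ((hasDerivWithinAt_D (j + 1) K u).div_const _).congr_deriv ?_
    have hN' : (N : ℝ) = 2 * (j + 1 : ℕ) := by rw [hN]; push_cast; ring
    rw [D_succ, hN', sub_self, zero_mul, zero_sub, neg_div, neg_div, Finset.sum_div, Finset.sum_div]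
    congr 1
    refine Finset.sum_congr rfl fun k _ => ?_
    rcases le_or_gt (u - (K k).h ^ 2) 0 with hv | hv
    · rw [D_of_nonpos _ _ hv]; simp
    · have h3 := sqrt_pos.2 hv
      have h4 : (SignType.sign (K k).h : ℝ) * |(K k).h| = (K k).h := sign_mul_abs _
      nth_rewrite 1 [← h4]
      field_simp
      ring
  have hmono := monotoneOn_add_wt hgc hGc (fun k u hu => hasDerivWithinAt_sweepAngle _ hu) hG0
    (fun k u => ha k (u - (K k).h ^ 2)) hgd
  have hanti := antitoneOn_sub_wt hgc hGc (fun k u hu => hasDerivWithinAt_sweepAngle _ hu) hG0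
    (fun k u => ha k (u - (K k).h ^ 2)) hgd
  obtain ⟨P, M, TP, TM, hPM, h1, h2, h3, h4, hM, -, hT, hW⟩ :=
    exists_wt_sum (h := fun k => (K k).h) (T := fun k => sweepAngle (K k).h u)
      fun k => sweepAngle_mem _ _
  obtain ⟨v, hv, hvu, hvs⟩ := exists_small K hu
  have hgv : g v = (∏ l ∈ Finset.range (j + 1), ((N : ℝ) / 2 - l)) * Phi K v /
      (π ^ (j + 1) * v ^ (j + 1)) := by
    rw [← D_mul_pow_of_small _ _ hvs, hg_def]
    field_simp
  have hzero : ∀ U L, ∑ k, wt U L (K k).h * sweepAngle (K k).h v = 0 := fun U L =>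
    Finset.sum_eq_zero fun k _ => by
      by_cases hk : (K k).h = 0
      · rw [hk, sweepAngle_zero, mul_zero]
      · rw [sweepAngle_of_le (hvs k hk), mul_zero]
  have hPhi := prod_mul_Phi_even hN K hv
  obtain ⟨C, hC⟩ := exists_abs_asymp_le (j + 1) K hN.ge
  have hlim : ∀ A : ℝ, Tendsto (fun w : ℝ => A + C / π ^ (j + 1) * (√w)⁻¹) atTop (𝓝 A) := fun A => by
    have := ((tendsto_inv_atTop_zero.comp tendsto_sqrt_atTop).const_mul
      (C / π ^ (j + 1))).const_add A
    simpa using this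
  have hasymp : ∀ w, 0 < w → -(C / π ^ (j + 1) * (√w)⁻¹) ≤ g w ∧
      g w ≤ 1 + C / π ^ (j + 1) * (√w)⁻¹ := fun w hw => by
    have e1 := abs_le.1 (hC w)
    have e2 := prod_mul_Phi_even hN K hw
    have e3 := sqrt_pos.2 hw
    have e4 : √w ^ (N - 1) = w ^ (j + 1) * (√w)⁻¹ := by
      rw [eq_mul_inv_iff_mul_eq₀ e3.ne', ← pow_succ, show N - 1 + 1 = 2 * (j + 1) by omega, pow_mul,
        sq_sqrt hw.le]
    rw [e4] at e1
    have e5 : 0 < π ^ (j + 1) * w ^ (j + 1) := by positivity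
    have e6 : g w * (π ^ (j + 1) * w ^ (j + 1)) = D (j + 1) K w * w ^ (j + 1) := by
      rw [hg_def]; field_simp
    have e7 : C / π ^ (j + 1) * (√w)⁻¹ * (π ^ (j + 1) * w ^ (j + 1)) =
      C * (w ^ (j + 1) * (√w)⁻¹) := by field_simp
    constructor
    · refine le_of_mul_le_mul_right ?_ e5
      rw [neg_mul, e6, e7]
      linarith [e1.1, e2.1]
    · refine le_of_mul_le_mul_right ?_ e5
      rw [add_mul, e6, e7]
      linarith [e1.2, e2.2]
  have hmax : ∀ {U L : ℝ}, 0 ≤ U → 0 ≤ L → ∀ w,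
      ∑ k, wt U L (K k).h * sweepAngle (K k).h w ≤ (U * P + L * M) / 2 := fun hU hL w => by
    rw [← hW, Finset.sum_div]
    refine Finset.sum_le_sum fun k _ => ?_
    have := mul_le_mul_of_nonneg_left (sweepAngle_mem (K k).h w).2 (wt_nonneg hU hL (K k).h)
    linarith
  refine ⟨P, M, g v, TP, TM, hPM, h1, h2, h3, h4, ?_, ?_, fun h => ?_, ?_, ?_, ?_, ?_⟩
  · rw [hgv]; exact div_nonneg hPhi.1 (by positivity)
  · rw [hgv]; exact div_le_one_of_le₀ hPhi.2 (by positivity)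
  · obtain ⟨k, hk⟩ := hM h
    rw [hgv, Phi_eq_zero_of_small K hk (hvs k hk.ne), mul_zero, zero_div]
  · have := hmono (Set.mem_Ioi.2 hv) (Set.mem_Ioi.2 hu) hvu
    simp only [hzero, hT] at this
    linarith
  · have := hanti (Set.mem_Ioi.2 hv) (Set.mem_Ioi.2 hu) hvu
    simp only [hzero, hT] at this
    linarith
  · have : -g u + (L * TP + U * TM) ≤ (L * P + U * M) / 2 := by
      refine ge_of_tendsto (hlim _) ?_
      filter_upwards [eventually_ge_atTop u] with w hw
      have e1 := hanti (Set.mem_Ioi.2 hu) (Set.mem_Ioi.2 (hu.trans_le hw)) hw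
      simp only [hT] at e1
      linarith [(hasymp w (hu.trans_le hw)).1, hmax hL hU w]
    linarith
  · have : g u + (U * TP + L * TM) ≤ 1 + (U * P + L * M) / 2 := by
      refine ge_of_tendsto (hlim _) ?_
      filter_upwards [eventually_ge_atTop u] with w hw
      have e1 := hmono (Set.mem_Ioi.2 hu) (Set.mem_Ioi.2 (hu.trans_le hw)) hw
      simp only [hT] at e1
      linarith [(hasymp w (hu.trans_le hw)).2, hmax hU hL w]
    linarith

/-- The fraction `1 - |h|/√u` of the radius swept by a wall at signed distance `h`. -/
noncomputable def sweepRadius (h u : ℝ) : ℝ := max 0 (1 - |h| / √u)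

lemma sweepRadius_of_le {h u : ℝ} (hu : 0 < u) (hh : u ≤ h ^ 2) : sweepRadius h u = 0 := by
  refine max_eq_left (sub_nonpos.2 ?_)
  rw [one_le_div (sqrt_pos.2 hu)]
  exact sqrt_le_iff.2 ⟨abs_nonneg h, by rwa [sq_abs]⟩

lemma sweepRadius_of_ge {h u : ℝ} (hu : 0 < u) (hh : h ^ 2 ≤ u) :
    sweepRadius h u = 1 - |h| / √u := by
  refine max_eq_right (sub_nonneg.2 ?_)
  rw [div_le_one (sqrt_pos.2 hu)]
  exact abs_le_sqrt hh

open Classical in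
lemma hasDerivWithinAt_sweepRadius (h : ℝ) {u : ℝ} (hu : 0 < u) :
    HasDerivWithinAt (sweepRadius h) (if u ≤ h ^ 2 then 0 else |h| / (2 * u * √u))
      (Set.Iic u) u := by
  split_ifs with hh
  · refine (hasDerivWithinAt_const u (Set.Iic u) (0 : ℝ)).congr_of_eventuallyEq ?_
      (sweepRadius_of_le hu hh)
    filter_upwards [Ioc_mem_nhdsLE hu] with v hv
    exact sweepRadius_of_le hv.1 (hv.2.trans hh)
  · rw [not_le] at hh
    have h3 := sqrt_pos.2 hu
    have h1 := ((hasDerivAt_sqrt hu.ne').fun_inv h3.ne').const_mul |h|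
    refine ((h1.const_sub 1).congr_of_eventuallyEq ?_).hasDerivWithinAt.congr_deriv ?_
    · filter_upwards [lt_mem_nhds hh] with v hv
      rw [sweepRadius_of_ge (lt_of_le_of_lt (sq_nonneg h) hv) hv.le, div_eq_mul_inv]
    · rw [sq_sqrt hu.le]
      field_simp

open Classical in
lemma odd_step {j : ℕ} (hN : N = 2 * j + 1) (K : ι → Wall N) {U L : ℝ} (hU : 0 ≤ U)
    (hL : 0 ≤ L) (hb : ∀ k v, D j (face K k) v / π ^ j ∈ Set.Icc (-L) U)
    {u : ℝ} (hu : 0 < u) :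
    ∃ (P M : ℕ) (z : ℝ), P + M ≤ Fintype.card ι ∧ 0 ≤ z ∧ z ≤ 1 ∧ (M ≠ 0 → z = 0) ∧
      (P = Fintype.card ι → z = 1) ∧
      z - (U * P + L * M) / 2 ≤ √u * D (j + 1) K u / π ^ j ∧
      √u * D (j + 1) K u / π ^ j ≤ z + (L * P + U * M) / 2 := by
  set g : ℝ → ℝ := fun u => D j K u / (2 * π ^ j * √u) with hg_def
  have hpi := pi_pos
  have hgc : ContinuousOn g (Set.Ioi 0) :=
    (continuousOn_continuous_D j K (by omega)).1.div (by fun_prop) fun u hu => by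
      have := sqrt_pos.2 (Set.mem_Ioi.1 hu); positivity
  have hGc : ∀ k : ι, ContinuousOn (sweepRadius (K k).h) (Set.Ioi 0) := fun k =>
    continuousOn_const.sup (continuousOn_const.sub (continuousOn_const.div (by fun_prop)
      fun u hu => (sqrt_pos.2 (Set.mem_Ioi.1 hu)).ne'))
  have hG0 : ∀ (k : ι) u, 0 < u → 0 ≤
      (1 / 2) * (if u ≤ (K k).h ^ 2 then 0 else |(K k).h| / (2 * u * √u)) :=
    fun k u hu => by split_ifs <;> positivity
  have hsum : ∀ u, 0 < u → √u * D (j + 1) K u / π ^ j = g u - ∑ k, (SignType.sign (K k).h : ℝ) *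
      (D j (face K k) (u - (K k).h ^ 2) / π ^ j) *
        (if u ≤ (K k).h ^ 2 then 0 else |(K k).h| / (2 * √u)) := fun u hu => by
    have e1 := sqrt_pos.2 hu
    have e2 := sq_sqrt hu.le
    have hN' : (N : ℝ) = 2 * j + 1 := by rw [hN]; push_cast; ring
    rw [D_succ, hN']
    have e3 : ∑ k, (SignType.sign (K k).h : ℝ) * (D j (face K k) (u - (K k).h ^ 2) / π ^ j) *
        (if u ≤ (K k).h ^ 2 then 0 else |(K k).h| / (2 * √u)) =
        (∑ k, (K k).h * D j (face K k) (u - (K k).h ^ 2)) / (2 * √u * π ^ j) := by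
      rw [Finset.sum_div]
      refine Finset.sum_congr rfl fun k _ => ?_
      split_ifs with hk
      · rw [D_of_nonpos _ _ (sub_nonpos.2 hk)]; simp
      · have h4 : (SignType.sign (K k).h : ℝ) * |(K k).h| = (K k).h := sign_mul_abs _
        nth_rewrite 4 [← h4]
        field_simp
    rw [e3, hg_def]
    rw [show (2 * (j : ℝ) + 1 - 2 * j) = 1 by ring, one_mul]
    generalize ∑ k, (K k).h * D j (face K k) (u - (K k).h ^ 2) = S
    have e4 : 2 * u = 2 * √u ^ 2 := by rw [e2]
    rw [e4]
    field_simp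
  have hgd : ∀ u, 0 < u → HasDerivWithinAt g (-∑ k, (SignType.sign (K k).h : ℝ) *
      (D j (face K k) (u - (K k).h ^ 2) / π ^ j) *
        ((1 / 2) * (if u ≤ (K k).h ^ 2 then 0 else |(K k).h| / (2 * u * √u)))) (Set.Iic u) u :=
      fun u hu => by
    have e1 := sqrt_pos.2 hu
    have e2 := sq_sqrt hu.le
    refine ((hasDerivWithinAt_D j K u).div
      ((hasDerivAt_sqrt hu.ne').const_mul (2 * π ^ j)).hasDerivWithinAt
      (by positivity)).congr_deriv ?_
    have e3 := hsum u hu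
    rw [sub_eq_add_neg] at e3
    have e4 : -∑ k, (SignType.sign (K k).h : ℝ) * (D j (face K k) (u - (K k).h ^ 2) / π ^ j) *
        ((1 / 2) * (if u ≤ (K k).h ^ 2 then 0 else |(K k).h| / (2 * u * √u))) =
        (-∑ k, (SignType.sign (K k).h : ℝ) * (D j (face K k) (u - (K k).h ^ 2) / π ^ j) *
        (if u ≤ (K k).h ^ 2 then 0 else |(K k).h| / (2 * √u))) / (2 * u) := by
      rw [neg_div, Finset.sum_div]
      congr 1
      refine Finset.sum_congr rfl fun k _ => ?_
      split_ifs
      · simp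
      · field_simp
    rw [e4, ← sub_eq_iff_eq_add'.2 e3, hg_def]
    have e5 : 2 * u = 2 * √u ^ 2 := by rw [e2]
    rw [e5]
    field_simp
  have hGd : ∀ (k : ι) u, 0 < u → HasDerivWithinAt (fun u => 1 / 2 * sweepRadius (K k).h u)
      ((1 / 2) * (if u ≤ (K k).h ^ 2 then 0 else |(K k).h| / (2 * u * √u))) (Set.Iic u) u :=
    fun k u hu => (hasDerivWithinAt_sweepRadius _ hu).const_mul _
  have hmono := monotoneOn_add_wt hgc (fun k => (hGc k).const_mul _) hGd hG0
    (fun k u => hb k (u - (K k).h ^ 2)) hgd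
  have hanti := antitoneOn_sub_wt hgc (fun k => (hGc k).const_mul _) hGd hG0
    (fun k u => hb k (u - (K k).h ^ 2)) hgd
  obtain ⟨P, M, -, -, hPM, -, -, -, -, hM, hP, -, hW⟩ :=
    exists_wt_sum (h := fun k => (K k).h) (T := fun k => 0) fun k => by simp
  obtain ⟨v, hv, hvu, hvs⟩ := exists_small K hu
  have hsv := sqrt_pos.2 hv
  have hgv : g v = (∏ l ∈ Finset.range j, ((N : ℝ) / 2 - l)) * Phi K v /
      (2 * π ^ j * v ^ j * √v) := by
    rw [← D_mul_pow_of_small _ _ hvs, hg_def]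
    field_simp
  have hzero : ∀ U L, ∑ k, wt U L (K k).h * (1 / 2 * sweepRadius (K k).h v) = 0 := fun U L =>
    Finset.sum_eq_zero fun k _ => by
      by_cases hk : (K k).h = 0
      · simp [hk, wt]
      · rw [sweepRadius_of_le hv (hvs k hk), mul_zero, mul_zero]
  have hPhi := prod_mul_Phi_odd hN K hv
  have hterm : ∀ k, 1 / 2 * sweepRadius (K k).h u +
      (if u ≤ (K k).h ^ 2 then 0 else |(K k).h| / (2 * √u)) ≤ 1 / 2 := fun k => by
    split_ifs with hk
    · rw [sweepRadius_of_le hu hk]; norm_num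
    · rw [sweepRadius_of_ge hu (not_le.1 hk).le]
      have := sqrt_pos.2 hu
      field_simp
      linarith
  have hi0 : ∀ k, 0 ≤ (if u ≤ (K k).h ^ 2 then 0 else |(K k).h| / (2 * √u)) := fun k => by
    split_ifs <;> positivity
  refine ⟨P, M, g v, hPM, ?_, ?_, fun h => ?_, fun h => ?_, ?_, ?_⟩
  · rw [hgv]; exact div_nonneg hPhi.1 (by positivity)
  · rw [hgv]; exact div_le_one_of_le₀ hPhi.2 (by positivity)
  · obtain ⟨k, hk⟩ := hM h
    rw [hgv, Phi_eq_zero_of_small K hk (hvs k hk.ne), mul_zero, zero_div]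
  · rw [hgv, Phi_eq_ball_of_small K (hP h) fun k => hvs k (hP h k).ne']
    subst hN
    rw [prod_mul_volume_ball_odd j hv]
    exact div_self (by positivity)
  · have e1 := hmono (Set.mem_Ioi.2 hv) (Set.mem_Ioi.2 hu) hvu
    simp only [hzero] at e1
    have e2 : ∑ k, (SignType.sign (K k).h : ℝ) * (D j (face K k) (u - (K k).h ^ 2) / π ^ j) *
        (if u ≤ (K k).h ^ 2 then 0 else |(K k).h| / (2 * √u)) +
        ∑ k, wt U L (K k).h * (1 / 2 * sweepRadius (K k).h u) ≤ (U * P + L * M) / 2 := by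
      rw [← hW, Finset.sum_div, ← Finset.sum_add_distrib]
      refine Finset.sum_le_sum fun k _ => ?_
      have f1 := mul_le_mul_of_nonneg_right
        (sign_mul_le_wt (h := (K k).h) (hb k (u - (K k).h ^ 2))) (hi0 k)
      have f2 := mul_le_mul_of_nonneg_left (hterm k) (wt_nonneg hU hL (K k).h)
      linarith
    rw [hsum u hu]
    linarith
  · have e1 := hanti (Set.mem_Ioi.2 hv) (Set.mem_Ioi.2 hu) hvu
    simp only [hzero] at e1
    have e2 : -∑ k, (SignType.sign (K k).h : ℝ) * (D j (face K k) (u - (K k).h ^ 2) / π ^ j) *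
        (if u ≤ (K k).h ^ 2 then 0 else |(K k).h| / (2 * √u)) +
        ∑ k, wt L U (K k).h * (1 / 2 * sweepRadius (K k).h u) ≤ (L * P + U * M) / 2 := by
      rw [← hW, Finset.sum_div, ← Finset.sum_neg_distrib, ← Finset.sum_add_distrib]
      refine Finset.sum_le_sum fun k _ => ?_
      have f1 := mul_le_mul_of_nonneg_right
        (neg_sign_mul_le_wt (h := (K k).h) (hb k (u - (K k).h ^ 2))) (hi0 k)
      have f2 := mul_le_mul_of_nonneg_left (hterm k) (wt_nonneg hL hU (K k).h)
      linarith
    rw [hsum u hu]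
    linarith

end Steps

section Induction

open Real

/-- Uniform bound for `p` walls in even dimension. -/
def EvenBound (p : ℕ) (L U : ℝ) : Prop :=
  ∀ (N j : ℕ) (ι : Type) [Fintype ι] [LinearOrder ι] (K : ι → Wall N), Fintype.card ι = p →
    N = 2 * j → ∀ u, D j K u / π ^ j ∈ Set.Icc (-L) U

/-- Uniform bound for `p` walls in odd dimension. -/
def OddBound (p : ℕ) (L U : ℝ) : Prop :=
  ∀ (N j : ℕ) (ι : Type) [Fintype ι] [LinearOrder ι] (K : ι → Wall N), Fintype.card ι = p →
    N = 2 * j + 1 → ∀ u, √u * D (j + 1) K u / π ^ j ∈ Set.Icc (-L) U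

lemma Phi_mem_of_dim_zero {N : ℕ} (hN : N = 0) {ι : Type} (K : ι → Wall N) (u : ℝ) :
    Phi K u ∈ Set.Icc (0 : ℝ) 1 := by
  refine ⟨Phi_nonneg K u, (Phi_le K u).trans ?_⟩
  subst hN
  simp [measureReal_def, volume_euclideanSpace_eq_dirac]

lemma evenBound_of_oddBound {p : ℕ} {L U L' U' : ℝ} (hL : 0 ≤ L) (hU : 0 ≤ U) (hL' : 0 ≤ L')
    (hU' : 1 ≤ U') (hodd : ∀ q, q + 1 = p → OddBound q L U)
    (hstep : ∀ (P M : ℕ) (b₀ TP TM x : ℝ), P + M ≤ p → 0 ≤ TP → TP ≤ P / 2 → 0 ≤ TM →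
      TM ≤ M / 2 → 0 ≤ b₀ → b₀ ≤ 1 → (M ≠ 0 → b₀ = 0) →
      b₀ - (U * TP + L * TM) ≤ x → x ≤ b₀ + (L * TP + U * TM) →
      -(L * (P / 2 - TP) + U * (M / 2 - TM)) ≤ x →
      x ≤ 1 + (U * (P / 2 - TP) + L * (M / 2 - TM)) → x ∈ Set.Icc (-L') U') :
    EvenBound p L' U' := by
  intro N j ι _ _ K hp hN u
  rcases le_or_gt u 0 with hu | hu
  · rw [D_of_nonpos _ _ hu, zero_div]; constructor <;> linarith
  obtain _ | j := j
  · rw [D_zero, pow_zero, div_one]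
    have := Phi_mem_of_dim_zero hN K u
    exact ⟨by linarith [this.1], this.2.trans hU'⟩
  · obtain ⟨P, M, b₀, TP, TM, h1, h2, h3, h4, h5, h6, h7, h8, h9, h10, h11, h12⟩ :=
      even_step hN K hU hL (fun k v => by
        have hc : 0 < Fintype.card ι := Fintype.card_pos_iff.2 ⟨k⟩
        refine hodd (p - 1) (by omega) _ j _ (face K k) ?_ (by omega) v
        simp [hp]) hu
    exact hstep P M b₀ TP TM _ (hp ▸ h1) h2 h3 h4 h5 h6 h7 h8 h9 h10 h11 h12

lemma oddBound_of_evenBound {p : ℕ} {L U L' U' : ℝ} (hL : 0 ≤ L) (hU : 0 ≤ U) (hL' : 0 ≤ L')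
    (hU' : 0 ≤ U') (heven : ∀ q, q + 1 = p → EvenBound q L U)
    (hstep : ∀ (P M : ℕ) (z x : ℝ), P + M ≤ p → 0 ≤ z → z ≤ 1 → (M ≠ 0 → z = 0) →
      (P = p → z = 1) → z - (U * P + L * M) / 2 ≤ x → x ≤ z + (L * P + U * M) / 2 →
      x ∈ Set.Icc (-L') U') :
    OddBound p L' U' := by
  intro N j ι _ _ K hp hN u
  rcases le_or_gt u 0 with hu | hu
  · rw [D_of_nonpos _ _ hu, mul_zero, zero_div]; constructor <;> linarith
  · obtain ⟨P, M, z, h1, h2, h3, h4, h5, h6, h7⟩ :=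
      odd_step hN K hU hL (fun k v => by
        have hc : 0 < Fintype.card ι := Fintype.card_pos_iff.2 ⟨k⟩
        refine heven (p - 1) (by omega) _ j _ (face K k) ?_ (by omega) v
        simp [hp]) hu
    exact hstep P M z _ (hp ▸ h1) h2 h3 h4 (hp ▸ h5) h6 h7

lemma evenBound_zero : EvenBound 0 0 1 := by
  refine evenBound_of_oddBound (L := 0) (U := 0) le_rfl le_rfl le_rfl le_rfl (by simp) ?_
  intro P M b₀ TP TM x h1 h2 h3 h4 h5 h6 h7 h8 h9 h10 h11 h12
  constructor <;> linarith

lemma oddBound_zero : OddBound 0 0 1 := by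
  refine oddBound_of_evenBound (L := 0) (U := 0) le_rfl le_rfl le_rfl zero_le_one (by simp) ?_
  intro P M z x h1 h2 h3 h4 h5 h6 h7
  constructor <;> linarith

lemma evenBound_one : EvenBound 1 0 1 := by
  refine evenBound_of_oddBound (L := 0) (U := 1) le_rfl zero_le_one le_rfl le_rfl
    (fun q hq => by obtain rfl : q = 0 := by omega
                    exact oddBound_zero) ?_
  intro P M b₀ TP TM x h1 h2 h3 h4 h5 h6 h7 h8 h9 h10 h11 h12
  have hP : P ≤ 1 := by omega
  have hM : M ≤ 1 := by omega
  interval_cases P <;> interval_cases M <;> norm_num at * <;> constructor <;> linarith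

lemma oddBound_one : OddBound 1 0 1 := by
  refine oddBound_of_evenBound (L := 0) (U := 1) le_rfl zero_le_one le_rfl zero_le_one
    (fun q hq => by obtain rfl : q = 0 := by omega
                    exact evenBound_zero) ?_
  intro P M z x h1 h2 h3 h4 h5 h6 h7
  have hP : P ≤ 1 := by omega
  have hM : M ≤ 1 := by omega
  interval_cases P <;> interval_cases M <;> norm_num at * <;> constructor <;> linarith

lemma evenBound_two : EvenBound 2 (1 / 2) 1 := by
  refine evenBound_of_oddBound (L := 0) (U := 1) le_rfl zero_le_one (by norm_num) le_rfl
    (fun q hq => by obtain rfl : q = 1 := by omega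
                    exact oddBound_one) ?_
  intro P M b₀ TP TM x h1 h2 h3 h4 h5 h6 h7 h8 h9 h10 h11 h12
  have hP : P ≤ 2 := by omega
  have hM : M ≤ 2 := by omega
  interval_cases P <;> interval_cases M <;> norm_num at * <;> constructor <;> linarith

lemma oddBound_two : OddBound 2 (1 / 2) 1 := by
  refine oddBound_of_evenBound (L := 0) (U := 1) le_rfl zero_le_one (by norm_num) zero_le_one
    (fun q hq => by obtain rfl : q = 1 := by omega
                    exact evenBound_one) ?_
  intro P M z x h1 h2 h3 h4 h5 h6 h7
  have hP : P ≤ 2 := by omega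
  have hM : M ≤ 2 := by omega
  interval_cases P <;> interval_cases M <;> norm_num at * <;> constructor <;> linarith

lemma evenBound_three : EvenBound 3 (3 / 2) (3 / 2) := by
  refine evenBound_of_oddBound (L := 1 / 2) (U := 1) (by norm_num) zero_le_one (by norm_num)
    (by norm_num) (fun q hq => by obtain rfl : q = 2 := by omega
                                  exact oddBound_two) ?_
  intro P M b₀ TP TM x h1 h2 h3 h4 h5 h6 h7 h8 h9 h10 h11 h12
  have hP : P ≤ 3 := by omega
  have hM : M ≤ 3 := by omega
  interval_cases P <;> interval_cases M <;> norm_num at * <;> constructor <;> linarith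

lemma oddBound_three : OddBound 3 2 2 := by
  refine oddBound_of_evenBound (L := 1 / 2) (U := 1) (by norm_num) zero_le_one (by norm_num)
    (by norm_num) (fun q hq => by obtain rfl : q = 2 := by omega
                                  exact evenBound_two) ?_
  intro P M z x h1 h2 h3 h4 h5 h6 h7
  have hP : P ≤ 3 := by omega
  have hM : M ≤ 3 := by omega
  interval_cases P <;> interval_cases M <;> norm_num at * <;> constructor <;> linarith

/-- The constant `p! / 2 ^ (p - 1)`. -/
noncomputable def halfFactorial (p : ℕ) : ℝ := p.factorial / 2 ^ (p - 1)

lemma halfFactorial_succ {p : ℕ} (hp : 1 ≤ p) :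
    halfFactorial (p + 1) = (p + 1) / 2 * halfFactorial p := by
  obtain ⟨p, rfl⟩ := Nat.exists_eq_add_of_le' hp
  rw [halfFactorial, halfFactorial, Nat.factorial_succ (p + 1), Nat.add_sub_cancel,
    Nat.add_sub_cancel, pow_succ]
  push_cast
  field_simp

lemma evenBound_succ {p : ℕ} {A B : ℝ} (hA : 0 ≤ A) (hB : 1 ≤ B) (h : OddBound p A A)
    (hAB : 2 + A * (p + 1) / 2 ≤ 2 * B) : EvenBound (p + 1) B B := by
  refine evenBound_of_oddBound hA hA (by linarith) hB
    (fun q hq => by obtain rfl : q = p := by omega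
                    exact h) ?_
  intro P M b₀ TP TM x h1 h2 h3 h4 h5 h6 h7 h8 h9 h10 h11 h12
  have hPM : (P : ℝ) + M ≤ p + 1 := by exact_mod_cast h1
  have := mul_le_mul_of_nonneg_left hPM hA
  constructor <;> linarith

lemma oddBound_succ {p : ℕ} {B : ℝ} (hB : 0 ≤ B) (h : EvenBound p B B) :
    OddBound (p + 1) (1 + (p + 1) / 2 * B) (1 + (p + 1) / 2 * B) := by
  have h0 : 0 ≤ 1 + (p + 1) / 2 * B := by positivity
  refine oddBound_of_evenBound hB hB h0 h0
    (fun q hq => by obtain rfl : q = p := by omega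
                    exact h) ?_
  intro P M z x h1 h2 h3 h4 h5 h6 h7
  have hPM : (P : ℝ) + M ≤ p + 1 := by exact_mod_cast h1
  have := mul_le_mul_of_nonneg_left hPM hB
  constructor <;> linarith

lemma EvenBound.mono {p : ℕ} {L U L' U' : ℝ} (h : EvenBound p L U) (hL : L ≤ L') (hU : U ≤ U') :
    EvenBound p L' U' := fun N j ι _ _ K hp hN u =>
  ⟨by linarith [(h N j ι K hp hN u).1], (h N j ι K hp hN u).2.trans hU⟩

lemma bounds_of_four_le {p : ℕ} (hp : 4 ≤ p) : 3 ≤ halfFactorial p ∧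
    EvenBound p (halfFactorial p) (halfFactorial p) ∧
    OddBound p (1 + halfFactorial p) (1 + halfFactorial p) := by
  induction p, hp using Nat.le_induction with
  | base =>
    have h3 : halfFactorial 3 = 3 / 2 := by norm_num [halfFactorial, Nat.factorial]
    have h4 : halfFactorial 4 = 3 := by norm_num [halfFactorial, Nat.factorial]
    refine ⟨h4.ge, ?_, ?_⟩
    · rw [h4]
      exact evenBound_succ (A := 2) (by norm_num) (by norm_num) oddBound_three (by norm_num)
    · rw [halfFactorial_succ (by norm_num), h3]
      exact oddBound_succ (by norm_num) evenBound_three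
  | succ p hp ih =>
    obtain ⟨h1, h2, h3⟩ := ih
    have hp' : (4 : ℝ) ≤ p := by exact_mod_cast hp
    rw [halfFactorial_succ (by omega)]
    refine ⟨by nlinarith, ?_, ?_⟩
    · exact evenBound_succ (by linarith) (by nlinarith) h3 (by nlinarith)
    · exact oddBound_succ (by linarith) h2

lemma evenBound_halfFactorial (p : ℕ) : EvenBound p (halfFactorial p) (halfFactorial p) := by
  rcases le_or_gt 4 p with hp | hp
  · exact (bounds_of_four_le hp).2.1
  · interval_cases p
    · exact evenBound_zero.mono (by norm_num [halfFactorial]) (by norm_num [halfFactorial])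
    · exact evenBound_one.mono (by norm_num [halfFactorial]) (by norm_num [halfFactorial])
    · exact evenBound_two.mono (by norm_num [halfFactorial]) (by norm_num [halfFactorial])
    · exact evenBound_three.mono (by norm_num [halfFactorial, Nat.factorial])
        (by norm_num [halfFactorial, Nat.factorial])

lemma abs_D_le {N j : ℕ} (hN : N = 2 * j) {ι : Type} [Fintype ι] [LinearOrder ι] (K : ι → Wall N)
    (u : ℝ) : |D j K u| ≤ π ^ j * halfFactorial (Fintype.card ι) := by
  have h := abs_le.2 (evenBound_halfFactorial _ N j ι K rfl hN u)
  rwa [abs_div, abs_of_pos (pow_pos pi_pos j), div_le_iff₀ (pow_pos pi_pos j), mul_comm] at h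

end Induction

section Shapes

/-- A half-space of the upper half-space model, at height `√σ`: the ball of squared radius `ρ`
(`e = -1`), its complement (`e = 1`) or an affine half-space (`e = 0`). -/
structure Shape (N : ℕ) where
  e : ℝ
  c : EuclideanSpace ℝ (Fin N)
  ρ : ℝ

namespace Shape

variable {N : ℕ} {ι : Type}

def holds (s : Shape N) (σ : ℝ) (x : EuclideanSpace ℝ (Fin N)) : Prop :=
  (s.e = 0 → s.ρ ≤ inner ℝ s.c x) ∧ s.e * (s.ρ - ‖x - s.c‖ ^ 2) ≤ s.e * σ

/-- Horizontal slice of a polytope at height `√σ`. -/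
def slice (S : ι → Shape N) (σ : ℝ) : Set (EuclideanSpace ℝ (Fin N)) :=
  {x | ∀ i, (S i).holds σ x}

lemma measurableSet_slice_prod [Finite ι] (S : ι → Shape N) :
    MeasurableSet {p : ℝ × EuclideanSpace ℝ (Fin N) | p.2 ∈ slice S p.1} := by
  have : {p : ℝ × EuclideanSpace ℝ (Fin N) | p.2 ∈ slice S p.1} =
      ⋂ i, {p | ((S i).e = 0 → (S i).ρ ≤ inner ℝ (S i).c p.2)} ∩
        {p | (S i).e * ((S i).ρ - ‖p.2 - (S i).c‖ ^ 2) ≤ (S i).e * p.1} := by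
    ext p; simp [slice, holds]
  rw [this]
  refine MeasurableSet.iInter fun i => MeasurableSet.inter ?_
    (measurableSet_le (by fun_prop) (by fun_prop))
  by_cases h : (S i).e = 0
  · simp only [h, forall_const]
    exact measurableSet_le (by fun_prop) (by fun_prop)
  · simp [h]

lemma measurableSet_slice [Finite ι] (S : ι → Shape N) (σ : ℝ) : MeasurableSet (slice S σ) :=
  (measurable_prodMk_left (x := σ)) (measurableSet_slice_prod S)

noncomputable def area (S : ι → Shape N) (σ : ℝ) : ℝ := volume.real (slice S σ)

lemma measurable_area [Finite ι] (S : ι → Shape N) : Measurable (area S) :=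
  (measurable_measure_prodMk_left (measurableSet_slice_prod S)).ennreal_toReal

lemma area_nonneg (S : ι → Shape N) (σ : ℝ) : 0 ≤ area S σ := measureReal_nonneg

/-- The polytope bounded by the radical hyperplanes of the `k`-th sphere with the others. -/
noncomputable def walls [LinearOrder ι] (S : ι → Shape N) (k : ι) : {j // j ≠ k} → Wall N := fun j =>
  open Classical in
  if (S j).e = 0 then ⟨(S j).c, inner ℝ (S j).c (S k).c - (S j).ρ, False⟩
  else ⟨(2 * (S j).e) • ((S k).c - (S j).c),
    (S j).e * ((S k).ρ - (S j).ρ + ‖(S k).c - (S j).c‖ ^ 2), 0 < (S j).e * (S k).e ∧ j < k⟩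

lemma walls_holds [LinearOrder ι] (S : ι → Shape N) (k : ι) (j : {j // j ≠ k})
    (x : EuclideanSpace ℝ (Fin N)) :
    (walls S k j).holds (x - (S k).c) ↔ ((S j).e = 0 → (S j).ρ ≤ inner ℝ (S j).c x) ∧
      (S j).e * ((S j).ρ - ‖x - (S j).c‖ ^ 2) ≤ (S j).e * ((S k).ρ - ‖x - (S k).c‖ ^ 2) ∧
      (0 < (S j).e * (S k).e ∧ j < k →
        (S j).e * ((S j).ρ - ‖x - (S j).c‖ ^ 2) < (S j).e * ((S k).ρ - ‖x - (S k).c‖ ^ 2)) := by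
  by_cases h : (S j).e = 0
  · simp [walls, h, Wall.holds, inner_sub_right]
  · have key : inner ℝ ((2 * (S j).e) • ((S k).c - (S j).c)) (x - (S k).c) +
        (S j).e * ((S k).ρ - (S j).ρ + ‖(S k).c - (S j).c‖ ^ 2) =
        (S j).e * ((S k).ρ - ‖x - (S k).c‖ ^ 2) - (S j).e * ((S j).ρ - ‖x - (S j).c‖ ^ 2) := by
      rw [show x - (S j).c = (x - (S k).c) + ((S k).c - (S j).c) by abel, norm_add_sq_real,
        real_inner_smul_left, real_inner_comm]
      ring
    simp only [walls, h, if_false, Wall.holds, key, false_imp_iff, true_and, sub_nonneg, sub_pos]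

lemma ind_region_sub [LinearOrder ι] (S : ι → Shape N) {k : ι} (hk : (S k).e ≠ 0) {σ : ℝ}
    (hσ : 0 < σ) (x : EuclideanSpace ℝ (Fin N)) :
    ind ((0 < (S k).ρ - ‖x - (S k).c‖ ^ 2 ∧ (S k).ρ - ‖x - (S k).c‖ ^ 2 ≤ σ) ∧
      (∀ i, (S i).e = 0 → (S i).ρ ≤ inner ℝ (S i).c x) ∧ ∀ j, j ≠ k →
      (S j).e * ((S j).ρ - ‖x - (S j).c‖ ^ 2) ≤ (S j).e * ((S k).ρ - ‖x - (S k).c‖ ^ 2) ∧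
      (0 < (S j).e * (S k).e ∧ j < k →
        (S j).e * ((S j).ρ - ‖x - (S j).c‖ ^ 2) < (S j).e * ((S k).ρ - ‖x - (S k).c‖ ^ 2))) =
    ind (x - (S k).c ∈ region (walls S k) (S k).ρ) -
      ind (x - (S k).c ∈ region (walls S k) ((S k).ρ - σ)) := by
  have h1 : ((∀ i, (S i).e = 0 → (S i).ρ ≤ inner ℝ (S i).c x) ∧ ∀ j, j ≠ k →
      (S j).e * ((S j).ρ - ‖x - (S j).c‖ ^ 2) ≤ (S j).e * ((S k).ρ - ‖x - (S k).c‖ ^ 2) ∧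
      (0 < (S j).e * (S k).e ∧ j < k →
        (S j).e * ((S j).ρ - ‖x - (S j).c‖ ^ 2) < (S j).e * ((S k).ρ - ‖x - (S k).c‖ ^ 2))) ↔
      ∀ j, (walls S k j).holds (x - (S k).c) := by
    simp only [walls_holds]
    constructor
    · exact fun h j => ⟨h.1 j, h.2 j j.2⟩
    · refine fun h => ⟨fun i hi => ?_, fun j hj => (h ⟨j, hj⟩).2⟩
      exact (h ⟨i, fun hik => hk (hik ▸ hi)⟩).1 hi
  rw [h1]
  simp only [region, Set.mem_ofPred_eq]
  by_cases hw : ∀ j, (walls S k j).holds (x - (S k).c)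
  swap; · rw [ind_neg (fun h => hw h.2), ind_neg (fun h => hw h.1), ind_neg (fun h => hw h.1), sub_zero]
  simp only [hw, implies_true, true_and, and_true, ind, tsub_le_iff_right, lt_sub_iff_add_lt]
  by_cases h2 : ‖x - (S k).c‖ ^ 2 + σ < (S k).ρ
  · have h3 : ‖x - (S k).c‖ ^ 2 < (S k).ρ := by linarith
    have h4 : ¬ (S k).ρ ≤ σ + ‖x - (S k).c‖ ^ 2 := by linarith
    simp [h2, h3, h4]
  · have h4 : (S k).ρ ≤ σ + ‖x - (S k).c‖ ^ 2 := by linarith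
    simp [h2, h4]

lemma ae_ne [Finite ι] (S : ι → Shape N) {σ : ℝ} (h : ∀ i, (S i).e ≠ 0 → σ < (S i).ρ) :
    ∀ᵐ x, ∀ i, (S i).e ≠ 0 → (S i).ρ - ‖x - (S i).c‖ ^ 2 ≠ σ := by
  rw [ae_all_iff]
  intro i
  by_cases hi : (S i).e = 0
  · simp [hi]
  have hpos := sub_pos.2 (h i hi)
  refine measure_mono_null (fun x hx => ?_) (Measure.addHaar_sphere_of_ne_zero volume (S i).c
    (Real.sqrt_pos.2 hpos).ne')
  simp only [Set.mem_compl_iff, Set.mem_ofPred_eq, not_forall, not_not] at hx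
  obtain ⟨-, hx⟩ := hx
  rw [mem_sphere_iff_norm, ← hx, sub_sub_cancel, Real.sqrt_sq (norm_nonneg _)]

lemma area_sub [Fintype ι] [LinearOrder ι] (S : ι → Shape N) {σ : ℝ} (hσ : 0 < σ)
    (h : ∀ i, (S i).e ≠ 0 → σ < (S i).ρ) (h0 : volume (slice S 0) ≠ ⊤)
    (h1 : volume (slice S σ) ≠ ⊤) :
    area S σ - area S 0 = ∑ k, (SignType.sign (S k).e : ℝ) *
      (Phi (walls S k) (S k).ρ - Phi (walls S k) ((S k).ρ - σ)) := by
  have hP : ∀ k u, Phi (walls S k) u = ∫ x, ind (x - (S k).c ∈ region (walls S k) u) := by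
    intro k u
    rw [integral_sub_right_eq_self (f := fun x => ind (x ∈ region (walls S k) u)),
      integral_ind_mem (measurableSet_region _ _)]
    rfl
  have hI : ∀ k u, Integrable fun x => ind (x - (S k).c ∈ region (walls S k) u) := fun k u =>
    (integrable_ind_mem (measurableSet_region (walls S k) u)
      (volume_region_ne_top _ _)).comp_sub_right (S k).c
  simp only [hP]
  rw [area, area, ← integral_ind_mem (measurableSet_slice S _),
    ← integral_ind_mem (measurableSet_slice S _),
    ← integral_sub (integrable_ind_mem (measurableSet_slice S _) h1)
      (integrable_ind_mem (measurableSet_slice S _) h0)]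
  simp only [← integral_sub (hI _ _) (hI _ _), ← integral_const_mul]
  rw [← integral_finsetSum _ fun k _ => by
    simpa only [Pi.sub_apply] using (((hI k _).sub (hI k _)).const_mul _)]
  refine integral_congr_ae ?_
  filter_upwards [ae_ne S h, ae_ne S (σ := 0) fun i hi => hσ.trans (h i hi)] with x hx1 hx2
  have := sweep_indicator (fun i => (S i).e) (fun i => (S i).ρ - ‖x - (S i).c‖ ^ 2)
    (∀ i, (S i).e = 0 → (S i).ρ ≤ inner ℝ (S i).c x) hσ hx2 hx1
  simp only [slice, holds, Set.mem_ofPred_eq, forall_and]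
  rw [this]
  refine Finset.sum_congr rfl fun k _ => ?_
  by_cases hk : (S k).e = 0
  · simp [hk]
  · rw [ind_region_sub S hk hσ]

open Classical in
/-- Peano coefficients of the slice area at the ideal boundary. -/
noncomputable def coeff [Fintype ι] [LinearOrder ι] (S : ι → Shape N) (l : ℕ) : ℝ :=
  if l = 0 then area S 0
  else -∑ k, (SignType.sign (S k).e : ℝ) * ((-1) ^ l * D l (walls S k) (S k).ρ / l.factorial)

lemma hasExpansion_area [Fintype ι] [LinearOrder ι] (S : ι → Shape N)
    (hρ : ∀ i, (S i).e ≠ 0 → 0 < (S i).ρ) (h0 : ∀ σ, 0 ≤ σ → volume (slice S σ) ≠ ⊤) (r : ℕ) :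
    HasExpansion (area S) (r + 1) (coeff S) := by
  have key : ∀ᶠ σ in 𝓝[>] 0, area S σ - ∑ l ∈ Finset.range (r + 1), coeff S l * σ ^ l =
      -∑ k, (SignType.sign (S k).e : ℝ) * (D 0 (walls S k) ((S k).ρ - σ) -
        ∑ l ∈ Finset.range (r + 1),
          ((-1) ^ l * D (0 + l) (walls S k) (S k).ρ / l.factorial) * σ ^ l) := by
    have hev : ∀ᶠ σ in 𝓝[>] (0 : ℝ), ∀ i, (S i).e ≠ 0 → σ < (S i).ρ := by
      rw [eventually_all]
      intro i
      by_cases hi : (S i).e = 0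
      · simp [hi]
      · filter_upwards [Ioo_mem_nhdsGT (hρ i hi)] with σ hσ _ using hσ.2
    filter_upwards [hev, self_mem_nhdsWithin] with σ h1 h2
    have h3 := area_sub S h2 h1 (h0 0 le_rfl) (h0 σ (le_of_lt h2))
    rw [sub_eq_iff_eq_add] at h3
    rw [h3]
    simp only [Finset.sum_range_succ' _ r, coeff, D_zero, zero_add]
    simp only [Nat.add_eq_zero_iff, one_ne_zero, and_false, if_false, if_true, pow_zero,
      Nat.factorial_zero, Nat.cast_one, div_one, one_mul, mul_one]
    simp only [neg_mul, Finset.sum_neg_distrib, Finset.sum_mul, mul_sub, Finset.sum_sub_distrib,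
      mul_add, Finset.sum_add_distrib, Finset.mul_sum]
    rw [Finset.sum_comm]
    simp only [mul_assoc]
    ring
  refine Asymptotics.IsBigO.congr' ?_ (key.mono fun _ h => h.symm) EventuallyEq.rfl
  exact (Asymptotics.IsBigO.fun_sum fun k _ => (hasExpansion_D (r + 1) 0 (walls S k)
    (S k).ρ).const_mul_left _).neg_left

lemma halfFactorial_mono {p q : ℕ} (hp : 1 ≤ p) (h : p ≤ q) :
    halfFactorial p ≤ halfFactorial q := by
  induction q, h using Nat.le_induction with
  | base => exact le_rfl
  | succ q hq ih =>
    have hq' : (1 : ℝ) ≤ q := by exact_mod_cast hp.trans hq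
    have : 0 ≤ halfFactorial q := by unfold halfFactorial; positivity
    rw [halfFactorial_succ (hp.trans hq)]
    nlinarith

lemma mul_halfFactorial_pred_le {p m : ℕ} (hpm : p ≤ m) :
    p * halfFactorial (p - 1) ≤ 2 * halfFactorial m := by
  have hpos : 0 ≤ halfFactorial m := by unfold halfFactorial; positivity
  obtain _ | _ | p := p
  · simpa using hpos
  · have h := halfFactorial_mono le_rfl hpm
    norm_num [halfFactorial] at h ⊢
    linarith
  · have h := halfFactorial_mono (by omega) hpm
    rw [halfFactorial_succ (by omega)] at h
    simp only [Nat.add_sub_cancel]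
    push_cast at h ⊢
    linarith

lemma area_le_one_of_dim_zero (S : ι → Shape N) (hN : N = 0) (σ : ℝ) : area S σ ≤ 1 := by
  subst hN
  have : (volume : Measure (EuclideanSpace ℝ (Fin 0))) = Measure.dirac 0 :=
    volume_euclideanSpace_eq_dirac _
  rw [area, this]
  exact measureReal_le_one

lemma abs_coeff_le [Fintype ι] [LinearOrder ι] (S : ι → Shape N) {j m : ℕ} (hN : N = 2 * j)
    (hm : 1 ≤ m) (hc : Fintype.card ι ≤ m) :
    j.factorial * |coeff S j| ≤ 2 * Real.pi ^ j * halfFactorial m := by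
  rcases Nat.eq_zero_or_pos j with rfl | hj
  · have h1 := area_le_one_of_dim_zero S hN 0
    have h2 := halfFactorial_mono le_rfl hm
    norm_num [halfFactorial] at h2
    simp only [coeff, if_true, abs_of_nonneg (area_nonneg S 0), halfFactorial]
    norm_num
    linarith
  have hfac : (0 : ℝ) < j.factorial := by exact_mod_cast j.factorial_pos
  have h1 : ∀ k, |(SignType.sign (S k).e : ℝ) *
      ((-1) ^ j * D j (walls S k) (S k).ρ / j.factorial)| ≤
        Real.pi ^ j * halfFactorial (Fintype.card ι - 1) / j.factorial := by
    intro k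
    have h2 := abs_D_le hN (walls S k) (S k).ρ
    rw [show Fintype.card {i // i ≠ k} = Fintype.card ι - 1 by simp] at h2
    rw [abs_mul, abs_div, abs_mul, abs_pow, abs_neg, abs_one, one_pow, one_mul,
      abs_of_pos hfac, ← mul_div_assoc]
    refine div_le_div_of_nonneg_right ?_ hfac.le
    have h3 : |(SignType.sign (S k).e : ℝ)| ≤ 1 := by
      cases SignType.sign (S k).e <;> simp
    nlinarith [abs_nonneg (D j (walls S k) (S k).ρ)]
  rw [coeff, if_neg hj.ne', abs_neg]
  calc (j.factorial : ℝ) * |∑ k, (SignType.sign (S k).e : ℝ) *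
        ((-1) ^ j * D j (walls S k) (S k).ρ / j.factorial)|
      ≤ j.factorial * ∑ _k : ι, Real.pi ^ j * halfFactorial (Fintype.card ι - 1) / j.factorial := by
        gcongr
        exact (Finset.abs_sum_le_sum_abs _ _).trans (Finset.sum_le_sum fun k _ => h1 k)
    _ = Real.pi ^ j * (Fintype.card ι * halfFactorial (Fintype.card ι - 1)) := by
        rw [Finset.sum_const, nsmul_eq_mul, Finset.card_univ]; field_simp
    _ ≤ Real.pi ^ j * (2 * halfFactorial m) := by
        exact mul_le_mul_of_nonneg_left (mul_halfFactorial_pred_le hc) (by positivity)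
    _ = _ := by ring

end Shape

end Shapes

section Gaussian

open Complex (I)

/-- The kernel `(t - εi)^{-m}`. -/
noncomputable def kern (m : ℕ) (ε t : ℝ) : ℂ := ((t : ℂ) - ε * I) ^ (-(m : ℤ))

lemma sub_mul_I_ne_zero {ε : ℝ} (hε : 0 < ε) (t : ℝ) : (t : ℂ) - ε * I ≠ 0 := fun h => by
  have := congrArg Complex.im h
  simp at this
  exact hε.ne' this

lemma kern_zero (ε t : ℝ) : kern 0 ε t = 1 := by simp [kern]

lemma kern_mul {ε : ℝ} (hε : 0 < ε) (m : ℕ) (t : ℝ) :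
    ((t : ℂ) - ε * I) * kern (m + 1) ε t = kern m ε t := by
  have := sub_mul_I_ne_zero hε t
  rw [kern, kern, ← zpow_one_add₀ this]
  congr 1; push_cast; ring

lemma norm_kern (m : ℕ) (ε t : ℝ) : ‖kern m ε t‖ = (‖(t : ℂ) - ε * I‖ ^ m)⁻¹ := by
  rw [kern, zpow_neg, zpow_natCast, norm_inv, norm_pow]

lemma norm_kern_le {ε : ℝ} (hε : 0 < ε) (m : ℕ) (t : ℝ) : ‖kern m ε t‖ ≤ (ε ^ m)⁻¹ := by
  rw [norm_kern]
  gcongr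
  have := Complex.abs_im_le_norm ((t : ℂ) - ε * I)
  simpa [abs_of_pos hε] using this

lemma norm_kern_le_of_ne_zero {t : ℝ} (ht : t ≠ 0) (m : ℕ) (ε : ℝ) :
    ‖kern m ε t‖ ≤ (|t| ^ m)⁻¹ := by
  rw [norm_kern]
  have : 0 < |t| := abs_pos.2 ht
  gcongr
  simpa using Complex.abs_re_le_norm ((t : ℂ) - ε * I)

lemma hasDerivAt_kern {ε : ℝ} (hε : 0 < ε) (m : ℕ) (t : ℝ) :
    HasDerivAt (kern m ε) (-(m : ℂ) * kern (m + 1) ε t) t := by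
  have h1 : HasDerivAt (fun t : ℝ => (t : ℂ) - ε * I) 1 t :=
    (Complex.ofRealCLM.hasDerivAt (x := t)).sub_const _
  have h2 := (hasDerivAt_zpow (-(m : ℤ)) ((t : ℂ) - ε * I)
    (Or.inl (sub_mul_I_ne_zero hε t))).comp t h1
  refine h2.congr_deriv ?_
  rw [kern, mul_one]
  push_cast
  congr 2
  ring

lemma continuous_kern {ε : ℝ} (hε : 0 < ε) (m : ℕ) : Continuous (kern m ε) :=
  continuous_iff_continuousAt.2 fun t => (hasDerivAt_kern hε m t).continuousAt

lemma tendsto_kern {t : ℝ} (ht : t ≠ 0) (m : ℕ) :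
    Tendsto (fun ε => kern m ε t) (𝓝[>] 0) (𝓝 ((t : ℂ) ^ (-(m : ℤ)))) := by
  have h1 : ContinuousAt (fun ε : ℝ => (t : ℂ) - ε * I) 0 := by fun_prop
  have h2 : ContinuousAt (fun ε => kern m ε t) 0 := by
    refine ContinuousAt.zpow₀ h1 _ (Or.inl ?_)
    simpa using ht
  have := h2.tendsto
  simp only [kern, Complex.ofReal_zero, zero_mul, sub_zero] at this
  exact this.mono_left nhdsWithin_le_nhds

lemma integrable_mul_kern {ε : ℝ} (hε : 0 < ε) (m : ℕ) {f : ℝ → ℂ} (hf : Integrable f) :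
    Integrable fun t => f t * kern m ε t :=
  hf.mul_bdd (continuous_kern hε m).aestronglyMeasurable
    (Eventually.of_forall fun t => norm_kern_le hε m t)

/-- `∫ e^{-bt²} (t - εi)^{-m} dt`. -/
noncomputable def gaussKern (b : ℝ) (m : ℕ) (ε : ℝ) : ℂ :=
  ∫ t : ℝ, (Real.exp (-b * t ^ 2) : ℂ) * kern m ε t

lemma integrable_gauss {b : ℝ} (hb : 0 < b) :
    Integrable fun t : ℝ => (Real.exp (-b * t ^ 2) : ℂ) :=
  (integrable_exp_neg_mul_sq hb).ofReal

lemma integrable_mul_gauss {b : ℝ} (hb : 0 < b) :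
    Integrable fun t : ℝ => (t : ℂ) * (Real.exp (-b * t ^ 2) : ℂ) := by
  simpa using (integrable_mul_exp_neg_mul_sq hb).ofReal (𝕜 := ℂ)

lemma gaussKern_add_two {b ε : ℝ} (hb : 0 < b) (hε : 0 < ε) (m : ℕ) :
    gaussKern b (m + 2) ε = -2 * b / (m + 1) * (gaussKern b m ε + ε * I * gaussKern b (m + 1) ε) := by
  have hg := integrable_gauss hb
  have htg := integrable_mul_gauss hb
  have hd : ∀ t : ℝ, HasDerivAt (fun t : ℝ => (Real.exp (-b * t ^ 2) : ℂ) * kern (m + 1) ε t)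
      (-2 * b * (((t : ℂ) * (Real.exp (-b * t ^ 2) : ℂ)) * kern (m + 1) ε t) -
        (m + 1) * ((Real.exp (-b * t ^ 2) : ℂ) * kern (m + 2) ε t)) t := by
    intro t
    have h1 : HasDerivAt (fun t : ℝ => Real.exp (-b * t ^ 2))
        (Real.exp (-b * t ^ 2) * (-b * (2 * t))) t := by
      have := ((hasDerivAt_pow 2 t).const_mul (-b)).exp
      simpa using this
    refine (h1.ofReal_comp.mul (hasDerivAt_kern hε (m + 1) t)).congr_deriv ?_
    push_cast
    ring
  have hi1 := (integrable_mul_kern hε (m + 1) htg).const_mul (-2 * b : ℂ)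
  have hi2 := (integrable_mul_kern hε (m + 2) hg).const_mul (m + 1 : ℂ)
  have h0 := integral_eq_zero_of_hasDerivAt_of_integrable hd (hi1.sub hi2)
    (integrable_mul_kern hε (m + 1) hg)
  rw [integral_sub hi1 hi2, integral_const_mul, integral_const_mul] at h0
  have h3 : ∫ t : ℝ, ((t : ℂ) * (Real.exp (-b * t ^ 2) : ℂ)) * kern (m + 1) ε t =
      gaussKern b m ε + ε * I * gaussKern b (m + 1) ε := by
    rw [gaussKern, gaussKern, ← integral_const_mul,
      ← integral_add (integrable_mul_kern hε m hg) ((integrable_mul_kern hε (m + 1) hg).const_mul _)]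
    refine integral_congr_ae (Eventually.of_forall fun t => ?_)
    simp only [← kern_mul hε m t]
    ring
  rw [h3] at h0
  have hm : (m + 1 : ℂ) ≠ 0 := by exact_mod_cast m.succ_ne_zero
  change _ - (m + 1 : ℂ) * gaussKern b (m + 2) ε = 0 at h0
  field_simp
  linear_combination -h0

lemma gaussKern_zero (b ε : ℝ) : gaussKern b 0 ε = Real.sqrt (Real.pi / b) := by
  simp only [gaussKern, kern_zero, mul_one]
  rw [integral_complex_ofReal, integral_gaussian]

lemma gaussKern_one {b ε : ℝ} (hb : 0 < b) (hε : 0 < ε) :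
    gaussKern b 1 ε = I * (∫ u : ℝ, Real.exp (-b * (ε * u) ^ 2) * (1 + u ^ 2)⁻¹ : ℝ) := by
  have hg := integrable_gauss hb
  have h1 := integrable_mul_kern hε 1 hg
  have h2 : gaussKern b 1 ε = ∫ t : ℝ, (Real.exp (-b * t ^ 2) : ℂ) * kern 1 ε (-t) := by
    rw [gaussKern, ← integral_neg_eq_self]; simp
  have h3 : (2 : ℂ) * gaussKern b 1 ε = ∫ t : ℝ, (2 * I / ε) *
      ((Real.exp (-b * (ε * (ε⁻¹ * t)) ^ 2) * (1 + (ε⁻¹ * t) ^ 2)⁻¹ : ℝ) : ℂ) := by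
    have h4 : Integrable fun t : ℝ => (Real.exp (-b * t ^ 2) : ℂ) * kern 1 ε (-t) := by
      simpa using h1.comp_neg
    rw [two_mul]
    nth_rewrite 2 [h2]
    rw [gaussKern, ← integral_add h1 h4]
    refine integral_congr_ae (Eventually.of_forall fun t => ?_)
    have e1 := sub_mul_I_ne_zero hε t
    have e2 := sub_mul_I_ne_zero hε (-t)
    have e3 : ((ε : ℂ)) ≠ 0 := by exact_mod_cast hε.ne'
    have e4 : (1 + ((ε : ℂ)⁻¹ * t) ^ 2) ≠ 0 := by
      have : (1 + (ε⁻¹ * t) ^ 2 : ℝ) ≠ 0 := by positivity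
      exact_mod_cast this
    have e5 : ε * (ε⁻¹ * t) = t := by field_simp
    simp only [kern, e5, Nat.cast_one, zpow_neg_one]
    rw [← mul_add]
    push_cast at e2 ⊢
    have e6 : ((t : ℂ) - ε * I)⁻¹ + (-(t : ℂ) - ε * I)⁻¹ = 2 * I / ε * (1 + ((ε : ℂ)⁻¹ * t) ^ 2)⁻¹ := by
      have : (1 + ((ε : ℂ)⁻¹ * t) ^ 2) = - ((t : ℂ) - ε * I) * (-(t : ℂ) - ε * I) / ε ^ 2 := by
        field_simp
        linear_combination (ε ^ 2 : ℂ) * Complex.I_sq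
      rw [this]
      field_simp
      ring
    rw [e6]
    ring
  rw [integral_const_mul, integral_complex_ofReal,
    Measure.integral_comp_mul_left (fun u => Real.exp (-b * (ε * u) ^ 2) * (1 + u ^ 2)⁻¹)] at h3
  rw [inv_inv, abs_of_pos hε, smul_eq_mul] at h3
  have e3 : ((ε : ℂ)) ≠ 0 := by exact_mod_cast hε.ne'
  rw [Complex.ofReal_mul] at h3
  refine mul_left_cancel₀ two_ne_zero (h3.trans ?_)
  generalize ((∫ u : ℝ, Real.exp (-b * (ε * u) ^ 2) * (1 + u ^ 2)⁻¹ : ℝ) : ℂ) = J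
  field_simp

lemma tendsto_gaussKern_one {b : ℝ} (hb : 0 < b) :
    Tendsto (gaussKern b 1) (𝓝[>] 0) (𝓝 (I * Real.pi)) := by
  have h1 : Tendsto (fun ε => ∫ u : ℝ, Real.exp (-b * (ε * u) ^ 2) * (1 + u ^ 2)⁻¹) (𝓝[>] 0)
      (𝓝 (∫ u : ℝ, (1 + u ^ 2)⁻¹)) := by
    refine tendsto_integral_filter_of_dominated_convergence (fun u => (1 + u ^ 2)⁻¹) ?_ ?_
      integrable_inv_one_add_sq ?_
    · refine Eventually.of_forall fun ε => Measurable.aestronglyMeasurable (by fun_prop)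
    · refine Eventually.of_forall fun ε => Eventually.of_forall fun u => ?_
      rw [Real.norm_of_nonneg (by positivity)]
      refine mul_le_of_le_one_left (by positivity) (Real.exp_le_one_iff.2 ?_)
      nlinarith [mul_nonneg hb.le (sq_nonneg (ε * u))]
    · refine Eventually.of_forall fun u => ?_
      have : Continuous fun ε : ℝ => Real.exp (-b * (ε * u) ^ 2) * (1 + u ^ 2)⁻¹ := by fun_prop
      have := (this.tendsto 0).mono_left (nhdsWithin_le_nhds (s := Set.Ioi 0))
      simpa using this
  rw [integral_univ_inv_one_add_sq] at h1
  refine (((Complex.continuous_ofReal.tendsto _).comp h1).const_mul I).congr' ?_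
  filter_upwards [self_mem_nhdsWithin] with ε hε
  exact (gaussKern_one hb hε).symm

lemma tendsto_gaussKern_add_two {b : ℝ} (hb : 0 < b) {m : ℕ} {g₀ g₁ : ℂ}
    (h₀ : Tendsto (gaussKern b m) (𝓝[>] 0) (𝓝 g₀))
    (h₁ : Tendsto (gaussKern b (m + 1)) (𝓝[>] 0) (𝓝 g₁)) :
    Tendsto (gaussKern b (m + 2)) (𝓝[>] 0) (𝓝 (-2 * b / (m + 1) * g₀)) := by
  have hε : Tendsto (fun ε : ℝ => (ε : ℂ) * I) (𝓝[>] 0) (𝓝 0) := by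
    have : Continuous fun ε : ℝ => (ε : ℂ) * I := by fun_prop
    simpa using (this.tendsto 0).mono_left (nhdsWithin_le_nhds (s := Set.Ioi 0))
  have := (h₀.add (hε.mul h₁)).const_mul (-2 * b / (m + 1) : ℂ)
  rw [zero_mul, add_zero] at this
  refine this.congr' ?_
  filter_upwards [self_mem_nhdsWithin] with ε hε
  exact (gaussKern_add_two hb hε m).symm

/-- `(1/2)_l / l!`, the Taylor coefficients of `(1 - x)^{-1/2}`. -/
noncomputable def qc : ℕ → ℝ
  | 0 => 1
  | l + 1 => qc l * (l + 1 / 2) / (l + 1)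

lemma qc_pos (l : ℕ) : 0 < qc l := by
  induction l with
  | zero => simp [qc]
  | succ l ih => rw [qc]; positivity

lemma qc_mul_factorial (k : ℕ) :
    qc k * k.factorial * Real.sqrt Real.pi = Real.Gamma (k + 1 / 2) := by
  induction k with
  | zero => rw [Nat.cast_zero, zero_add, Real.Gamma_one_half_eq]; simp [qc]
  | succ k ih =>
    rw [show ((k + 1 : ℕ) : ℝ) + 1 / 2 = (k + 1 / 2) + 1 by push_cast; ring,
      Real.Gamma_add_one (by positivity), ← ih, qc, Nat.factorial_succ]
    push_cast
    field_simp

lemma tendsto_gaussKern {b : ℝ} (hb : 0 < b) (k : ℕ) :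
    Tendsto (gaussKern b (2 * k)) (𝓝[>] 0)
      (𝓝 (((-b) ^ k * Real.sqrt (Real.pi / b) / (qc k * k.factorial) : ℝ) : ℂ)) ∧
    Tendsto (gaussKern b (2 * k + 1)) (𝓝[>] 0)
      (𝓝 (I * Real.pi * ((-b) ^ k / k.factorial : ℝ))) := by
  induction k with
  | zero =>
    constructor
    · simp [qc, funext (gaussKern_zero b)]
    · simpa using tendsto_gaussKern_one hb
  | succ k ih =>
    obtain ⟨h1, h2⟩ := ih
    have h3 := tendsto_gaussKern_add_two hb h1 h2
    have h4 := tendsto_gaussKern_add_two (m := 2 * k + 1) hb h2 h3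
    have hf : (k.factorial : ℂ) ≠ 0 := by exact_mod_cast k.factorial_ne_zero
    have hk : (k + 1 : ℂ) ≠ 0 := by exact_mod_cast k.succ_ne_zero
    have hk2 : (2 * k + 1 : ℂ) ≠ 0 := by exact_mod_cast (2 * k).succ_ne_zero
    have hq : (qc k : ℂ) ≠ 0 := by exact_mod_cast (qc_pos k).ne'
    constructor
    · rw [show 2 * (k + 1) = 2 * k + 2 by ring]
      convert h3 using 2
      rw [qc, Nat.factorial_succ]
      push_cast
      field_simp
      ring
    · rw [show 2 * (k + 1) + 1 = 2 * k + 1 + 2 by ring]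
      convert h4 using 2
      rw [Nat.factorial_succ]
      push_cast
      have : (2 * k + 1 + 1 : ℂ) = 2 * (k + 1) := by ring
      rw [this]
      field_simp
      ring

end Gaussian

section Remainder

open Complex (I)

namespace HasExpansion

variable {f g : ℝ → ℝ} {r : ℕ} {c d : ℕ → ℝ}

lemma congr_coeff (h : HasExpansion f r c) (hcd : ∀ l < r, c l = d l) : HasExpansion f r d := by
  refine Asymptotics.IsBigO.congr_left h fun σ => ?_
  rw [Finset.sum_congr rfl fun l hl => by rw [hcd l (Finset.mem_range.1 hl)]]

lemma sub (hf : HasExpansion f r c) (hg : HasExpansion g r d) :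
    HasExpansion (fun σ => f σ - g σ) r fun l => c l - d l := by
  refine (Asymptotics.IsBigO.sub hf hg).congr_left fun σ => ?_
  simp only [sub_mul, Finset.sum_sub_distrib]
  ring

lemma const_mul (hf : HasExpansion f r c) (a : ℝ) :
    HasExpansion (fun σ => a * f σ) r fun l => a * c l := by
  refine (Asymptotics.IsBigO.const_mul_left hf a).congr_left fun σ => ?_
  simp only [mul_sub, Finset.mul_sum, mul_assoc]

lemma sum {ι : Type*} (s : Finset ι) {f : ι → ℝ → ℝ} {c : ι → ℕ → ℝ}
    (h : ∀ i ∈ s, HasExpansion (f i) r (c i)) :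
    HasExpansion (fun σ => ∑ i ∈ s, f i σ) r fun l => ∑ i ∈ s, c i l := by
  refine (Asymptotics.IsBigO.fun_sum h).congr_left fun σ => ?_
  rw [Finset.sum_sub_distrib, Finset.sum_comm]
  simp only [Finset.sum_mul]

end HasExpansion

lemma hasExpansion_exp (b : ℝ) (r : ℕ) :
    HasExpansion (fun s => Real.exp (-b * s)) r fun l => (-b) ^ l / l.factorial := by
  have ht : Tendsto (fun s : ℝ => -b * s) (𝓝[>] 0) (𝓝 0) := by
    have : Continuous fun s : ℝ => -b * s := by fun_prop
    simpa using (this.tendsto 0).mono_left (nhdsWithin_le_nhds (s := Set.Ioi 0))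
  have h := (Real.exp_sub_sum_range_isBigO_pow r).comp_tendsto ht
  have h2 : ((fun x : ℝ => x ^ r) ∘ fun s => -b * s) =O[𝓝[>] 0] fun s : ℝ => s ^ r := by
    refine ((Asymptotics.isBigO_refl (fun s : ℝ => s ^ r) _).const_mul_left ((-b) ^ r)).congr_left
      fun s => ?_
    simp only [Function.comp_apply, mul_pow]
  refine (h.trans h2).congr_left fun s => ?_
  simp only [Function.comp_apply, mul_pow, div_mul_eq_mul_div]

lemma exists_exp_jet (r : ℕ) (c : ℕ → ℝ) :
    ∃ a : Fin r → ℝ, ∀ l < r, ∑ i, a i * ((-(i + 1 : ℝ)) ^ l / l.factorial) = c l := by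
  let v : Fin r → ℝ := fun i => -(i + 1)
  have hv : Function.Injective v := fun i j h => by
    simp only [v, neg_inj, add_left_inj, Nat.cast_inj] at h
    exact Fin.ext h
  have hdet : IsUnit (Matrix.vandermonde v).det :=
    isUnit_iff_ne_zero.2 (Matrix.det_vandermonde_ne_zero_iff.2 hv)
  refine ⟨Matrix.vecMul (fun l : Fin r => c l * (l : ℕ).factorial) (Matrix.vandermonde v)⁻¹,
    fun l hl => ?_⟩
  have h1 : Matrix.vecMul (Matrix.vecMul (fun l : Fin r => c l * (l : ℕ).factorial)
      (Matrix.vandermonde v)⁻¹) (Matrix.vandermonde v) ⟨l, hl⟩ = c l * l.factorial := by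
    rw [Matrix.vecMul_vecMul, Matrix.nonsing_inv_mul _ hdet, Matrix.vecMul_one]
  have h2 : (l.factorial : ℝ) ≠ 0 := by exact_mod_cast l.factorial_ne_zero
  simp only [← mul_div_assoc]
  rw [← Finset.sum_div, div_eq_iff h2, ← h1]
  simp only [Matrix.vecMul, dotProduct, Matrix.vandermonde_apply, v]

/-- `f` is `O(s^r)` at `0` and decays exponentially. -/
def IsSmall (f : ℝ → ℝ) (r : ℕ) : Prop :=
  Measurable f ∧ ∃ C, ∀ s, 0 < s → |f s| ≤ C * (s ^ r * Real.exp (-s))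

lemma IsSmall.exists_nonneg {f : ℝ → ℝ} {r : ℕ} (h : IsSmall f r) :
    ∃ C, 0 ≤ C ∧ ∀ s, 0 < s → |f s| ≤ C * (s ^ r * Real.exp (-s)) := by
  obtain ⟨-, C, hC⟩ := h
  refine ⟨|C|, abs_nonneg C, fun s hs => (hC s hs).trans ?_⟩
  gcongr
  exact le_abs_self C

lemma exists_isSmall {ψ : ℝ → ℝ} (hψ : Measurable ψ) {M B : ℝ} (hM : ∀ s, 0 < s → |ψ s| ≤ M)
    (hB : ∀ s, B < s → ψ s = 0) {r : ℕ} {c : ℕ → ℝ} (h : HasExpansion ψ r c) :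
    ∃ a : Fin r → ℝ, (∀ l < r, ∑ i, a i * ((-(i + 1 : ℝ)) ^ l / l.factorial) = c l) ∧
      IsSmall (fun s => ψ s - ∑ i, a i * Real.exp (-(i + 1 : ℝ) * s)) r := by
  obtain ⟨a, ha⟩ := exists_exp_jet r c
  refine ⟨a, ha, by fun_prop, ?_⟩
  set R : ℝ → ℝ := fun s => ψ s - ∑ i, a i * Real.exp (-(i + 1 : ℝ) * s) with hR
  have hexp : HasExpansion R r fun _ => 0 := by
    refine (h.sub (HasExpansion.sum Finset.univ fun (i : Fin r) _ =>
      (hasExpansion_exp (i + 1 : ℝ) r).const_mul (a i))).congr_coeff fun l hl => ?_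
    rw [ha l hl, sub_self]
  simp only [HasExpansion, zero_mul, Finset.sum_const_zero, sub_zero] at hexp
  obtain ⟨C, hC⟩ := hexp.bound
  obtain ⟨δ, hδ, hC⟩ := mem_nhdsGT_iff_exists_Ioo_subset.1 hC
  simp only [Set.mem_Ioi] at hδ
  set A := ∑ i, |a i|
  have hA : 0 ≤ A := Finset.sum_nonneg fun i _ => abs_nonneg _
  have hM0 : 0 ≤ M := (abs_nonneg _).trans (hM 1 one_pos)
  refine ⟨|C| * Real.exp δ + (M * Real.exp B + A) / δ ^ r, fun s hs => ?_⟩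
  rcases lt_or_ge s δ with hsδ | hsδ
  · have h1 := hC ⟨hs, hsδ⟩
    simp only [Set.mem_ofPred_eq, Real.norm_eq_abs, abs_of_pos (pow_pos hs r)] at h1
    calc |R s| ≤ |C| * s ^ r := h1.trans (by gcongr; exact le_abs_self C)
      _ ≤ |C| * s ^ r * (Real.exp δ * Real.exp (-s)) := by
          refine le_mul_of_one_le_right (by positivity) ?_
          rw [← Real.exp_add]
          exact Real.one_le_exp (by linarith)
      _ = |C| * Real.exp δ * (s ^ r * Real.exp (-s)) := by ring
      _ ≤ _ := by
          gcongr
          exact le_add_of_nonneg_right (by positivity)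
  · have h1 : |ψ s| ≤ M * Real.exp B * Real.exp (-s) := by
      rcases lt_or_ge B s with hBs | hBs
      · rw [hB s hBs, abs_zero]; positivity
      · rw [mul_assoc, ← Real.exp_add]
        exact (hM s hs).trans (le_mul_of_one_le_right hM0 (Real.one_le_exp (by linarith)))
    have h2 : |∑ i, a i * Real.exp (-(i + 1 : ℝ) * s)| ≤ A * Real.exp (-s) := by
      rw [Finset.sum_mul]
      refine (Finset.abs_sum_le_sum_abs _ _).trans (Finset.sum_le_sum fun i _ => ?_)
      rw [abs_mul, abs_of_pos (Real.exp_pos _)]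
      gcongr
      have : (0 : ℝ) ≤ i := Nat.cast_nonneg _
      nlinarith
    calc |R s| ≤ (M * Real.exp B + A) * Real.exp (-s) := by
          rw [add_mul]; exact (abs_sub _ _).trans (add_le_add h1 h2)
      _ ≤ (M * Real.exp B + A) * Real.exp (-s) * (s ^ r / δ ^ r) := by
          refine le_mul_of_one_le_right (by positivity) ?_
          rw [one_le_div (by positivity)]
          gcongr
      _ = (M * Real.exp B + A) / δ ^ r * (s ^ r * Real.exp (-s)) := by ring
      _ ≤ _ := by
          gcongr
          exact le_add_of_nonneg_left (by positivity)

lemma ae_ne_zero : ∀ᵐ t : ℝ, t ≠ 0 := by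
  simp [ae_iff]

lemma integrable_abs_pow_mul_exp (p : ℕ) :
    Integrable fun t : ℝ => |t| ^ p * Real.exp (-t ^ 2) := by
  have := (integrable_rpow_mul_exp_neg_mul_sq one_pos
    (s := p) (by have : (0 : ℝ) ≤ p := p.cast_nonneg
                 linarith)).norm
  refine this.congr (Eventually.of_forall fun t => ?_)
  simp

lemma IsSmall.measurable {f : ℝ → ℝ} {r : ℕ} (h : IsSmall f r) : Measurable f := h.1

lemma IsSmall.integrable_sq {f : ℝ → ℝ} {r : ℕ} (h : IsSmall f r) :
    Integrable fun t : ℝ => f (t ^ 2) := by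
  obtain ⟨C, hC⟩ := h.2
  refine ((integrable_abs_pow_mul_exp (2 * r)).const_mul C).mono'
    (h.measurable.comp (by fun_prop)).aestronglyMeasurable ?_
  filter_upwards [ae_ne_zero] with t ht
  have := hC (t ^ 2) (by positivity)
  rwa [← sq_abs t, ← pow_mul, sq_abs] at this

lemma IsSmall.tendsto_integral_kern {f : ℝ → ℝ} {r m : ℕ} (h : IsSmall f r) (hm : m ≤ 2 * r) :
    Tendsto (fun ε => ∫ t : ℝ, (f (t ^ 2) : ℂ) * kern m ε t) (𝓝[>] 0)
      (𝓝 (∫ t : ℝ, (f (t ^ 2) : ℂ) * (t : ℂ) ^ (-(m : ℤ)))) := by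
  obtain ⟨C, hC⟩ := h.2
  refine tendsto_integral_filter_of_dominated_convergence
    (fun t => C * (|t| ^ (2 * r - m) * Real.exp (-t ^ 2))) ?_ ?_
    ((integrable_abs_pow_mul_exp _).const_mul C) ?_
  · filter_upwards [self_mem_nhdsWithin] with ε hε
    exact (integrable_mul_kern hε m h.integrable_sq.ofReal).aestronglyMeasurable
  · refine Eventually.of_forall fun ε => ?_
    filter_upwards [ae_ne_zero] with t ht
    have ht' : 0 < |t| := abs_pos.2 ht
    have h1 := hC (t ^ 2) (by positivity)
    rw [norm_mul, Complex.norm_real, Real.norm_eq_abs]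
    calc |f (t ^ 2)| * ‖kern m ε t‖
        ≤ (C * ((t ^ 2) ^ r * Real.exp (-t ^ 2))) * (|t| ^ m)⁻¹ :=
          mul_le_mul h1 (norm_kern_le_of_ne_zero ht m ε) (norm_nonneg _)
            ((abs_nonneg _).trans h1)
      _ = _ := by
          rw [← sq_abs t, ← pow_mul, pow_sub₀ _ ht'.ne' hm, sq_abs]
          ring
  · filter_upwards [ae_ne_zero] with t ht
    exact (tendsto_kern ht m).const_mul _

variable {ψ : ℝ → ℝ} {r : ℕ} {a : Fin r → ℝ}

lemma integral_kern_eq (h : IsSmall (fun s => ψ s - ∑ i, a i * Real.exp (-(i + 1 : ℝ) * s)) r)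
    (m : ℕ) {ε : ℝ} (hε : 0 < ε) :
    ∫ t : ℝ, (ψ (t ^ 2) : ℂ) * kern m ε t =
      (∫ t : ℝ, ((ψ (t ^ 2) - ∑ i, a i * Real.exp (-(i + 1 : ℝ) * t ^ 2) : ℝ) : ℂ) * kern m ε t) +
        ∑ i, (a i : ℂ) * gaussKern (i + 1) m ε := by
  have hI : ∀ i : Fin r, Integrable fun t : ℝ =>
      (a i : ℂ) * ((Real.exp (-(i + 1 : ℝ) * t ^ 2) : ℂ) * kern m ε t) := fun i =>
    (integrable_mul_kern hε m (integrable_gauss (by positivity))).const_mul _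
  have hI' : Integrable fun t : ℝ => ((ψ (t ^ 2) -
      ∑ i, a i * Real.exp (-(i + 1 : ℝ) * t ^ 2) : ℝ) : ℂ) * kern m ε t :=
    integrable_mul_kern hε m h.integrable_sq.ofReal
  simp only [gaussKern, ← integral_const_mul]
  rw [← integral_finsetSum _ fun i _ => hI i, ← integral_add hI' (integrable_finsetSum _ fun i _ => hI i)]
  refine integral_congr_ae (Eventually.of_forall fun t => ?_)
  push_cast
  simp only [sub_mul, Finset.sum_mul, mul_assoc, sub_add_cancel]

lemma tendsto_integral_kern_odd {ψ : ℝ → ℝ} (hψ : Measurable ψ) {M B : ℝ}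
    (hM : ∀ s, 0 < s → |ψ s| ≤ M) (hB : ∀ s, B < s → ψ s = 0) {k : ℕ} {c : ℕ → ℝ}
    (h : HasExpansion ψ (k + 1) c) :
    Tendsto (fun ε => ∫ t : ℝ, (ψ (t ^ 2) : ℂ) * kern (2 * k + 1) ε t) (𝓝[>] 0)
      (𝓝 (I * Real.pi * c k)) := by
  obtain ⟨a, ha, hs⟩ := exists_isSmall hψ hM hB h
  have h1 := hs.tendsto_integral_kern (m := 2 * k + 1) (by omega)
  have h0 : ∫ t : ℝ, ((ψ (t ^ 2) - ∑ i, a i * Real.exp (-(i + 1 : ℝ) * t ^ 2) : ℝ) : ℂ) *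
      (t : ℂ) ^ (-((2 * k + 1 : ℕ) : ℤ)) = 0 := by
    refine self_eq_neg.1 ?_
    nth_rewrite 1 [← integral_neg_eq_self]
    rw [← integral_neg]
    refine integral_congr_ae (Eventually.of_forall fun t => ?_)
    have hodd : Odd (-((2 * k + 1 : ℕ) : ℤ)) := by
      rw [odd_neg]; exact_mod_cast odd_two_mul_add_one k
    simp only [neg_sq, Complex.ofReal_neg, hodd.neg_zpow, mul_neg]
  rw [h0] at h1
  have h2 := h1.add (tendsto_finsetSum Finset.univ fun (i : Fin (k + 1)) _ =>
    (tendsto_gaussKern (b := i + 1) (by positivity) k).2.const_mul (a i : ℂ))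
  rw [zero_add] at h2
  convert h2.congr' ?_ using 2
  · rw [← ha k (by omega)]
    push_cast
    rw [Finset.mul_sum]
    exact Finset.sum_congr rfl fun i _ => by ring
  · filter_upwards [self_mem_nhdsWithin] with ε hε
    exact (integral_kern_eq hs _ hε).symm

end Remainder

section Abel

lemma eqOn_rpow_two {f : ℝ → ℝ} : Set.EqOn
    (fun x : ℝ => (2 * x ^ ((2 : ℝ) - 1)) • ((Real.sqrt (x ^ (2 : ℝ)))⁻¹ * f (x ^ (2 : ℝ))))
    (fun x => 2 * f (x ^ 2)) (Set.Ioi 0) := by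
  intro x hx
  have hx' : (0 : ℝ) < x := hx
  have h1 : x ^ ((2 : ℝ) - 1) = x := by rw [show (2 : ℝ) - 1 = 1 by norm_num, Real.rpow_one]
  simp only [h1, Real.rpow_two, Real.sqrt_sq hx'.le, smul_eq_mul]
  field_simp

lemma integral_comp_sq (f : ℝ → ℝ) :
    ∫ w : ℝ, f (w ^ 2) = ∫ s : ℝ, (Real.sqrt s)⁻¹ * f s := by
  have h1 := integral_comp_abs (f := fun w => f (w ^ 2))
  simp only [sq_abs] at h1
  rw [h1, ← integral_const_mul, ← setIntegral_congr_fun measurableSet_Ioi eqOn_rpow_two,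
    integral_comp_rpow_Ioi_of_pos (g := fun s => (Real.sqrt s)⁻¹ * f s) two_pos]
  refine setIntegral_eq_integral_of_forall_compl_eq_zero fun s hs => ?_
  rw [Real.sqrt_eq_zero_of_nonpos (not_lt.1 hs), inv_zero, zero_mul]

lemma integrable_of_comp_sq {f : ℝ → ℝ} (h : Integrable fun w : ℝ => f (w ^ 2)) :
    Integrable fun s => (Real.sqrt s)⁻¹ * f s := by
  have h1 : IntegrableOn (fun s => (Real.sqrt s)⁻¹ * f s) (Set.Ioi 0) := by
    rw [← integrableOn_Ioi_comp_rpow_iff _ (two_ne_zero (α := ℝ)), abs_two,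
      integrableOn_congr_fun eqOn_rpow_two measurableSet_Ioi]
    exact (h.const_mul 2).integrableOn
  refine (integrableOn_iff_integrable_of_support_subset fun s hs => ?_).1 h1
  by_contra h2
  exact hs (by simp [Real.sqrt_eq_zero_of_nonpos (not_lt.1 h2)])

lemma integral_add_sq (f : ℝ → ℝ) (σ : ℝ) :
    ∫ w : ℝ, f (σ + w ^ 2) = ∫ s : ℝ, (Real.sqrt (s - σ))⁻¹ * f s := by
  rw [integral_comp_sq fun s => f (σ + s),
    ← integral_sub_right_eq_self (fun s => (Real.sqrt s)⁻¹ * f (σ + s)) σ]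
  simp

lemma integrable_of_add_sq {f : ℝ → ℝ} {σ : ℝ} (h : Integrable fun w : ℝ => f (σ + w ^ 2)) :
    Integrable fun s => (Real.sqrt (s - σ))⁻¹ * f s := by
  have := (integrable_of_comp_sq (f := fun s => f (σ + s)) h).comp_sub_right σ
  simpa using this

lemma qc_identity (k : ℕ) (y : ℝ) :
    -(∑ l ∈ Finset.range (k + 1), qc l * y ^ l) / 2 +
      (1 - y) * ∑ l ∈ Finset.range (k + 1), qc l * (l * y ^ (l - 1)) =
    -((k + 1 / 2) * qc k * y ^ k) := by
  induction k with
  | zero => simp [qc]; ring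
  | succ k ih =>
    rw [Finset.sum_range_succ, Finset.sum_range_succ (fun l : ℕ => qc l * (l * y ^ (l - 1)))]
    have h : (k + 1 : ℝ) * qc (k + 1) = (k + 1 / 2) * qc k := by
      rw [qc]; field_simp
    simp only [Nat.add_sub_cancel]
    push_cast
    rw [pow_succ]
    linear_combination ih + y ^ k * h

lemma abs_invSqrt_sub_le (k : ℕ) {x : ℝ} (hx0 : 0 ≤ x) (hx : x ≤ 1 / 2) :
    |(Real.sqrt (1 - x))⁻¹ - ∑ l ∈ Finset.range (k + 1), qc l * x ^ l| ≤
      4 * ((k + 1 / 2) * qc k) * x ^ (k + 1) := by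
  set T : ℝ → ℝ := fun y => Real.sqrt (1 - y) * ∑ l ∈ Finset.range (k + 1), qc l * y ^ l with hT
  have hs : ∀ y ≤ (1 / 2 : ℝ), 1 / 2 ≤ Real.sqrt (1 - y) := fun y hy =>
    Real.le_sqrt_of_sq_le (by linarith)
  have hd : ∀ y ∈ Set.Icc 0 x, HasDerivWithinAt T
      (-((k + 1 / 2) * qc k * y ^ k) / Real.sqrt (1 - y)) (Set.Icc 0 x) y := by
    intro y hy
    have hy1 := hs y (hy.2.trans hx)
    have h1 : HasDerivAt (fun y : ℝ => Real.sqrt (1 - y)) (-1 / (2 * Real.sqrt (1 - y))) y :=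
      ((hasDerivAt_id y).const_sub 1).sqrt (by simp only [id]; linarith [hy.2])
    have h2 : HasDerivAt (fun y : ℝ => ∑ l ∈ Finset.range (k + 1), qc l * y ^ l)
        (∑ l ∈ Finset.range (k + 1), qc l * (l * y ^ (l - 1))) y :=
      HasDerivAt.fun_sum fun l _ => (hasDerivAt_pow l y).const_mul _
    refine (h1.mul h2).hasDerivWithinAt.congr_deriv ?_
    rw [← qc_identity k y]
    have h3 : Real.sqrt (1 - y) ^ 2 = 1 - y := Real.sq_sqrt (by linarith [hy.2])
    have h4 : Real.sqrt (1 - y) ≠ 0 := by linarith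
    generalize ∑ l ∈ Finset.range (k + 1), qc l * (l * y ^ (l - 1)) = A
    field_simp
    linear_combination (2 * A) * h3
  have hb : ∀ y ∈ Set.Ico 0 x, ‖-((k + 1 / 2) * qc k * y ^ k) / Real.sqrt (1 - y)‖ ≤
      2 * ((k + 1 / 2) * qc k) * x ^ k := by
    intro y hy
    have hy1 := hs y (hy.2.le.trans hx)
    have hq := qc_pos k
    have hy0 := hy.1
    have hyx : y ^ k ≤ x ^ k := pow_le_pow_left₀ hy.1 hy.2.le k
    rw [norm_div, norm_neg, Real.norm_of_nonneg (by positivity),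
      Real.norm_of_nonneg (by linarith), div_le_iff₀ (by linarith)]
    calc (k + 1 / 2) * qc k * y ^ k ≤ (2 * ((k + 1 / 2) * qc k) * x ^ k) * (1 / 2) := by
          have : (k + 1 / 2) * qc k * y ^ k ≤ (k + 1 / 2) * qc k * x ^ k := by gcongr
          linarith
      _ ≤ _ := by gcongr
  have h1 := norm_image_sub_le_of_norm_deriv_le_segment' hd hb x ⟨hx0, le_rfl⟩
  have hT0 : T 0 = 1 := by simp [hT, Finset.sum_range_succ', qc]
  rw [hT0, sub_zero, Real.norm_eq_abs] at h1
  have hx1 := hs x hx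
  have h2 : (Real.sqrt (1 - x))⁻¹ - ∑ l ∈ Finset.range (k + 1), qc l * x ^ l =
      -(T x - 1) / Real.sqrt (1 - x) := by
    have : Real.sqrt (1 - x) ≠ 0 := by linarith
    simp only [hT]
    field_simp
    ring
  rw [h2, abs_div, abs_neg, abs_of_nonneg (by linarith : 0 ≤ Real.sqrt (1 - x)),
    div_le_iff₀ (by linarith)]
  have hq := qc_pos k
  calc |T x - 1| ≤ (4 * ((k + 1 / 2) * qc k) * x ^ (k + 1)) * (1 / 2) := by
        refine h1.trans (le_of_eq ?_); ring
    _ ≤ _ := by gcongr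

lemma IsSmall.exists_le_exp {f : ℝ → ℝ} {r : ℕ} (h : IsSmall f r) :
    ∃ C, ∀ s, 0 < s → |f s| ≤ C * Real.exp (-(1 / 2) * s) := by
  obtain ⟨C, hC0, hC⟩ := h.exists_nonneg
  refine ⟨C * (2 ^ r * r.factorial), fun s hs => (hC s hs).trans ?_⟩
  rw [mul_assoc]
  refine mul_le_mul_of_nonneg_left ?_ hC0
  have h1 := Real.pow_div_factorial_le_exp (s / 2) (by positivity) r
  rw [div_le_iff₀ (by positivity), div_pow, div_le_iff₀ (by positivity)] at h1
  calc s ^ r * Real.exp (-s) ≤ (Real.exp (s / 2) * r.factorial * 2 ^ r) * Real.exp (-s) := by gcongr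
    _ = 2 ^ r * r.factorial * (Real.exp (s / 2) * Real.exp (-s)) := by ring
    _ = _ := by rw [← Real.exp_add]; congr 2; ring

lemma IsSmall.integrable_add_sq {f : ℝ → ℝ} {r : ℕ} (h : IsSmall f r) {σ : ℝ} (hσ : 0 ≤ σ) :
    Integrable fun w : ℝ => f (σ + w ^ 2) := by
  obtain ⟨C, hC⟩ := h.exists_le_exp
  have hC0 : 0 ≤ C := by
    have := (abs_nonneg _).trans (hC 1 one_pos)
    exact nonneg_of_mul_nonneg_left this (Real.exp_pos _)
  refine ((integrable_exp_neg_mul_sq (b := 1 / 2) (by norm_num)).const_mul C).mono'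
    (h.measurable.comp (by fun_prop)).aestronglyMeasurable ?_
  filter_upwards [ae_ne_zero] with w hw
  have hw2 : 0 < w ^ 2 := by positivity
  refine (hC _ (by positivity)).trans ?_
  exact mul_le_mul_of_nonneg_left (Real.exp_le_exp.2 (by linarith)) hC0

lemma IsSmall.integrable_sq_div {f : ℝ → ℝ} {r l : ℕ} (h : IsSmall f r) (hl : l ≤ r) :
    Integrable fun w : ℝ => f (w ^ 2) * ((w ^ 2) ^ l)⁻¹ := by
  obtain ⟨C, hC⟩ := h.2
  refine ((integrable_abs_pow_mul_exp (2 * (r - l))).const_mul C).mono'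
    ((h.measurable.comp (by fun_prop)).mul (by fun_prop)).aestronglyMeasurable ?_
  filter_upwards [ae_ne_zero] with w hw
  have hw2 : 0 < w ^ 2 := by positivity
  rw [norm_mul, Real.norm_eq_abs, norm_inv, Real.norm_of_nonneg (by positivity)]
  calc |f (w ^ 2)| * ((w ^ 2) ^ l)⁻¹ ≤ C * ((w ^ 2) ^ r * Real.exp (-w ^ 2)) * ((w ^ 2) ^ l)⁻¹ := by
        gcongr; exact hC _ hw2
    _ = _ := by
        rw [pow_mul, sq_abs, pow_sub₀ _ hw2.ne' hl]; ring

/-- Remainder in the expansion of the Abel kernel `(s - σ)^{-1/2}`. -/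
noncomputable def abelRem (k : ℕ) (σ s : ℝ) : ℝ :=
  (Real.sqrt (s - σ))⁻¹ - ∑ l ∈ Finset.range (k + 1), qc l * σ ^ l * ((s ^ l)⁻¹ * (Real.sqrt s)⁻¹)

lemma abelRem_of_nonpos (k : ℕ) {σ s : ℝ} (hσ : 0 ≤ σ) (hs : s ≤ 0) : abelRem k σ s = 0 := by
  simp [abelRem, Real.sqrt_eq_zero_of_nonpos hs, Real.sqrt_eq_zero_of_nonpos (by linarith : s - σ ≤ 0)]

lemma IsSmall.integral_abelRem {f : ℝ → ℝ} {k : ℕ} (h : IsSmall f k) {σ : ℝ} (hσ : 0 ≤ σ) :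
    Integrable (fun s => abelRem k σ s * f s) ∧
    ∫ s, abelRem k σ s * f s = (∫ w : ℝ, f (σ + w ^ 2)) -
      ∑ l ∈ Finset.range (k + 1), qc l * σ ^ l * ∫ w : ℝ, f (w ^ 2) * ((w ^ 2) ^ l)⁻¹ := by
  have h1 := integrable_of_add_sq (h.integrable_add_sq hσ)
  have h2 : ∀ l ∈ Finset.range (k + 1), Integrable fun s =>
      qc l * σ ^ l * ((Real.sqrt s)⁻¹ * (f s * (s ^ l)⁻¹)) := fun l hl =>
    (integrable_of_comp_sq (f := fun s => f s * (s ^ l)⁻¹) (h.integrable_sq_div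
      (by have := Finset.mem_range.1 hl; omega))).const_mul _
  have h3 : (fun s => abelRem k σ s * f s) = fun s => (Real.sqrt (s - σ))⁻¹ * f s -
      ∑ l ∈ Finset.range (k + 1), qc l * σ ^ l * ((Real.sqrt s)⁻¹ * (f s * (s ^ l)⁻¹)) := by
    ext s
    rw [abelRem, sub_mul, Finset.sum_mul]
    congr 1
    exact Finset.sum_congr rfl fun l _ => by ring
  rw [h3]
  refine ⟨h1.sub (integrable_finsetSum _ h2), ?_⟩
  rw [integral_sub h1 (integrable_finsetSum _ h2), integral_finsetSum _ h2, integral_add_sq]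
  simp only [integral_const_mul, ← integral_comp_sq fun s => f s * (s ^ _)⁻¹]

lemma abelRem_scale (k : ℕ) {σ : ℝ} (hσ : 0 < σ) (v : ℝ) :
    abelRem k σ (σ * v) = (Real.sqrt σ)⁻¹ * abelRem k 1 v := by
  have h1 : Real.sqrt (σ * v - σ) = Real.sqrt σ * Real.sqrt (v - 1) := by
    rw [← Real.sqrt_mul hσ.le]; congr 1; ring
  rw [abelRem, abelRem, h1, Real.sqrt_mul hσ.le, mul_sub, mul_inv, Finset.mul_sum]
  congr 1
  refine Finset.sum_congr rfl fun l _ => ?_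
  rw [mul_pow, mul_inv, mul_inv, one_pow]
  have : σ ^ l ≠ 0 := by positivity
  field_simp

lemma isSmall_model (k : ℕ) : IsSmall (fun s => s ^ k * Real.exp (-s)) k := by
  refine ⟨by fun_prop, 1, fun s hs => ?_⟩
  rw [abs_of_nonneg (by positivity), one_mul]

lemma abs_abelRem_le (k : ℕ) {v : ℝ} (hv : 2 < v) :
    |abelRem k 1 v * v ^ k| ≤ 4 * ((k + 1 / 2) * qc k) * v ^ (-(3 / 2) : ℝ) := by
  have hv0 : 0 < v := by linarith
  have h1 := abs_invSqrt_sub_le k (x := v⁻¹) (by positivity)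
    (by rw [one_div]; exact inv_anti₀ two_pos hv.le)
  have h2 : abelRem k 1 v * v ^ k = ((Real.sqrt v)⁻¹ * v ^ k) * ((Real.sqrt (1 - v⁻¹))⁻¹ -
      ∑ l ∈ Finset.range (k + 1), qc l * v⁻¹ ^ l) := by
    have h3 : Real.sqrt (v - 1) = Real.sqrt v * Real.sqrt (1 - v⁻¹) := by
      rw [← Real.sqrt_mul hv0.le]; congr 1; field_simp
    rw [abelRem, h3, mul_inv]
    simp only [one_pow, mul_one, inv_pow, sub_mul, mul_sub, Finset.sum_mul, Finset.mul_sum]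
    congr 1
    · ring
    · exact Finset.sum_congr rfl fun l _ => by ring
  have h4 : v ^ (-(3 / 2) : ℝ) = (Real.sqrt v)⁻¹ * v ^ k * v⁻¹ ^ (k + 1) := by
    rw [Real.sqrt_eq_rpow, ← Real.rpow_neg hv0.le, pow_succ, mul_assoc, ← mul_assoc (v ^ k),
      ← mul_pow, mul_inv_cancel₀ hv0.ne', one_pow, one_mul, ← Real.rpow_neg_one v,
      ← Real.rpow_add hv0]
    norm_num
  rw [h2, abs_mul, abs_of_nonneg (by positivity), h4]
  calc _ ≤ ((Real.sqrt v)⁻¹ * v ^ k) * (4 * ((k + 1 / 2) * qc k) * v⁻¹ ^ (k + 1)) := by gcongr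
    _ = _ := by ring

lemma integrable_abelRem (k : ℕ) : Integrable fun v => |abelRem k 1 v| * |v| ^ k := by
  have hmeas : Measurable fun v => |abelRem k 1 v| * |v| ^ k := by
    unfold abelRem; fun_prop
  have h1 : IntegrableOn (fun v => |abelRem k 1 v| * |v| ^ k) (Set.Iic 2) := by
    refine (((isSmall_model k).integral_abelRem zero_le_one).1.norm.const_mul
      (Real.exp 2)).integrableOn.mono' hmeas.aestronglyMeasurable ?_
    refine (ae_restrict_iff' measurableSet_Iic).2 (Eventually.of_forall fun v hv => ?_)
    rw [Real.norm_of_nonneg (by positivity), norm_mul, norm_mul, Real.norm_eq_abs, norm_pow,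
      Real.norm_eq_abs, Real.norm_of_nonneg (Real.exp_pos _).le]
    have : 1 ≤ Real.exp 2 * Real.exp (-v) := by
      rw [← Real.exp_add]; exact Real.one_le_exp (by linarith [Set.mem_Iic.1 hv])
    calc |abelRem k 1 v| * |v| ^ k ≤
        |abelRem k 1 v| * |v| ^ k * (Real.exp 2 * Real.exp (-v)) :=
          le_mul_of_one_le_right (by positivity) this
      _ = _ := by ring
  have h2 : IntegrableOn (fun v => |abelRem k 1 v| * |v| ^ k) (Set.Ioi 2) := by
    refine ((integrableOn_Ioi_rpow_of_lt (a := -(3 / 2)) (by norm_num) two_pos).const_mul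
      (4 * ((k + 1 / 2) * qc k))).mono' hmeas.aestronglyMeasurable ?_
    refine (ae_restrict_iff' measurableSet_Ioi).2 (Eventually.of_forall fun v hv => ?_)
    rw [Real.norm_of_nonneg (by positivity), ← abs_pow, ← abs_mul]
    exact abs_abelRem_le k hv
  rw [← integrableOn_univ, ← Set.Iic_union_Ioi (a := (2 : ℝ))]
  exact h1.union h2

/-- The Abel transform of a function that is `O(s^k)` has an expansion of order `k + 1/2`. -/
lemma IsSmall.isBigO_abel {f : ℝ → ℝ} {k : ℕ} (h : IsSmall f k) :
    (fun σ => (∫ w : ℝ, f (σ + w ^ 2)) -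
      ∑ l ∈ Finset.range (k + 1), (qc l * ∫ w : ℝ, f (w ^ 2) * ((w ^ 2) ^ l)⁻¹) * σ ^ l)
      =O[𝓝[>] 0] fun σ => σ ^ k * Real.sqrt σ := by
  obtain ⟨C, hC0, hC⟩ := h.exists_nonneg
  refine Asymptotics.IsBigO.of_bound (C * ∫ v, |abelRem k 1 v| * |v| ^ k) ?_
  filter_upwards [self_mem_nhdsWithin] with σ hσ
  have hσ' : 0 < σ := hσ
  obtain ⟨-, h2⟩ := h.integral_abelRem hσ'.le
  have h3 : (∫ w : ℝ, f (σ + w ^ 2)) - ∑ l ∈ Finset.range (k + 1),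
      (qc l * ∫ w : ℝ, f (w ^ 2) * ((w ^ 2) ^ l)⁻¹) * σ ^ l = ∫ s, abelRem k σ s * f s := by
    rw [h2]
    congr 1
    exact Finset.sum_congr rfl fun l _ => by ring
  have h4 : ∀ v, |abelRem k σ (σ * v)| * |σ * v| ^ k =
      (Real.sqrt σ)⁻¹ * σ ^ k * (|abelRem k 1 v| * |v| ^ k) := by
    intro v
    rw [abelRem_scale k hσ', abs_mul, abs_mul, abs_of_pos hσ', abs_of_nonneg (by positivity),
      mul_pow]
    ring
  have h5 : Integrable fun s => |abelRem k σ s| * |s| ^ k := by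
    have h6 := ((integrable_abelRem k).const_mul ((Real.sqrt σ)⁻¹ * σ ^ k)).comp_mul_left'
      (inv_ne_zero hσ'.ne')
    refine h6.congr (Eventually.of_forall fun s => ?_)
    simp only [← h4]
    rw [mul_inv_cancel_left₀ hσ'.ne']
  rw [h3, Real.norm_of_nonneg (by positivity : 0 ≤ σ ^ k * Real.sqrt σ)]
  calc ‖∫ s, abelRem k σ s * f s‖ ≤ ∫ s, C * (|abelRem k σ s| * |s| ^ k) := by
        refine norm_integral_le_of_norm_le (h5.const_mul C) (Eventually.of_forall fun s => ?_)
        rcases le_or_gt s 0 with hs | hs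
        · rw [abelRem_of_nonpos k hσ'.le hs, zero_mul, norm_zero, abs_zero, zero_mul, mul_zero]
        · rw [norm_mul, Real.norm_eq_abs, Real.norm_eq_abs, abs_of_pos hs]
          calc |abelRem k σ s| * |f s| ≤ |abelRem k σ s| * (C * (s ^ k * 1)) := by
                gcongr
                refine (hC s hs).trans ?_
                gcongr
                exact Real.exp_le_one_iff.2 (by linarith)
            _ = _ := by ring
    _ = C * (σ * ∫ v, |abelRem k σ (σ * v)| * |σ * v| ^ k) := by
        rw [integral_const_mul,
          Measure.integral_comp_mul_left (fun s => |abelRem k σ s| * |s| ^ k), abs_inv,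
          abs_of_pos hσ', smul_eq_mul, mul_inv_cancel_left₀ hσ'.ne']
    _ = _ := by
        simp only [h4]
        rw [integral_const_mul]
        have : Real.sqrt σ ≠ 0 := (Real.sqrt_pos.2 hσ').ne'
        have h7 : σ * (Real.sqrt σ)⁻¹ = Real.sqrt σ := by
          rw [← div_eq_mul_inv, Real.div_sqrt]
        calc _ = C * (σ * (Real.sqrt σ)⁻¹ * σ ^ k * ∫ v, |abelRem k 1 v| * |v| ^ k) := by ring
          _ = _ := by rw [h7]; ring

end Abel

section Even

lemma eq_zero_of_const_mul_isLittleO {a : ℝ} {k : ℕ}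
    (h : (fun σ : ℝ => a * σ ^ k) =o[𝓝[>] 0] fun σ => σ ^ k) : a = 0 := by
  by_contra ha
  refine Asymptotics.isLittleO_irrefl (Eventually.frequently ?_)
    ((Asymptotics.isLittleO_const_mul_left_iff ha).1 h)
  filter_upwards [self_mem_nhdsWithin] with σ hσ
  exact pow_ne_zero k (ne_of_gt hσ)

lemma pow_isLittleO_pow {k l : ℕ} (h : k < l) :
    (fun σ : ℝ => σ ^ l) =o[𝓝[>] 0] fun σ => σ ^ k :=
  (Asymptotics.isLittleO_pow_pow h).mono nhdsWithin_le_nhds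

lemma eq_zero_of_isLittleO {e : ℕ → ℝ} (k : ℕ)
    (h : (fun σ : ℝ => ∑ l ∈ Finset.range (k + 1), e l * σ ^ l) =o[𝓝[>] 0] fun σ => σ ^ k) :
    ∀ l ≤ k, e l = 0 := by
  induction k with
  | zero =>
    intro l hl
    rw [Nat.le_zero.1 hl]
    exact eq_zero_of_const_mul_isLittleO (k := 0) (by simpa using h)
  | succ k ih =>
    have h1 : ∀ l ≤ k, e l = 0 := by
      refine ih ?_
      refine ((h.trans (pow_isLittleO_pow k.lt_succ_self)).sub
        ((pow_isLittleO_pow k.lt_succ_self).const_mul_left (e (k + 1)))).congr_left fun σ => ?_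
      rw [Finset.sum_range_succ, add_sub_cancel_right]
    intro l hl
    rcases hl.lt_or_eq with hl | rfl
    · exact h1 l (by omega)
    · refine eq_zero_of_const_mul_isLittleO (h.congr_left fun σ => ?_)
      rw [Finset.sum_range_succ, Finset.sum_eq_zero, zero_add]
      intro l hl
      rw [h1 l (by have := Finset.mem_range.1 hl; omega), zero_mul]

lemma pow_mul_sqrt_isLittleO (k : ℕ) :
    (fun σ : ℝ => σ ^ k * Real.sqrt σ) =o[𝓝[>] 0] fun σ => σ ^ k := by
  have h : (fun σ : ℝ => Real.sqrt σ) =o[𝓝[>] 0] fun _ => (1 : ℝ) := by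
    rw [Asymptotics.isLittleO_one_iff]
    simpa using (Real.continuous_sqrt.tendsto 0).mono_left (nhdsWithin_le_nhds (s := Set.Ioi 0))
  simpa using (Asymptotics.isBigO_refl (fun σ : ℝ => σ ^ k) (𝓝[>] 0)).mul_isLittleO h

lemma HasExpansion.congr' {f g : ℝ → ℝ} {r : ℕ} {c : ℕ → ℝ} (h : HasExpansion f r c)
    (hfg : ∀ σ, 0 < σ → f σ = g σ) : HasExpansion g r c := by
  refine Asymptotics.IsBigO.congr' h ?_ EventuallyEq.rfl
  filter_upwards [self_mem_nhdsWithin] with σ hσ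
  rw [hfg σ hσ]

lemma integral_exp_add_sq {b : ℝ} (σ : ℝ) :
    ∫ w : ℝ, Real.exp (-b * (σ + w ^ 2)) = Real.sqrt (Real.pi / b) * Real.exp (-b * σ) := by
  rw [← integral_gaussian b, ← integral_mul_const]
  refine integral_congr_ae (Eventually.of_forall fun w => ?_)
  simp only [← Real.exp_add]
  congr 1; ring

lemma integrable_exp_add_sq {b : ℝ} (hb : 0 < b) (σ : ℝ) :
    Integrable fun w : ℝ => Real.exp (-b * (σ + w ^ 2)) := by
  refine ((integrable_exp_neg_mul_sq hb).mul_const (Real.exp (-b * σ))).congr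
    (Eventually.of_forall fun w => ?_)
  simp only [← Real.exp_add]
  congr 1; ring

lemma tendsto_integral_kern_even {ψ : ℝ → ℝ} (hψ : Measurable ψ) {M B : ℝ}
    (hM : ∀ s, 0 < s → |ψ s| ≤ M) (hB : ∀ s, B < s → ψ s = 0) {k : ℕ} {c d : ℕ → ℝ}
    (h : HasExpansion ψ k c) (hd : HasExpansion (fun σ => ∫ w : ℝ, ψ (σ + w ^ 2)) (k + 1) d) :
    Tendsto (fun ε => ∫ t : ℝ, (ψ (t ^ 2) : ℂ) * kern (2 * k) ε t) (𝓝[>] 0)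
      (𝓝 ((d k / qc k : ℝ) : ℂ)) := by
  obtain ⟨a, -, hs⟩ := exists_isSmall hψ hM hB h
  set R : ℝ → ℝ := fun s => ψ s - ∑ i, a i * Real.exp (-(i + 1 : ℝ) * s) with hR
  set J : ℝ := ∫ w : ℝ, R (w ^ 2) * ((w ^ 2) ^ k)⁻¹ with hJ
  set g : ℕ → ℝ := fun l => d l -
    ∑ i, a i * (Real.sqrt (Real.pi / (i + 1 : ℝ)) * ((-(i + 1 : ℝ)) ^ l / l.factorial)) with hg
  have hAbel : HasExpansion (fun σ => ∫ w : ℝ, R (σ + w ^ 2)) (k + 1) g := by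
    refine (hd.sub (HasExpansion.sum Finset.univ fun (i : Fin k) _ =>
      ((hasExpansion_exp (i + 1) (k + 1)).const_mul
        (Real.sqrt (Real.pi / (i + 1 : ℝ)))).const_mul (a i))).congr' fun σ hσ => ?_
    have hI : ∀ i : Fin k, Integrable fun w : ℝ =>
        a i * Real.exp (-(i + 1 : ℝ) * (σ + w ^ 2)) := fun i =>
      (integrable_exp_add_sq (by positivity) σ).const_mul _
    have h1 := hs.integrable_add_sq hσ.le
    have h2 : ∫ w : ℝ, ψ (σ + w ^ 2) = (∫ w : ℝ, R (σ + w ^ 2)) +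
        ∑ i : Fin k, ∫ w : ℝ, a i * Real.exp (-(i + 1 : ℝ) * (σ + w ^ 2)) := by
      rw [← integral_finsetSum _ fun i _ => hI i,
        ← integral_add h1 (integrable_finsetSum _ fun i _ => hI i)]
      simp only [hR, sub_add_cancel]
    simp only [h2, integral_const_mul, integral_exp_add_sq, add_sub_cancel_right]
  have hkey : g k = qc k * J := by
    have h1 := hs.isBigO_abel.trans_isLittleO (pow_mul_sqrt_isLittleO k)
    have h2 : (fun σ => (∫ w : ℝ, R (σ + w ^ 2)) - ∑ l ∈ Finset.range (k + 1), g l * σ ^ l)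
        =o[𝓝[>] 0] fun σ : ℝ => σ ^ k :=
      Asymptotics.IsBigO.trans_isLittleO hAbel (pow_isLittleO_pow k.lt_succ_self)
    have h3 := eq_zero_of_isLittleO (e := fun l => g l -
        qc l * ∫ w : ℝ, R (w ^ 2) * ((w ^ 2) ^ l)⁻¹) k <| by
      refine (h1.sub h2).congr_left fun σ => ?_
      simp only [sub_mul, Finset.sum_sub_distrib]
      ring
    exact sub_eq_zero.1 (h3 k le_rfl)
  have h1 := hs.tendsto_integral_kern (m := 2 * k) le_rfl
  have h0 : ∫ t : ℝ, (R (t ^ 2) : ℂ) * (t : ℂ) ^ (-((2 * k : ℕ) : ℤ)) = (J : ℂ) := by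
    rw [hJ, ← integral_complex_ofReal]
    refine integral_congr_ae (Eventually.of_forall fun t => ?_)
    simp only [zpow_neg, zpow_natCast, pow_mul]
    push_cast
    rfl
  rw [h0] at h1
  have h2 := h1.add (tendsto_finsetSum Finset.univ fun (i : Fin k) _ =>
    (tendsto_gaussKern (b := i + 1) (by positivity) k).1.const_mul (a i : ℂ))
  have hq := (qc_pos k).ne'
  have hf : (k.factorial : ℝ) ≠ 0 := by positivity
  have hval : d k / qc k = J + ∑ i : Fin k, a i *
      ((-(i + 1 : ℝ)) ^ k * Real.sqrt (Real.pi / (i + 1 : ℝ)) / (qc k * k.factorial)) := by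
    rw [div_eq_iff hq, add_mul, mul_comm J, ← hkey, Finset.sum_mul, hg]
    simp only
    rw [← sub_eq_iff_eq_add', sub_sub_cancel]
    refine Finset.sum_congr rfl fun i _ => ?_
    field_simp
  rw [hval]
  convert h2.congr' ?_ using 2
  · push_cast; rfl
  · filter_upwards [self_mem_nhdsWithin] with ε hε
    exact (integral_kern_eq hs (2 * k) hε).symm

end Even

namespace IsSlicing

variable {N : ℕ} {ν : EuclideanSpace ℝ (Fin N)}
  {i : EuclideanSpace ℝ (Fin (N - 1)) →ₗ[ℝ] EuclideanSpace ℝ (Fin N)}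

lemma exists_eq (h : IsSlicing ν i) (hν : ‖ν‖ = 1) (x : EuclideanSpace ℝ (Fin N)) :
    ∃ (w : ℝ) (z : _), x = w • ν + i z := by
  obtain ⟨z, hz⟩ := h.surj (x - inner ℝ ν x • ν) (by
    rw [inner_sub_right, inner_smul_right, real_inner_self_eq_norm_sq, hν]; ring)
  exact ⟨inner ℝ ν x, z, by rw [hz]; abel⟩

lemma inner_map (h : IsSlicing ν i) (y z : EuclideanSpace ℝ (Fin (N - 1))) :
    inner ℝ (i y) (i z) = inner ℝ y z :=
  LinearIsometry.inner_map_map ⟨i, h.norm_eq⟩ y z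

lemma setIntegral_comp_inner (h : IsSlicing ν i) (hν : ‖ν‖ = 1)
    {A : Set (EuclideanSpace ℝ (Fin N))} (hA : MeasurableSet A) {g : ℝ → ℂ}
    (hI : IntegrableOn (fun x => g (inner ℝ ν x)) A) :
    ∫ x in A, g (inner ℝ ν x) = ∫ t, (volume.real {z | t • ν + i z ∈ A} : ℂ) * g t := by
  have hin : ∀ (t : ℝ) z, inner ℝ ν (t • ν + i z) = t := fun t z => by
    rw [inner_add_right, inner_smul_right, real_inner_self_eq_norm_sq, hν, h.inner_eq]; ring
  have hI2 := (integrable_indicator_iff hA).2 hI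
  have hmeas : ∀ t : ℝ, MeasurableSet {z | t • ν + i z ∈ A} := fun t => by
    have : Measurable fun z => t • ν + i z :=
      (continuous_const.add i.continuous_of_finiteDimensional).measurable
    exact this hA
  rw [← integral_indicator hA, ← h.mp.map_eq,
    integral_map h.mp.measurable.aemeasurable (by rw [h.mp.map_eq]; exact hI2.aestronglyMeasurable),
    Measure.volume_eq_prod, integral_prod _ (by
      rw [← Measure.volume_eq_prod]; exact h.mp.integrable_comp_of_integrable hI2)]
  refine integral_congr_ae (Eventually.of_forall fun t => ?_)
  have h1 : (fun z => A.indicator (fun x => g (inner ℝ ν x)) (t • ν + i z)) =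
      {z | t • ν + i z ∈ A}.indicator fun _ => g t := by
    ext z
    by_cases hz : t • ν + i z ∈ A
    · rw [Set.indicator_of_mem hz, Set.indicator_of_mem (Set.mem_ofPred_eq ▸ hz), hin]
    · rw [Set.indicator_of_notMem hz, Set.indicator_of_notMem (Set.mem_ofPred_eq ▸ hz)]
  simp only [h1]
  rw [integral_indicator (hmeas t), setIntegral_const, Complex.real_smul]

end IsSlicing

namespace Shape

variable {N : ℕ} {ι : Type} {ν : EuclideanSpace ℝ (Fin N)}
  {i : EuclideanSpace ℝ (Fin (N - 1)) →ₗ[ℝ] EuclideanSpace ℝ (Fin N)}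

/-- The half-space whose trace on the hyperplane parametrized by `i` is `s`. -/
def lift (i : EuclideanSpace ℝ (Fin (N - 1)) →ₗ[ℝ] EuclideanSpace ℝ (Fin N)) (s : Shape (N - 1)) :
    Shape N := ⟨s.e, i s.c, s.ρ⟩

lemma exists_lift_eq (h : IsSlicing ν i) {T : Shape N} (hT : inner ℝ ν T.c = 0) :
    ∃ s, lift i s = T := by
  obtain ⟨z, hz⟩ := h.surj T.c hT
  exact ⟨⟨T.e, z, T.ρ⟩, by rw [lift, hz]⟩

lemma holds_lift (h : IsSlicing ν i) (hν : ‖ν‖ = 1) (s : Shape (N - 1)) (σ w : ℝ) (z) :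
    (lift i s).holds σ (w • ν + i z) ↔ s.holds (σ + w ^ 2) z := by
  have h1 : ‖w • ν + i z - i s.c‖ ^ 2 = w ^ 2 + ‖z - s.c‖ ^ 2 := by
    rw [add_sub_assoc, ← map_sub, h.norm_sq hν]
  have h2 : inner ℝ (i s.c) (w • ν + i z) = inner ℝ s.c z := by
    rw [inner_add_right, inner_smul_right, real_inner_comm, h.inner_eq, h.inner_map]; ring
  simp only [holds, lift, h1, h2]
  refine and_congr Iff.rfl ⟨fun h3 => ?_, fun h3 => ?_⟩ <;> linarith

lemma mem_slice_lift (h : IsSlicing ν i) (hν : ‖ν‖ = 1) (S : ι → Shape (N - 1)) (σ w : ℝ) (z) :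
    w • ν + i z ∈ slice (fun j => lift i (S j)) σ ↔ z ∈ slice S (σ + w ^ 2) :=
  forall_congr' fun j => holds_lift h hν (S j) σ w z

section Bounded

variable {S : ι → Shape (N - 1)} {B : ℝ}

lemma add_norm_sq_le (h : IsSlicing ν i) (hν : ‖ν‖ = 1)
    (hB : slice (fun j => lift i (S j)) 0 ⊆ closedBall 0 B) {σ : ℝ} (hσ : 0 ≤ σ) {z}
    (hz : z ∈ slice S σ) : σ + ‖z‖ ^ 2 ≤ B ^ 2 := by
  have h1 := hB ((mem_slice_lift h hν S 0 (Real.sqrt σ) z).2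
    (by rwa [Real.sq_sqrt hσ, zero_add]))
  rw [mem_closedBall_zero_iff] at h1
  have h2 := pow_le_pow_left₀ (norm_nonneg _) h1 2
  rwa [h.norm_sq hν, Real.sq_sqrt hσ] at h2

lemma slice_subset (h : IsSlicing ν i) (hν : ‖ν‖ = 1) (hB0 : 0 ≤ B)
    (hB : slice (fun j => lift i (S j)) 0 ⊆ closedBall 0 B) {σ : ℝ} (hσ : 0 ≤ σ) :
    slice S σ ⊆ closedBall 0 B := fun z hz => by
  have := add_norm_sq_le h hν hB hσ hz
  rw [mem_closedBall_zero_iff]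
  exact (sq_le_sq₀ (norm_nonneg _) hB0).1 (by linarith)

lemma slice_lift_subset (h : IsSlicing ν i) (hν : ‖ν‖ = 1) (hB0 : 0 ≤ B)
    (hB : slice (fun j => lift i (S j)) 0 ⊆ closedBall 0 B) {σ : ℝ} (hσ : 0 ≤ σ) :
    slice (fun j => lift i (S j)) σ ⊆ closedBall 0 B := fun x hx => by
  obtain ⟨w, z, rfl⟩ := h.exists_eq hν x
  have := add_norm_sq_le h hν hB (by positivity) ((mem_slice_lift h hν S σ w z).1 hx)
  rw [mem_closedBall_zero_iff, ← sq_le_sq₀ (norm_nonneg _) hB0, h.norm_sq hν]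
  linarith

lemma volume_slice_ne_top {M : ℕ} {S : ι → Shape M} {σ : ℝ} (h : slice S σ ⊆ closedBall 0 B) :
    volume (slice S σ) ≠ ⊤ :=
  measure_ne_top_of_subset h measure_closedBall_lt_top.ne

lemma area_eq_zero (h : IsSlicing ν i) (hν : ‖ν‖ = 1)
    (hB : slice (fun j => lift i (S j)) 0 ⊆ closedBall 0 B) (σ : ℝ) (hσ : B ^ 2 < σ) :
    area S σ = 0 := by
  have : slice S σ = ∅ := Set.eq_empty_of_forall_notMem fun z hz => by
    have := add_norm_sq_le h hν hB (by nlinarith [sq_nonneg B]) hz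
    nlinarith [sq_nonneg ‖z‖]
  rw [area, this, measureReal_empty]

lemma area_le (h : IsSlicing ν i) (hν : ‖ν‖ = 1) (hB0 : 0 ≤ B)
    (hB : slice (fun j => lift i (S j)) 0 ⊆ closedBall 0 B) (σ : ℝ) (hσ : 0 < σ) :
    |area S σ| ≤ volume.real (closedBall (0 : EuclideanSpace ℝ (Fin (N - 1))) B) := by
  rw [abs_of_nonneg (area_nonneg S σ)]
  exact measureReal_mono (slice_subset h hν hB0 hB hσ.le) measure_closedBall_lt_top.ne

lemma area_lift [Finite ι] (h : IsSlicing ν i) (hν : ‖ν‖ = 1) (hB0 : 0 ≤ B)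
    (hB : slice (fun j => lift i (S j)) 0 ⊆ closedBall 0 B) {σ : ℝ} (hσ : 0 ≤ σ) :
    area (fun j => lift i (S j)) σ = ∫ w : ℝ, area S (σ + w ^ 2) := by
  have h1 := h.setIntegral_comp_inner hν (measurableSet_slice (fun j => lift i (S j)) σ)
    (g := fun _ => 1) (integrableOn_const (volume_slice_ne_top (slice_lift_subset h hν hB0 hB hσ)))
  simp only [mem_slice_lift h hν, mul_one, setIntegral_const, Complex.real_smul] at h1
  rw [integral_complex_ofReal] at h1
  exact_mod_cast h1

lemma setIntegral_kern [Finite ι] (h : IsSlicing ν i) (hν : ‖ν‖ = 1)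
    (hB : slice (fun j => lift i (S j)) 0 ⊆ closedBall 0 B) (m : ℕ) {ε : ℝ} (hε : 0 < ε) :
    ∫ x in slice (fun j => lift i (S j)) 0, kern m ε (inner ℝ ν x) =
      ∫ t : ℝ, (area S (t ^ 2) : ℂ) * kern m ε t := by
  have hm := measurableSet_slice (fun j => lift i (S j)) 0
  rw [h.setIntegral_comp_inner hν hm (g := kern m ε)]
  · simp only [mem_slice_lift h hν, zero_add]; rfl
  · refine Measure.integrableOn_of_bounded (volume_slice_ne_top hB)
      ((continuous_kern hε m).comp (by fun_prop)).aestronglyMeasurable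
      (Eventually.of_forall fun x => norm_kern_le hε m _)

variable [Fintype ι] [LinearOrder ι]

theorem exists_tendsto_kern_odd (h : IsSlicing ν i) (hν : ‖ν‖ = 1) (hB0 : 0 ≤ B)
    (hB : slice (fun j => lift i (S j)) 0 ⊆ closedBall 0 B)
    (hρ : ∀ j, (S j).e ≠ 0 → 0 < (S j).ρ) {k m : ℕ} (hN : N = 2 * k + 1) (hm : 1 ≤ m)
    (hc : Fintype.card ι ≤ m) :
    ∃ L : ℂ, Tendsto (fun ε => ∫ t : ℝ, (area S (t ^ 2) : ℂ) * kern N ε t) (𝓝[>] 0) (𝓝 L) ∧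
      ‖L‖ ≤ halfFactorial m * (2 * Real.pi ^ ((N + 1 : ℝ) / 2) / Real.Gamma ((N + 1 : ℝ) / 2)) := by
  have hexp := hasExpansion_area S hρ
    (fun σ hσ => volume_slice_ne_top (slice_subset h hν hB0 hB hσ)) k
  have hbd := abs_coeff_le S (j := k) (m := m) (by omega) hm hc
  have hlim := tendsto_integral_kern_odd (measurable_area S) (area_le h hν hB0 hB)
    (area_eq_zero h hν hB) hexp
  rw [← hN] at hlim
  refine ⟨_, hlim, ?_⟩
  have hN' : (N + 1 : ℝ) / 2 = (k + 1 : ℕ) := by rw [hN]; push_cast; ring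
  rw [hN', Real.rpow_natCast, Nat.cast_succ, Real.Gamma_nat_eq_factorial, norm_mul, norm_mul,
    Complex.norm_I, Complex.norm_real, Complex.norm_real, Real.norm_of_nonneg Real.pi_pos.le,
    Real.norm_eq_abs, one_mul, mul_div_assoc', le_div_iff₀ (by positivity), pow_succ]
  calc Real.pi * |coeff S k| * k.factorial = Real.pi * (k.factorial * |coeff S k|) := by ring
    _ ≤ Real.pi * (2 * Real.pi ^ k * halfFactorial m) := by gcongr
    _ = _ := by ring

theorem exists_tendsto_kern_even (h : IsSlicing ν i) (hν : ‖ν‖ = 1) (hB0 : 0 ≤ B)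
    (hB : slice (fun j => lift i (S j)) 0 ⊆ closedBall 0 B)
    (hρ : ∀ j, (S j).e ≠ 0 → 0 < (S j).ρ) {k m : ℕ} (hk : k ≠ 0) (hN : N = 2 * k) (hm : 1 ≤ m)
    (hc : Fintype.card ι ≤ m) :
    ∃ L : ℂ, Tendsto (fun ε => ∫ t : ℝ, (area S (t ^ 2) : ℂ) * kern N ε t) (𝓝[>] 0) (𝓝 L) ∧
      ‖L‖ ≤ halfFactorial m * (2 * Real.pi ^ ((N + 1 : ℝ) / 2) / Real.Gamma ((N + 1 : ℝ) / 2)) := by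
  have hexp := hasExpansion_area S hρ
    (fun σ hσ => volume_slice_ne_top (slice_subset h hν hB0 hB hσ)) (k - 1)
  rw [Nat.sub_add_cancel (Nat.one_le_iff_ne_zero.2 hk)] at hexp
  set d := coeff fun j => lift i (S j)
  have hexp' : HasExpansion (fun σ => ∫ w : ℝ, area S (σ + w ^ 2)) (k + 1) d :=
    (hasExpansion_area (fun j => lift i (S j)) hρ (fun σ hσ => volume_slice_ne_top
      (slice_lift_subset h hν hB0 hB hσ)) k).congr' fun σ hσ => area_lift h hν hB0 hB hσ.le
  have hbd := abs_coeff_le (fun j => lift i (S j)) (j := k) (m := m) hN hm hc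
  have hlim := tendsto_integral_kern_even (measurable_area S) (area_le h hν hB0 hB)
    (area_eq_zero h hν hB) hexp hexp'
  rw [← hN] at hlim
  refine ⟨_, hlim, ?_⟩
  have hN' : (N + 1 : ℝ) / 2 = k + 1 / 2 := by rw [hN]; push_cast; ring
  have hq := qc_pos k
  have hπ := Real.sqrt_pos.2 Real.pi_pos
  rw [hN', Real.rpow_add Real.pi_pos, Real.rpow_natCast, ← Real.sqrt_eq_rpow, ← qc_mul_factorial,
    Complex.norm_real, Real.norm_eq_abs, abs_div, abs_of_pos hq, mul_div_assoc',
    div_le_div_iff₀ hq (by positivity)]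
  calc |d k| * (qc k * k.factorial * Real.sqrt Real.pi) =
        (k.factorial * |d k|) * (qc k * Real.sqrt Real.pi) := by ring
    _ ≤ (2 * Real.pi ^ k * halfFactorial m) * (qc k * Real.sqrt Real.pi) := by gcongr
    _ = _ := by ring

end Bounded

end Shape

lemma IsDHHalfSpace.exists_shape {n : ℕ} [NeZero n] {H : Set (EuclideanSpace ℝ (Fin n))}
    (h : IsDHHalfSpace H) : ∃ s : Shape n, s.c 0 = 0 ∧ (s.e ≠ 0 → 0 < s.ρ) ∧
      ∀ x, x ∈ H ↔ s.holds 0 x := by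
  obtain ⟨c, r, hr, hc, rfl⟩ | ⟨c, r, hr, hc, rfl⟩ | ⟨v, t, -, hv, rfl⟩ := h
  · refine ⟨⟨-1, c, r ^ 2⟩, hc, fun _ => by positivity, fun x => ?_⟩
    rw [mem_closedBall, dist_eq_norm, ← sq_le_sq₀ (norm_nonneg _) hr.le]
    norm_num [Shape.holds]
  · refine ⟨⟨1, c, r ^ 2⟩, hc, fun _ => by positivity, fun x => ?_⟩
    rw [Set.mem_compl_iff, mem_ball, not_lt, dist_eq_norm, ← sq_le_sq₀ hr.le (norm_nonneg _)]
    norm_num [Shape.holds]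
  · exact ⟨⟨0, v, t⟩, hv, fun h => absurd rfl h, fun x => by simp [Shape.holds]⟩

/-- **Theorem 1.3** (uniform boundedness of `V_n(P)`): if `P ⊆ ℝⁿ` is a bounded intersection
of at most `m` DH-half-spaces, then `V_n(P) = lim_{ε→0⁺} μ_ε(P)` exists and
`|V_n(P)| ≤ (m!/2^{m-1}) · V_n(Sⁿ)`, where `V_n(Sⁿ) = 2π^{(n+1)/2}/Γ((n+1)/2)`. -/
theorem dh_volume_le (n m : ℕ) [NeZero n] (hm : 1 ≤ m)
    (P : Set (EuclideanSpace ℝ (Fin n)))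
    (hP : ∃ S : Finset (Set (EuclideanSpace ℝ (Fin n))),
      S.card ≤ m ∧ (∀ H ∈ S, IsDHHalfSpace H) ∧ P = ⋂₀ ↑S)
    (hPb : Bornology.IsBounded P) :
    ∃ L : ℂ, Tendsto (fun ε : ℝ => dhInt n P ε) (nhdsWithin 0 (Set.Ioi 0)) (nhds L) ∧
      ‖L‖ ≤ (m.factorial : ℝ) / 2 ^ (m - 1) *
        (2 * Real.pi ^ ((n + 1 : ℝ) / 2) / Real.Gamma ((n + 1 : ℝ) / 2)) := by
  obtain ⟨F, hcard, hF, rfl⟩ := hP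
  set ν : EuclideanSpace ℝ (Fin n) := EuclideanSpace.single 0 1 with hν_def
  have hν : ‖ν‖ = 1 := by simp [hν_def]
  have hin : ∀ x, inner ℝ ν x = x 0 := fun x => by
    rw [hν_def, EuclideanSpace.inner_single_left]; simp
  obtain ⟨i, hi⟩ := exists_isSlicing hν
  have hex : ∀ j : Fin F.card, ∃ s : Shape (n - 1), (s.e ≠ 0 → 0 < s.ρ) ∧
      ∀ x, x ∈ (F.equivFin.symm j : Set _) ↔ (Shape.lift i s).holds 0 x := fun j => by
    obtain ⟨T, h1, h2, h3⟩ := (hF _ (F.equivFin.symm j).2).exists_shape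
    obtain ⟨s, rfl⟩ := Shape.exists_lift_eq hi (by rw [hin, h1] : inner ℝ ν T.c = 0)
    exact ⟨s, h2, h3⟩
  choose S hρ hS using hex
  have hP : ⋂₀ (F : Set (Set (EuclideanSpace ℝ (Fin n)))) =
      Shape.slice (fun j => Shape.lift i (S j)) 0 := by
    ext x
    refine ⟨fun h j => (hS j x).1 (h _ (F.equivFin.symm j).2), fun h H hH => ?_⟩
    simpa using (hS (F.equivFin ⟨H, hH⟩) x).2 (h _)
  rw [hP] at hPb ⊢
  obtain ⟨B, hB0, hB⟩ := hPb.subset_closedBall_lt 0 0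
  have h_int : ∀ ε ∈ Set.Ioi (0 : ℝ), ∫ t : ℝ, (Shape.area S (t ^ 2) : ℂ) * kern n ε t =
      dhInt n (Shape.slice (fun j => Shape.lift i (S j)) 0) ε := fun ε hε => by
    rw [← Shape.setIntegral_kern hi hν hB n hε, dhInt]
    simp only [hin, kern]
  have hc : Fintype.card (Fin F.card) ≤ m := by rwa [Fintype.card_fin]
  obtain ⟨k, hk | hk⟩ := Nat.even_or_odd' n
  · obtain ⟨L, h1, h2⟩ := Shape.exists_tendsto_kern_even hi hν hB0.le hB hρ
      (by rintro rfl; exact NeZero.ne n hk) hk hm hc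
    exact ⟨L, h1.congr' (eventually_nhdsWithin_of_forall h_int), h2⟩
  · obtain ⟨L, h1, h2⟩ := Shape.exists_tendsto_kern_odd hi hν hB0.le hB hρ hk hm hc
    exact ⟨L, h1.congr' (eventually_nhdsWithin_of_forall h_int), h2⟩
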